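/- arXiv:2511.21616 — 6 statements merged into one kernel-verified Lean document; each statement's English description precedes it below -/
import Mathlib

section
/- Let {k_1,...,k_6} ⊂ ℤ³ and C > 0 be such that Σ_{i=1}^6 k_i ⊗ k_i = C·Id and such that {k_i ⊗ k_i}_{i=1,...,6} is a basis of the space 𝒮³ of real symmetric 3×3 matrices. Then there exists a positive constant N₀ (depending on the family {k_i}) such that for every 0 < N ≤ N₀ there exist functions Γ_{k_1},...,Γ_{k_6} ∈ C^∞(S_N, (0,∞)), where S_N := {K ∈ 𝒮³ : |K − Id|_∞ ≤ N}, with the property that K = Σ_{i=1}^6 Γ_{k_i}(K)² k_i ⊗ k_i for every K ∈ S_N. -/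
noncomputable section

/-- Outer product `k ⊗ k` of an integer vector with itself, as a real 3×3 matrix
(matrices are modelled as elements of `Fin 3 → Fin 3 → ℝ`). -/
def outerZ (k : Fin 3 → ℤ) : Fin 3 → Fin 3 → ℝ := fun a b => (k a : ℝ) * (k b : ℝ)

/-- The 3×3 identity matrix. -/
def idM : Fin 3 → Fin 3 → ℝ := fun a b => if a = b then 1 else 0

/-- `S_N`: the set of symmetric 3×3 matrices `K` with `|K - Id|_∞ ≤ N`
(entrywise sup distance from the identity). -/
def SN (N : ℝ) : Set (Fin 3 → Fin 3 → ℝ) :=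
  {K | (∀ a b, K a b = K b a) ∧ ∀ a b, |K a b - idM a b| ≤ N}

/-- Geometric Lemma 1: if `Σ kᵢ ⊗ kᵢ = C·Id` and the `kᵢ ⊗ kᵢ` form a basis of the space of
symmetric 3×3 matrices, then there is `N₀ > 0` such that for every `0 < N ≤ N₀` there are
smooth positive functions `Γ_{kᵢ}` on `S_N` with `K = Σ Γ_{kᵢ}(K)² kᵢ ⊗ kᵢ` on `S_N`. -/
theorem stmt0 (k : Fin 6 → Fin 3 → ℤ) (C : ℝ) (hC : 0 < C)
    (hsum : ∀ a b, (∑ i : Fin 6, outerZ (k i) a b) = C * idM a b)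
    (hli : LinearIndependent ℝ (fun i : Fin 6 => outerZ (k i)))
    (hspan : ∀ M : Fin 3 → Fin 3 → ℝ, (∀ a b, M a b = M b a) →
      M ∈ Submodule.span ℝ (Set.range fun i : Fin 6 => outerZ (k i))) :
    ∃ N₀ : ℝ, 0 < N₀ ∧ ∀ N : ℝ, 0 < N → N ≤ N₀ →
      ∃ Γ : Fin 6 → (Fin 3 → Fin 3 → ℝ) → ℝ,
        (∀ i, ContDiffOn ℝ (⊤ : ℕ∞) (Γ i) (SN N)) ∧
        (∀ i, ∀ K ∈ SN N, 0 < Γ i K) ∧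
        (∀ K ∈ SN N, ∀ a b, K a b = ∑ i : Fin 6, (Γ i K) ^ 2 * outerZ (k i) a b) := by
  obtain ⟨L, hL⟩ := LinearMap.exists_leftInverse_of_injective
    (Fintype.linearCombination ℝ fun i : Fin 6 => outerZ (k i))
    (LinearMap.ker_eq_bot.2 hli.fintypeLinearCombination_injective)
  have hL_apply (c : Fin 6 → ℝ) : L (∑ i, c i • outerZ (k i)) = c := by
    simpa [Fintype.linearCombination_apply] using LinearMap.congr_fun hL c
  have hL_sum (K : Fin 3 → Fin 3 → ℝ) (hK : ∀ a b, K a b = K b a) :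
      ∑ i, L K i • outerZ (k i) = K := by
    obtain ⟨c, rfl⟩ := (Submodule.mem_span_range_iff_exists_fun ℝ).1 (hspan K hK)
    rw [hL_apply]
  have hL_id (i : Fin 6) : L idM i = C⁻¹ := by
    have h : ∑ i : Fin 6, (fun _ => C⁻¹ : Fin 6 → ℝ) i • outerZ (k i) = idM := by
      rw [← Finset.smul_sum]
      ext a b
      simp [Finset.sum_apply, hsum, hC.ne']
    rw [← h, hL_apply]
  have hL_cont : Continuous L := L.continuous_of_finiteDimensional
  have hopen : IsOpen {K : Fin 3 → Fin 3 → ℝ | ∀ i, 0 < L K i} := by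
    simp only [Set.ofPred_forall]
    exact isOpen_iInter_of_finite fun i =>
      isOpen_lt continuous_const ((continuous_apply i).comp hL_cont)
  obtain ⟨r, hr, hball⟩ := Metric.nhds_basis_closedBall.mem_iff.1
    (hopen.mem_nhds (x := idM) fun i => by rw [hL_id]; positivity)
  refine ⟨r, hr, fun N _ hNr => ⟨fun i K => √(L K i), ?_⟩⟩
  have hpos : ∀ K ∈ SN N, ∀ i, 0 < L K i := fun K hK => hball <| by
    rw [Metric.mem_closedBall, dist_pi_le_iff hr.le]
    intro a
    rw [dist_pi_le_iff hr.le]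
    intro b
    exact (hK.2 a b).trans hNr
  refine ⟨fun i => ?_, fun i K hK => Real.sqrt_pos.2 (hpos K hK i), fun K hK a b => ?_⟩
  · have hL_smooth : ContDiff ℝ (⊤ : ℕ∞) fun K => L K i :=
      contDiff_pi.1 L.toContinuousLinearMap.contDiff i
    exact hL_smooth.contDiffOn.sqrt fun K hK => (hpos K hK i).ne'
  · simp only [Real.sq_sqrt (hpos K hK _).le]
    simpa [Finset.sum_apply] using (congrFun (congrFun (hL_sum K hK.1) a) b).symm
end
end

section
/- Suppose {k_1, k_2, k_3} ⊂ ℤ³ is an orthogonal frame (three nonzero pairwise orthogonal vectors), and define k_4 := −(k_1 + k_2 + k_3). Then for any N₀ > 0 there exist real-valued affine functions Λ_{k_1},...,Λ_{k_4} on ℝ³ such that their restrictions to 𝒱_{N₀} := {u ∈ ℝ³ : |u| ≤ N₀} take values in [N₀, ∞), and u = Σ_{i=1}^4 Λ_{k_i}(u) k_i for every u ∈ 𝒱_{N₀}. -/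
open Matrix in
/-- Expansion of a vector in an orthogonal basis, in coordinates. -/
theorem sum_dotProduct_div_mul_eq_of_orthogonal {K n : Type*} [Field K] [Fintype n]
    (v : n → n → K) (hne : ∀ i, v i ⬝ᵥ v i ≠ 0) (horth : ∀ i j, i ≠ j → v i ⬝ᵥ v j = 0)
    (u : n → K) (a : n) :
    ∑ i, (v i ⬝ᵥ u) / (v i ⬝ᵥ v i) * v i a = u a := by
  classical
  let A : Matrix n n K := Matrix.of v
  let B : Matrix n n K := Matrix.of fun b i => v i b / (v i ⬝ᵥ v i)
  have hAB : A * B = 1 := by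
    ext i j
    have h : (A * B) i j = (v i ⬝ᵥ v j) / (v j ⬝ᵥ v j) := by
      simp [A, B, Matrix.mul_apply, dotProduct, Finset.sum_div, mul_div_assoc]
    rw [h, Matrix.one_apply]
    split_ifs with hij
    · subst hij
      exact div_self (hne i)
    · rw [horth i j hij, zero_div]
  have hBA : B *ᵥ (A *ᵥ u) = u := by
    rw [Matrix.mulVec_mulVec, mul_eq_one_comm.mp hAB, Matrix.one_mulVec]
  refine Eq.trans (Finset.sum_congr rfl fun i _ => ?_) (congrFun hBA a)
  change (v i ⬝ᵥ u) / (v i ⬝ᵥ v i) * v i a = v i a / (v i ⬝ᵥ v i) * (v i ⬝ᵥ u)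
  ring

/-- A nonzero integer vector has squared Euclidean length at least one. -/
theorem one_le_dotProduct_self_intCast {n : Type*} [Fintype n] {v : n → ℤ} (hv : v ≠ 0) :
    (1 : ℝ) ≤ (fun a => (v a : ℝ)) ⬝ᵥ (fun a => (v a : ℝ)) := by
  have h0 : 0 ≤ v ⬝ᵥ v := Finset.sum_nonneg fun a _ => mul_self_nonneg (v a)
  have h1 : v ⬝ᵥ v ≠ 0 := fun h => hv (dotProduct_self_eq_zero.mp h)
  have h2 : (1 : ℤ) ≤ v ⬝ᵥ v := by omega
  have h3 : ((1 : ℤ) : ℝ) ≤ ((v ⬝ᵥ v : ℤ) : ℝ) := Int.cast_le.mpr h2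
  simpa [dotProduct] using h3

/-- If `v` has length at least one, the coefficient along `v` of the projection of `u` onto `v`
is bounded by the length of `u`. -/
theorem abs_dotProduct_div_le_sqrt {n : Type*} [Fintype n] {v : n → ℝ} (hv : 1 ≤ v ⬝ᵥ v)
    (u : n → ℝ) : |(v ⬝ᵥ u) / (v ⬝ᵥ v)| ≤ √(∑ a, u a ^ 2) := by
  have hpos : 0 < v ⬝ᵥ v := by linarith
  have hu : 0 ≤ ∑ a, u a ^ 2 := Finset.sum_nonneg fun a _ => sq_nonneg (u a)
  have hcs : (v ⬝ᵥ u) ^ 2 ≤ (v ⬝ᵥ v) * ∑ a, u a ^ 2 := by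
    simpa [dotProduct, sq] using Finset.sum_mul_sq_le_sq_mul_sq Finset.univ v u
  apply Real.abs_le_sqrt
  rw [div_pow, div_le_iff₀ (by positivity)]
  nlinarith [mul_nonneg hu (mul_nonneg hpos.le (sub_nonneg.mpr hv))]

/-- Geometric Lemma 2: if `k₁, k₂, k₃ ∈ ℤ³` form an orthogonal frame and
`k₄ := −(k₁+k₂+k₃)`, then for every `N₀ > 0` there are affine functions
`Λ_{kᵢ}(u) = cᵢ + wᵢ·u` on `ℝ³` whose values on the ball `{|u| ≤ N₀}` lie in `[N₀, ∞)`
and which satisfy `u = Σᵢ Λ_{kᵢ}(u) kᵢ` on that ball.  (Indices: `i ≠ 3` are the three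
frame vectors, `i = 3` is `k₄`.) -/
theorem stmt1 (k : Fin 4 → Fin 3 → ℤ)
    (hnz : ∀ i : Fin 4, i ≠ 3 → k i ≠ 0)
    (horth : ∀ i j : Fin 4, i ≠ 3 → j ≠ 3 → i ≠ j → (∑ a : Fin 3, k i a * k j a) = 0)
    (hk4 : k 3 = -(k 0 + k 1 + k 2)) :
    ∀ N₀ : ℝ, 0 < N₀ →
      ∃ (c : Fin 4 → ℝ) (w : Fin 4 → Fin 3 → ℝ),
        ∀ u : Fin 3 → ℝ, Real.sqrt (∑ a : Fin 3, (u a) ^ 2) ≤ N₀ →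
          (∀ i : Fin 4, N₀ ≤ c i + ∑ a : Fin 3, w i a * u a) ∧
          (∀ a : Fin 3, u a = ∑ i : Fin 4, (c i + ∑ b : Fin 3, w i b * u b) * (k i a : ℝ)) := by
  intro N₀ hN
  let v : Fin 3 → Fin 3 → ℝ := fun i a => (k i.castSucc a : ℝ)
  have hlast : ∀ i : Fin 3, i.castSucc ≠ (3 : Fin 4) := fun i => Fin.castSucc_ne_last i
  have hv : ∀ i, 1 ≤ v i ⬝ᵥ v i := fun i => one_le_dotProduct_self_intCast (hnz _ (hlast i))
  have hvo : ∀ i j, i ≠ j → v i ⬝ᵥ v j = 0 := by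
    intro i j hij
    have h := horth _ _ (hlast i) (hlast j) fun h => hij (Fin.castSucc_injective 3 h)
    simp only [dotProduct, v]
    exact_mod_cast h
  let w : Fin 4 → Fin 3 → ℝ := Fin.snoc (fun i a => v i a / (v i ⬝ᵥ v i)) 0
  have hw : ∀ (i : Fin 3) (u : Fin 3 → ℝ),
      ∑ a, w i.castSucc a * u a = (v i ⬝ᵥ u) / (v i ⬝ᵥ v i) := by
    intro i u
    simp only [w, Fin.snoc_castSucc, dotProduct, Finset.sum_div]
    exact Finset.sum_congr rfl fun a _ => div_mul_eq_mul_div _ _ _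
  have hw_last : ∀ u : Fin 3 → ℝ, ∑ a, w (Fin.last 3) a * u a = 0 := by
    intro u
    simp only [w, Fin.snoc_last, Pi.zero_apply, zero_mul, Finset.sum_const_zero]
  refine ⟨fun _ => 2 * N₀, w, fun u hu => ⟨fun i => ?_, fun a => ?_⟩⟩
  · refine Fin.lastCases ?_ (fun i => ?_) i
    · rw [hw_last]
      linarith
    · rw [hw]
      linarith [(abs_le.mp ((abs_dotProduct_div_le_sqrt (hv i) u).trans hu)).1]
  · have hexp := sum_dotProduct_div_mul_eq_of_orthogonal v
      (fun i => (zero_lt_one.trans_le (hv i)).ne') hvo u a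
    have hk : (k (Fin.last 3) a : ℝ) = -∑ i, v i a := by
      rw [show Fin.last 3 = (3 : Fin 4) from rfl, hk4]
      simp [v, Fin.sum_univ_three]
    rw [Fin.sum_univ_castSucc, hw_last, hk]
    simp only [hw, add_mul, Finset.sum_add_distrib, ← Finset.mul_sum]
    change u a = 2 * N₀ * ∑ i, v i a + ∑ i, (v i ⬝ᵥ u) / (v i ⬝ᵥ v i) * v i a + _
    rw [hexp]
    ring
end

section
/- For every α ∈ [0,1] there exists a constant C (depending only on α) with the following property. Let t₀ ≤ t, let v : [t₀,t] × ℝ³ → ℝ³ and g : [t₀,t] × ℝ³ → ℝ be smooth and bounded together with all their spatial derivatives, and let f : [t₀,t] × ℝ³ → ℝ be a smooth bounded solution of the transport equation ∂_s f + v·∇f = g on [t₀,t] × ℝ³ with f(t₀,·) = f₀. Then ‖f(t,·)‖_α ≤ C e^{α (t−t₀) ‖v_{[t₀,t]}‖_1} ( ‖f₀‖_α + ∫_{t₀}^t ‖g(s,·)‖_α ds ). -/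
open Set MeasureTheory

noncomputable section

/-- Physical space `ℝ³`. -/
abbrev E3 := EuclideanSpace ℝ (Fin 3)

/-- Sup norm `‖f‖₀ = [f]₀`. -/
def sup0 {F : Type*} [NormedAddCommGroup F] (f : E3 → F) : ℝ := ⨆ x, ‖f x‖

/-- First-derivative seminorm `[f]₁`. -/
def sem1 {F : Type*} [NormedAddCommGroup F] [NormedSpace ℝ F] (f : E3 → F) : ℝ :=
  ⨆ x, ‖fderiv ℝ f x‖

/-- Hölder seminorm `[f]_α = sup_{x ≠ y} ‖f x − f y‖ / ‖x − y‖^α`. -/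
def hsem {F : Type*} [NormedAddCommGroup F] (α : ℝ) (f : E3 → F) : ℝ :=
  ⨆ p : { p : E3 × E3 // p.1 ≠ p.2 },
    ‖f p.1.1 - f p.1.2‖ / ‖p.1.1 - p.1.2‖ ^ α

/-- Hölder norm `‖f‖_α` for `α ∈ [0,1]`:  `‖f‖₀` for `α = 0`, `max(‖f‖₀, [f]₁)` for `α = 1`,
and `max(‖f‖₀, [f]_α)` for `α ∈ (0,1)`. -/
def Cnorm {F : Type*} [NormedAddCommGroup F] [NormedSpace ℝ F] (α : ℝ) (f : E3 → F) : ℝ :=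
  if α = 0 then sup0 f
  else if α = 1 then max (sup0 f) (sem1 f)
  else max (sup0 f) (hsem α f)

/-- `‖v_{[t₀,t]}‖₁ = sup_{s ∈ [t₀,t]} ‖v(s,·)‖₁`. -/
def vnorm1 (t₀ t : ℝ) (v : ℝ → E3 → E3) : ℝ :=
  ⨆ s : Icc t₀ t, max (sup0 (v s.1)) (sem1 (v s.1))

open Filter Topology

section Norms

variable {F : Type*} [NormedAddCommGroup F] {h : E3 → F} {M L α : ℝ}

theorem norm_le_sup0 (hM : ∀ x, ‖h x‖ ≤ M) (x : E3) : ‖h x‖ ≤ sup0 h :=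
  le_ciSup (f := fun x => ‖h x‖) ⟨M, by rintro _ ⟨y, rfl⟩; exact hM y⟩ x

theorem sup0_nonneg (h : E3 → F) : 0 ≤ sup0 h := Real.iSup_nonneg fun _ => norm_nonneg _

theorem hsem_nonneg (α : ℝ) (h : E3 → F) : 0 ≤ hsem α h :=
  Real.iSup_nonneg fun _ => by positivity

/-- A bounded Lipschitz function has uniformly bounded Hölder quotients. -/
theorem holder_quotient_le (hα : α ∈ Icc (0 : ℝ) 1) (hM : ∀ x, ‖h x‖ ≤ M)
    (hL : ∀ x y, ‖h x - h y‖ ≤ L * ‖x - y‖) (hL0 : 0 ≤ L) (x y : E3) :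
    ‖h x - h y‖ / ‖x - y‖ ^ α ≤ 2 * M + L := by
  have hM0 : 0 ≤ M := (norm_nonneg _).trans (hM x)
  rcases eq_or_ne x y with rfl | hxy
  · simp only [sub_self, norm_zero, zero_div]
    positivity
  have hd : 0 < ‖x - y‖ := norm_pos_iff.2 (sub_ne_zero.2 hxy)
  have hp : 0 < ‖x - y‖ ^ α := Real.rpow_pos_of_pos hd α
  rw [div_le_iff₀ hp]
  rcases le_total ‖x - y‖ 1 with h1 | h1
  · have hle : ‖x - y‖ ≤ ‖x - y‖ ^ α := by
      simpa using Real.rpow_le_rpow_of_exponent_ge hd h1 hα.2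
    calc ‖h x - h y‖ ≤ L * ‖x - y‖ := hL x y
      _ ≤ L * ‖x - y‖ ^ α := by gcongr
      _ ≤ (2 * M + L) * ‖x - y‖ ^ α := by gcongr; linarith
  · have hle : 1 ≤ ‖x - y‖ ^ α := Real.one_le_rpow h1 hα.1
    calc ‖h x - h y‖ ≤ ‖h x‖ + ‖h y‖ := norm_sub_le _ _
      _ ≤ (2 * M + L) * 1 := by linarith [hM x, hM y]
      _ ≤ (2 * M + L) * ‖x - y‖ ^ α := by gcongr

theorem norm_sub_le_hsem (hα : α ∈ Icc (0 : ℝ) 1) (hM : ∀ x, ‖h x‖ ≤ M)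
    (hL : ∀ x y, ‖h x - h y‖ ≤ L * ‖x - y‖) (hL0 : 0 ≤ L) (x y : E3) :
    ‖h x - h y‖ ≤ hsem α h * ‖x - y‖ ^ α := by
  rcases eq_or_ne x y with rfl | hxy
  · simpa using mul_nonneg (hsem_nonneg α h) (Real.rpow_nonneg le_rfl α)
  have hd : 0 < ‖x - y‖ := norm_pos_iff.2 (sub_ne_zero.2 hxy)
  rw [← div_le_iff₀ (Real.rpow_pos_of_pos hd α)]
  exact le_ciSup (f := fun p : { p : E3 × E3 // p.1 ≠ p.2 } =>
      ‖h p.1.1 - h p.1.2‖ / ‖p.1.1 - p.1.2‖ ^ α)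
    ⟨2 * M + L, by rintro _ ⟨p, rfl⟩; exact holder_quotient_le hα hM hL hL0 _ _⟩ ⟨(x, y), hxy⟩

theorem hsem_le {A : ℝ} (hA : 0 ≤ A) (hle : ∀ x y, ‖h x - h y‖ ≤ A * ‖x - y‖ ^ α) :
    hsem α h ≤ A :=
  Real.iSup_le (fun p => div_le_of_le_mul₀ (by positivity) hA (hle _ _)) hA

variable [NormedSpace ℝ F]

theorem norm_fderiv_le_sem1 (hL : ∀ x, ‖fderiv ℝ h x‖ ≤ L) (x : E3) :
    ‖fderiv ℝ h x‖ ≤ sem1 h :=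
  le_ciSup (f := fun x => ‖fderiv ℝ h x‖) ⟨L, by rintro _ ⟨y, rfl⟩; exact hL y⟩ x

theorem norm_sub_le_of_fderiv (hd : Differentiable ℝ h) (hL : ∀ x, ‖fderiv ℝ h x‖ ≤ L)
    (x y : E3) : ‖h x - h y‖ ≤ L * ‖x - y‖ :=
  convex_univ.norm_image_sub_le_of_norm_fderiv_le (fun z _ => hd z) (fun z _ => hL z)
    (mem_univ y) (mem_univ x)

theorem sem1_eq_hsem_one (hd : Differentiable ℝ h) (hM : ∀ x, ‖h x‖ ≤ M)
    (hL : ∀ x, ‖fderiv ℝ h x‖ ≤ L) : sem1 h = hsem 1 h := by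
  have hL0 : 0 ≤ L := (norm_nonneg _).trans (hL 0)
  apply le_antisymm
  · refine Real.iSup_le (fun x => norm_fderiv_le_of_lip' ℝ (hsem_nonneg 1 h) ?_) (hsem_nonneg 1 h)
    refine Eventually.of_forall fun y => ?_
    simpa using norm_sub_le_hsem (α := 1) ⟨zero_le_one, le_rfl⟩ hM
      (norm_sub_le_of_fderiv hd hL) hL0 y x
  · refine hsem_le (Real.iSup_nonneg fun _ => norm_nonneg _) fun x y => ?_
    simpa using norm_sub_le_of_fderiv hd (norm_fderiv_le_sem1 hL) x y

theorem Cnorm_eq_max (hα : α ≠ 0) (hd : Differentiable ℝ h) (hM : ∀ x, ‖h x‖ ≤ M)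
    (hL : ∀ x, ‖fderiv ℝ h x‖ ≤ L) : Cnorm α h = max (sup0 h) (hsem α h) := by
  rw [Cnorm, if_neg hα]
  split_ifs with h1
  · rw [sem1_eq_hsem_one hd hM hL, h1]
  · rfl

theorem sup0_le_Cnorm (α : ℝ) (h : E3 → F) : sup0 h ≤ Cnorm α h := by
  rw [Cnorm]
  split_ifs
  exacts [le_rfl, le_max_left _ _, le_max_left _ _]

end Norms

section Measurability

variable {F : Type*} [NormedAddCommGroup F] {g : ℝ → E3 → F} {a b M L α : ℝ}

theorem intervalIntegrable_of_eqOn_measurable {u w : ℝ → ℝ} (hab : a ≤ b) (hw : Measurable w)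
    (huw : EqOn w u (Icc a b)) {C : ℝ} (hC : ∀ s ∈ Icc a b, ‖u s‖ ≤ C) :
    IntervalIntegrable u volume a b := by
  have hi : IntegrableOn w (Icc a b) volume :=
    Measure.integrableOn_of_bounded (M := C) measure_Icc_lt_top.ne hw.aestronglyMeasurable
      ((ae_restrict_iff' measurableSet_Icc).2
        (Eventually.of_forall fun s hs => by rw [huw hs]; exact hC s hs))
  rw [intervalIntegrable_iff_integrableOn_Icc_of_le hab]
  exact hi.congr_fun huw measurableSet_Icc

theorem continuous_comp_projIcc (hab : a ≤ b) (hc : ∀ x, ContinuousOn (fun s => g s x) (Icc a b))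
    (x : E3) : Continuous fun s => g (projIcc a b hab s) x :=
  (hc x).comp_continuous (continuous_subtype_val.comp continuous_projIcc) fun s =>
    (projIcc a b hab s).2

theorem lowerSemicontinuous_sup0 (hab : a ≤ b)
    (hc : ∀ x, ContinuousOn (fun s => g s x) (Icc a b))
    (hM : ∀ s ∈ Icc a b, ∀ x, ‖g s x‖ ≤ M) :
    LowerSemicontinuous fun s => sup0 (g (projIcc a b hab s)) := by
  refine lowerSemicontinuous_ciSup (fun s => ⟨M, ?_⟩) fun x =>
    (continuous_comp_projIcc hab hc x).norm.lowerSemicontinuous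
  rintro _ ⟨x, rfl⟩
  exact hM _ (projIcc a b hab s).2 x

theorem lowerSemicontinuous_hsem (hα : α ∈ Icc (0 : ℝ) 1) (hab : a ≤ b)
    (hc : ∀ x, ContinuousOn (fun s => g s x) (Icc a b))
    (hM : ∀ s ∈ Icc a b, ∀ x, ‖g s x‖ ≤ M)
    (hL : ∀ s ∈ Icc a b, ∀ x y, ‖g s x - g s y‖ ≤ L * ‖x - y‖) (hL0 : 0 ≤ L) :
    LowerSemicontinuous fun s => hsem α (g (projIcc a b hab s)) := by
  refine lowerSemicontinuous_ciSup (fun s => ⟨2 * M + L, ?_⟩) fun p =>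
    (((continuous_comp_projIcc hab hc p.1.1).sub
      (continuous_comp_projIcc hab hc p.1.2)).norm.div_const _).lowerSemicontinuous
  rintro _ ⟨p, rfl⟩
  have hs := (projIcc a b hab s).2
  exact holder_quotient_le hα (hM _ hs) (hL _ hs) hL0 _ _

theorem intervalIntegrable_Cnorm [NormedSpace ℝ F] (hα : α ∈ Icc (0 : ℝ) 1) (hab : a ≤ b)
    (hc : ∀ x, ContinuousOn (fun s => g s x) (Icc a b))
    (hd : ∀ s ∈ Icc a b, Differentiable ℝ (g s))
    (hM : ∀ s ∈ Icc a b, ∀ x, ‖g s x‖ ≤ M)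
    (hL : ∀ s ∈ Icc a b, ∀ x, ‖fderiv ℝ (g s) x‖ ≤ L) :
    IntervalIntegrable (fun s => Cnorm α (g s)) volume a b := by
  have ha : a ∈ Icc a b := ⟨le_rfl, hab⟩
  have hM0 : 0 ≤ M := (norm_nonneg _).trans (hM a ha 0)
  have hL0 : 0 ≤ L := (norm_nonneg _).trans (hL a ha 0)
  have hLip : ∀ s ∈ Icc a b, ∀ x y, ‖g s x - g s y‖ ≤ L * ‖x - y‖ := fun s hs =>
    norm_sub_le_of_fderiv (hd s hs) (hL s hs)
  have hsup : ∀ s ∈ Icc a b, sup0 (g s) ≤ M := fun s hs => ciSup_le (hM s hs)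
  rcases eq_or_ne α 0 with rfl | hα0
  · refine intervalIntegrable_of_eqOn_measurable (C := M) hab
      (lowerSemicontinuous_sup0 hab hc hM).measurable (fun s hs => ?_) fun s hs => ?_
    · simp [Cnorm, projIcc_of_mem hab hs]
    · simpa [Cnorm, abs_of_nonneg (sup0_nonneg _)] using hsup s hs
  · refine intervalIntegrable_of_eqOn_measurable (C := 2 * M + L) hab
      ((lowerSemicontinuous_sup0 hab hc hM).sup
        (lowerSemicontinuous_hsem hα hab hc hM hLip hL0)).measurable
      (fun s hs => ?_) fun s hs => ?_
    · simp [Cnorm_eq_max hα0 (hd s hs) (hM s hs) (hL s hs), projIcc_of_mem hab hs]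
    · rw [Real.norm_of_nonneg ((sup0_nonneg _).trans (sup0_le_Cnorm _ _)),
        Cnorm_eq_max hα0 (hd s hs) (hM s hs) (hL s hs)]
      exact max_le ((hsup s hs).trans (by linarith))
        (Real.iSup_le (fun p => holder_quotient_le hα (hM s hs) (hLip s hs) hL0 _ _)
          (by positivity))

end Measurability

section Characteristics

variable {a b : ℝ} {v : ℝ → E3 → E3} {f g : ℝ → E3 → ℝ}

/-- A bounded, globally Lipschitz field has a characteristic through every point at time `b`. -/
theorem exists_characteristic (hab : a ≤ b) {B K : ℝ}
    (hc : ∀ x, ContinuousOn (fun s => v s x) (Icc a b))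
    (hB : ∀ s ∈ Icc a b, ∀ x, ‖v s x‖ ≤ B)
    (hK : ∀ s ∈ Icc a b, ∀ x y, ‖v s x - v s y‖ ≤ K * ‖x - y‖) (hK0 : 0 ≤ K) (x : E3) :
    ∃ X : ℝ → E3, X b = x ∧
      ∀ s ∈ Icc a b, HasDerivWithinAt X (v s (X s)) (Icc a b) s := by
  have hB0 : 0 ≤ B := (norm_nonneg _).trans (hB a ⟨le_rfl, hab⟩ 0)
  have hba : 0 ≤ b - a := sub_nonneg.2 hab
  lift B to NNReal using hB0
  lift K to NNReal using hK0
  have hPL : IsPicardLindelof v (⟨b, hab, le_rfl⟩ : Icc a b) x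
      (B * (b - a).toNNReal) 0 B K := by
    refine ⟨fun s hs => LipschitzOnWith.of_dist_le_mul fun y _ z _ => ?_, fun y _ => hc y,
      fun s hs y _ => hB s hs y, ?_⟩
    · simpa [dist_eq_norm] using hK s hs y z
    · simp [hba]
  exact hPL.exists_eq_forall_mem_Icc_hasDerivWithinAt₀

/-- Backward Grönwall estimate for two characteristics. -/
theorem norm_characteristic_sub_le {K : ℝ} {X Y : ℝ → E3}
    (hK : ∀ s ∈ Icc a b, ∀ x y, ‖v s x - v s y‖ ≤ K * ‖x - y‖) (hK0 : 0 ≤ K)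
    (hX : ∀ s ∈ Icc a b, HasDerivWithinAt X (v s (X s)) (Icc a b) s)
    (hY : ∀ s ∈ Icc a b, HasDerivWithinAt Y (v s (Y s)) (Icc a b) s) {s : ℝ}
    (hs : s ∈ Icc a b) : ‖X s - Y s‖ ≤ ‖X b - Y b‖ * Real.exp (K * (b - s)) := by
  have hneg : MapsTo (fun τ : ℝ => -τ) (Icc (-b) (-a)) (Icc a b) := fun τ hτ =>
    ⟨by linarith [hτ.2], by linarith [hτ.1]⟩
  have key : ∀ Z : ℝ → E3, (∀ s ∈ Icc a b, HasDerivWithinAt Z (v s (Z s)) (Icc a b) s) →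
      ∀ τ ∈ Icc (-b) (-a), HasDerivWithinAt (fun τ => Z (-τ)) (-v (-τ) (Z (-τ)))
        (Icc (-b) (-a)) τ := fun Z hZ τ hτ => by
    simpa [Function.comp_def] using
      (hZ (-τ) (hneg hτ)).scomp τ (hasDerivAt_neg τ).hasDerivWithinAt hneg
  have right : ∀ Z : ℝ → E3, (∀ s ∈ Icc a b, HasDerivWithinAt Z (v s (Z s)) (Icc a b) s) →
      ∀ τ ∈ Ico (-b) (-a), HasDerivWithinAt (fun τ => Z (-τ)) (-v (-τ) (Z (-τ)))
        (Ici τ) τ := fun Z hZ τ hτ =>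
    (key Z hZ τ ⟨hτ.1, hτ.2.le⟩).mono_of_mem_nhdsWithin (Icc_mem_nhdsGE_of_mem hτ)
  lift K to NNReal using hK0
  have hG := dist_le_of_trajectories_ODE_of_mem (v := fun τ y => -v (-τ) y)
    (s := fun _ => univ) (K := K) (δ := ‖X b - Y b‖)
    (fun τ hτ => LipschitzOnWith.of_dist_le_mul fun y _ z _ => by
      simpa [dist_eq_norm, neg_add_eq_sub, norm_sub_rev] using
        hK (-τ) (hneg ⟨hτ.1, hτ.2.le⟩) y z)
    (fun τ hτ => (key X hX τ hτ).continuousWithinAt) (right X hX) (fun _ _ => mem_univ _)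
    (fun τ hτ => (key Y hY τ hτ).continuousWithinAt) (right Y hY) (fun _ _ => mem_univ _)
    (by simp [dist_eq_norm]) (-s) ⟨by linarith [hs.2], by linarith [hs.1]⟩
  simpa [dist_eq_norm, neg_add_eq_sub] using hG

/-- The derivative of a solution of the transport equation along a characteristic is `g`. -/
theorem hasDerivWithinAt_along_characteristic (hab : a < b)
    (hf : ContDiffOn ℝ (⊤ : ℕ∞) (fun q : ℝ × E3 => f q.1 q.2) (Icc a b ×ˢ univ))
    (heq : ∀ s ∈ Icc a b, ∀ x : E3, HasDerivWithinAt (fun τ => f τ x)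
      (g s x - fderiv ℝ (f s) x (v s x)) (Icc a b) s) {X : ℝ → E3}
    (hX : ∀ s ∈ Icc a b, HasDerivWithinAt X (v s (X s)) (Icc a b) s) {s : ℝ}
    (hs : s ∈ Icc a b) :
    HasDerivWithinAt (fun τ => f τ (X τ)) (g s (X s)) (Icc a b) s := by
  obtain ⟨D, hD⟩ := hf.differentiableOn (by simp) (s, X s) ⟨hs, mem_univ _⟩
  have htime : HasDerivWithinAt (fun τ => f τ (X s)) (D (1, 0)) (Icc a b) s :=
    hD.comp_hasDerivWithinAt (f := fun τ => (τ, X s)) s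
      ((hasDerivWithinAt_id s _).prodMk (hasDerivWithinAt_const s _ (X s)))
      fun τ hτ => ⟨hτ, mem_univ _⟩
  have hspace : HasFDerivAt (f s) (D.comp (ContinuousLinearMap.inr ℝ ℝ E3)) (X s) := by
    rw [← hasFDerivWithinAt_univ]
    exact hD.comp (f := fun y => (s, y)) (X s)
      ((hasFDerivAt_prodMk_right s (X s)).hasFDerivWithinAt) fun y _ => ⟨hs, mem_univ _⟩
  have hcomp : HasDerivWithinAt (fun τ => f τ (X τ)) (D (1, v s (X s))) (Icc a b) s :=
    hD.comp_hasDerivWithinAt (f := fun τ => (τ, X τ)) s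
      ((hasDerivWithinAt_id s _).prodMk (hX s hs)) fun τ hτ => ⟨hτ, mem_univ _⟩
  have h1 := (uniqueDiffOn_Icc hab s hs).eq_deriv _ htime (heq s hs (X s))
  have h2 : D (0, v s (X s)) = fderiv ℝ (f s) (X s) (v s (X s)) := by
    rw [hspace.fderiv]; rfl
  have h3 : D (1, v s (X s)) = g s (X s) := by
    have : ((1 : ℝ), v s (X s)) = (1, 0) + (0, v s (X s)) := by simp
    rw [this, map_add, h1, h2, sub_add_cancel]
  rwa [h3] at hcomp

theorem continuousOn_along
    {F : Type*} [NormedAddCommGroup F] {u : ℝ → E3 → F} {X : ℝ → E3} {s : Set ℝ}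
    (hu : ContinuousOn (fun q : ℝ × E3 => u q.1 q.2) (s ×ˢ univ)) (hX : ContinuousOn X s) :
    ContinuousOn (fun τ => u τ (X τ)) s :=
  hu.comp (f := fun τ => (τ, X τ)) (continuousOn_id.prodMk hX) fun _ hτ => ⟨hτ, mem_univ _⟩

theorem differentiable_slice {F : Type*} [NormedAddCommGroup F] [NormedSpace ℝ F]
    {u : ℝ → E3 → F} {s : Set ℝ}
    (hu : ContDiffOn ℝ (⊤ : ℕ∞) (fun q : ℝ × E3 => u q.1 q.2) (s ×ˢ univ)) {τ : ℝ}
    (hτ : τ ∈ s) : Differentiable ℝ (u τ) := by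
  have := hu.comp (g := fun q : ℝ × E3 => u q.1 q.2) (f := fun y : E3 => (τ, y)) (s := univ)
    (contDiff_prodMk_right τ).contDiffOn fun y _ => ⟨hτ, mem_univ y⟩
  exact (contDiffOn_univ.1 this).differentiable (by simp)

theorem integral_along_characteristic (hab : a < b)
    (hf : ContDiffOn ℝ (⊤ : ℕ∞) (fun q : ℝ × E3 => f q.1 q.2) (Icc a b ×ˢ univ))
    (hg : ContDiffOn ℝ (⊤ : ℕ∞) (fun q : ℝ × E3 => g q.1 q.2) (Icc a b ×ˢ univ))
    (heq : ∀ s ∈ Icc a b, ∀ x : E3, HasDerivWithinAt (fun τ => f τ x)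
      (g s x - fderiv ℝ (f s) x (v s x)) (Icc a b) s) {X : ℝ → E3}
    (hX : ∀ s ∈ Icc a b, HasDerivWithinAt X (v s (X s)) (Icc a b) s) :
    IntervalIntegrable (fun s => g s (X s)) volume a b ∧
      f b (X b) = f a (X a) + ∫ s in a..b, g s (X s) := by
  have hXc : ContinuousOn X (Icc a b) := fun s hs => (hX s hs).continuousWithinAt
  have hF := fun s hs => hasDerivWithinAt_along_characteristic hab hf heq hX (s := s) hs
  have hint : IntervalIntegrable (fun s => g s (X s)) volume a b :=
    (continuousOn_along hg.continuousOn hXc).intervalIntegrable_of_Icc hab.le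
  refine ⟨hint, ?_⟩
  rw [intervalIntegral.integral_eq_sub_of_hasDerivAt_of_le hab.le
    (fun s hs => (hF s hs).continuousWithinAt)
    (fun s hs => (hF s (Ioo_subset_Icc_self hs)).hasDerivAt (Icc_mem_nhds hs.1 hs.2)) hint]
  ring

end Characteristics

/-- Transport estimate (Hölder norm of order `α ∈ [0,1]`): if `∂ₛ f + v·∇f = g` on
`[t₀,t] × ℝ³` then `‖f(t)‖_α ≤ C e^{α (t−t₀) ‖v‖₁} (‖f(t₀)‖_α + ∫_{t₀}^t ‖g(s)‖_α ds)`. -/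
theorem stmt4 :
    ∀ α : ℝ, α ∈ Icc (0 : ℝ) 1 →
      ∃ C : ℝ, 0 < C ∧
        ∀ (t₀ t : ℝ) (v : ℝ → E3 → E3) (g f : ℝ → E3 → ℝ),
          t₀ ≤ t →
          ContDiffOn ℝ (⊤ : ℕ∞) (fun q : ℝ × E3 => v q.1 q.2) (Icc t₀ t ×ˢ univ) →
          (∀ n : ℕ, ∃ M : ℝ, ∀ s ∈ Icc t₀ t, ∀ x, ‖iteratedFDeriv ℝ n (v s) x‖ ≤ M) →
          ContDiffOn ℝ (⊤ : ℕ∞) (fun q : ℝ × E3 => g q.1 q.2) (Icc t₀ t ×ˢ univ) →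
          (∀ n : ℕ, ∃ M : ℝ, ∀ s ∈ Icc t₀ t, ∀ x, ‖iteratedFDeriv ℝ n (g s) x‖ ≤ M) →
          ContDiffOn ℝ (⊤ : ℕ∞) (fun q : ℝ × E3 => f q.1 q.2) (Icc t₀ t ×ˢ univ) →
          (∀ n : ℕ, ∃ M : ℝ, ∀ s ∈ Icc t₀ t, ∀ x, ‖iteratedFDeriv ℝ n (f s) x‖ ≤ M) →
          (∀ s ∈ Icc t₀ t, ∀ x : E3,
            HasDerivWithinAt (fun τ => f τ x)
              (g s x - fderiv ℝ (f s) x (v s x)) (Icc t₀ t) s) →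
          Cnorm α (f t) ≤ C * Real.exp (α * (t - t₀) * vnorm1 t₀ t v) *
            (Cnorm α (f t₀) + ∫ s in t₀..t, Cnorm α (g s)) := by
  intro α hα
  refine ⟨1, one_pos, ?_⟩
  intro t₀ t v g f ht hv hvb hg hgb hf hfb heq
  rcases ht.eq_or_lt with rfl | hlt
  · simp
  obtain ⟨B, hB⟩ := hvb 0
  obtain ⟨B', hB'⟩ := hvb 1
  obtain ⟨M, hM⟩ := hgb 0
  obtain ⟨L, hL⟩ := hgb 1
  obtain ⟨P, hP⟩ := hfb 0
  obtain ⟨Q, hQ⟩ := hfb 1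
  simp only [norm_iteratedFDeriv_zero] at hB hM hP
  simp only [norm_iteratedFDeriv_one] at hB' hL hQ
  have ht₀mem : t₀ ∈ Icc t₀ t := ⟨le_rfl, ht⟩
  have htmem : t ∈ Icc t₀ t := ⟨ht, le_rfl⟩
  have hL0 : 0 ≤ L := (norm_nonneg _).trans (hL t₀ ht₀mem 0)
  have hQ0 : 0 ≤ Q := (norm_nonneg _).trans (hQ t₀ ht₀mem 0)
  have hslice : ∀ {F : Type} [NormedAddCommGroup F] [NormedSpace ℝ F] {u : ℝ → E3 → F},
      ContDiffOn ℝ (⊤ : ℕ∞) (fun q : ℝ × E3 => u q.1 q.2) (Icc t₀ t ×ˢ univ) →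
      ∀ x, ContinuousOn (fun s => u s x) (Icc t₀ t) := fun hu x =>
    continuousOn_along hu.continuousOn continuousOn_const
  set K := vnorm1 t₀ t v with hKdef
  have hK0 : 0 ≤ K := Real.iSup_nonneg fun s => (sup0_nonneg _).trans (le_max_left _ _)
  have hvK : ∀ s ∈ Icc t₀ t, sem1 (v s) ≤ K := fun s hs =>
    (le_max_right (sup0 (v s)) _).trans <|
      le_ciSup (f := fun s : Icc t₀ t => max (sup0 (v s.1)) (sem1 (v s.1)))
        ⟨max B B', by
          rintro _ ⟨r, rfl⟩
          exact max_le_max (ciSup_le (hB r r.2)) (ciSup_le (hB' r r.2))⟩ ⟨s, hs⟩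
  have hK : ∀ s ∈ Icc t₀ t, ∀ x y, ‖v s x - v s y‖ ≤ K * ‖x - y‖ := fun s hs =>
    norm_sub_le_of_fderiv (differentiable_slice hv hs) fun x =>
      (norm_fderiv_le_sem1 (hB' s hs) x).trans (hvK s hs)
  have hflow := exists_characteristic ht (hslice hv) hB hK hK0
  have hN : IntervalIntegrable (fun s => Cnorm α (g s)) volume t₀ t :=
    intervalIntegrable_Cnorm hα ht (hslice hg) (fun s hs => differentiable_slice hg hs) hM hL
  set R := Cnorm α (f t₀) + ∫ s in t₀..t, Cnorm α (g s) with hR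
  have hR0 : 0 ≤ R := add_nonneg ((sup0_nonneg _).trans (sup0_le_Cnorm _ _))
    (intervalIntegral.integral_nonneg ht fun s _ => (sup0_nonneg _).trans (sup0_le_Cnorm _ _))
  set e := Real.exp (α * (t - t₀) * K) with he
  have he1 : 1 ≤ e := Real.one_le_exp
    (mul_nonneg (mul_nonneg hα.1 (sub_nonneg.2 ht)) hK0)
  have hsup : sup0 (f t) ≤ e * R := by
    refine (ciSup_le fun x => ?_).trans (le_mul_of_one_le_left hR0 he1)
    obtain ⟨X, rfl, hX⟩ := hflow x
    obtain ⟨-, hXi⟩ := integral_along_characteristic hlt hf hg heq hX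
    rw [hXi]
    refine (norm_add_le _ _).trans (add_le_add ?_ ?_)
    · exact (norm_le_sup0 (hP t₀ ht₀mem) _).trans (sup0_le_Cnorm _ _)
    · refine intervalIntegral.norm_integral_le_of_norm_le ht (Eventually.of_forall ?_) hN
      intro s hs
      exact (norm_le_sup0 (hM s (Ioc_subset_Icc_self hs)) _).trans (sup0_le_Cnorm _ _)
  rw [one_mul]
  rcases eq_or_ne α 0 with hα0 | hα0
  · rwa [Cnorm, if_pos hα0]
  rw [Cnorm_eq_max hα0 (differentiable_slice hf htmem) (hP t htmem) (hQ t htmem)]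
  refine max_le hsup (hsem_le (mul_nonneg (zero_le_one.trans he1) hR0) fun x y => ?_)
  obtain ⟨X, rfl, hX⟩ := hflow x
  obtain ⟨Y, rfl, hY⟩ := hflow y
  obtain ⟨hXint, hXi⟩ := integral_along_characteristic hlt hf hg heq hX
  obtain ⟨hYint, hYi⟩ := integral_along_characteristic hlt hf hg heq hY
  have hdist : ∀ s ∈ Icc t₀ t, ‖X s - Y s‖ ^ α ≤ e * ‖X t - Y t‖ ^ α := by
    intro s hs
    have hle : ‖X s - Y s‖ ≤ ‖X t - Y t‖ * Real.exp (K * (t - t₀)) := by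
      refine (norm_characteristic_sub_le hK hK0 hX hY hs).trans ?_
      gcongr
      exact hs.1
    calc ‖X s - Y s‖ ^ α ≤ (‖X t - Y t‖ * Real.exp (K * (t - t₀))) ^ α :=
          Real.rpow_le_rpow (norm_nonneg _) hle hα.1
      _ = e * ‖X t - Y t‖ ^ α := by
          rw [Real.mul_rpow (norm_nonneg _) (Real.exp_pos _).le, ← Real.exp_mul, he, mul_comm]
          congr 2
          ring
  have hhol : ∀ {u : ℝ → E3 → ℝ} {m l : ℝ}, 0 ≤ l →
      ContDiffOn ℝ (⊤ : ℕ∞) (fun q : ℝ × E3 => u q.1 q.2) (Icc t₀ t ×ˢ univ) →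
      (∀ s ∈ Icc t₀ t, ∀ x, ‖u s x‖ ≤ m) → (∀ s ∈ Icc t₀ t, ∀ x, ‖fderiv ℝ (u s) x‖ ≤ l) →
      ∀ s ∈ Icc t₀ t, ‖u s (X s) - u s (Y s)‖ ≤
        Cnorm α (u s) * (e * ‖X t - Y t‖ ^ α) := by
    intro u m l hl0 hu hm hl s hs
    have hd := differentiable_slice hu hs
    rw [Cnorm_eq_max hα0 hd (hm s hs) (hl s hs)]
    refine (norm_sub_le_hsem hα (hm s hs) (norm_sub_le_of_fderiv hd (hl s hs)) hl0 _ _).trans ?_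
    exact mul_le_mul (le_max_right _ _) (hdist s hs) (by positivity)
      ((sup0_nonneg _).trans (le_max_left _ _))
  have hsplit : f t (X t) - f t (Y t) =
      (f t₀ (X t₀) - f t₀ (Y t₀)) + ∫ s in t₀..t, (g s (X s) - g s (Y s)) := by
    rw [intervalIntegral.integral_sub hXint hYint, hXi, hYi]
    ring
  calc ‖f t (X t) - f t (Y t)‖
      ≤ ‖f t₀ (X t₀) - f t₀ (Y t₀)‖ + ‖∫ s in t₀..t, (g s (X s) - g s (Y s))‖ := by
        rw [hsplit]; exact norm_add_le _ _
    _ ≤ Cnorm α (f t₀) * (e * ‖X t - Y t‖ ^ α) +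
        ∫ s in t₀..t, Cnorm α (g s) * (e * ‖X t - Y t‖ ^ α) :=
        add_le_add (hhol hQ0 hf hP hQ t₀ ht₀mem)
          (intervalIntegral.norm_integral_le_of_norm_le ht
            (Eventually.of_forall fun s hs => hhol hL0 hg hM hL s (Ioc_subset_Icc_self hs))
            (hN.mul_const _))
    _ = e * R * ‖X t - Y t‖ ^ α := by
        rw [intervalIntegral.integral_mul_const, hR]
        ring
end
end

section
/- For every integer N ≥ 1 and every α ∈ [0,1) there exists a constant C (depending only on N and α) with the following property. Let t₀ ≤ t, let v : [t₀,t] × ℝ³ → ℝ³ and g : [t₀,t] × ℝ³ → ℝ be smooth and bounded together with all their spatial derivatives, with |t − t₀| ‖v_{[t₀,t]}‖_1 ≤ 1, and let f : [t₀,t] × ℝ³ → ℝ be a smooth bounded solution of ∂_s f + v·∇f = g on [t₀,t] × ℝ³ with f(t₀,·) = f₀. Then [f(t,·)]_{N+α} ≤ C ( [f₀]_{N+α} + |t−t₀| [v_{[t₀,t]}]_{N+α} [f₀]_1 + ∫_{t₀}^t ( [g(s,·)]_{N+α} + (t−s) [v_{[t₀,t]}]_{N+α} [g(s,·)]_1 )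 ds ). -/
open Set MeasureTheory

noncomputable section

/-- Derivative seminorm `[f]_n` (sup norm of the `n`-th derivative). -/
def semN {F : Type*} [NormedAddCommGroup F] [NormedSpace ℝ F] (n : ℕ) (f : E3 → F) : ℝ :=
  ⨆ x, ‖iteratedFDeriv ℝ n f x‖

/-- Hölder seminorm `[f]_{n+α}` for `α ∈ (0,1)`:
`max_{|r|=n} sup_{x≠y} |Dʳf x − Dʳf y|/|x−y|^α`, phrased via `iteratedFDeriv`. -/
def hsemN {F : Type*} [NormedAddCommGroup F] [NormedSpace ℝ F] (n : ℕ) (α : ℝ)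
    (f : E3 → F) : ℝ :=
  ⨆ p : { p : E3 × E3 // p.1 ≠ p.2 },
    ‖iteratedFDeriv ℝ n f p.1.1 - iteratedFDeriv ℝ n f p.1.2‖ / ‖p.1.1 - p.1.2‖ ^ α

/-- Seminorm `[f]_{n+α}` for `α ∈ [0,1)` (equal to `[f]_n` when `α = 0`). -/
def semNA {F : Type*} [NormedAddCommGroup F] [NormedSpace ℝ F] (n : ℕ) (α : ℝ)
    (f : E3 → F) : ℝ :=
  if α = 0 then semN n f else hsemN n α f

/-- `[v_{[t₀,t]}]_{N+α} = sup_{s ∈ [t₀,t]} [v(s,·)]_{N+α}`. -/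
def vsemNA (t₀ t : ℝ) (N : ℕ) (α : ℝ) (v : ℝ → E3 → E3) : ℝ :=
  ⨆ s : Icc t₀ t, semNA N α (v s.1)

section Transport

variable {F G H : Type*} [NormedAddCommGroup F] [NormedSpace ℝ F]
  [NormedAddCommGroup G] [NormedSpace ℝ G] [NormedAddCommGroup H] [NormedSpace ℝ H]

/-- Smooth functions all of whose derivatives are bounded. -/
def SmoothBounded (u : E3 → F) : Prop :=
  ContDiff ℝ (⊤ : ℕ∞) u ∧ ∀ n : ℕ, ∃ M : ℝ, ∀ x, ‖iteratedFDeriv ℝ n u x‖ ≤ M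

lemma SmoothBounded.differentiable {u : E3 → F} (hu : SmoothBounded u) : Differentiable ℝ u :=
  hu.1.differentiable (by simp)

lemma SmoothBounded.fderiv {u : E3 → F} (hu : SmoothBounded u) :
    SmoothBounded (fderiv ℝ u) := by
  refine ⟨hu.1.fderiv_right (by simp), fun n => ?_⟩
  obtain ⟨M, hM⟩ := hu.2 (n + 1)
  exact ⟨M, fun x => by rw [norm_iteratedFDeriv_fderiv]; exact hM x⟩

lemma SmoothBounded.add {u w : E3 → F} (hu : SmoothBounded u) (hw : SmoothBounded w) :
    SmoothBounded (fun x => u x + w x) := by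
  refine ⟨hu.1.add hw.1, fun n => ?_⟩
  obtain ⟨M, hM⟩ := hu.2 n
  obtain ⟨M', hM'⟩ := hw.2 n
  refine ⟨M + M', fun x => ?_⟩
  rw [fun_iteratedFDeriv_add_apply (hu.1.contDiffAt.of_le (by exact_mod_cast le_top))
    (hw.1.contDiffAt.of_le (by exact_mod_cast le_top))]
  exact (norm_add_le _ _).trans (add_le_add (hM x) (hM' x))

lemma SmoothBounded.neg {u : E3 → F} (hu : SmoothBounded u) :
    SmoothBounded (fun x => - u x) := by
  refine ⟨hu.1.neg, fun n => ?_⟩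
  obtain ⟨M, hM⟩ := hu.2 n
  refine ⟨M, fun x => ?_⟩
  have := iteratedFDeriv_neg_apply (𝕜 := ℝ) (i := n) (f := u) (x := x)
  simp only [Pi.neg_def] at this
  rw [this, norm_neg]
  exact hM x

lemma SmoothBounded.bilin {u : E3 → F} {w : E3 → G} (B : F →L[ℝ] G →L[ℝ] H)
    (hu : SmoothBounded u) (hw : SmoothBounded w) :
    SmoothBounded (fun x => B (u x) (w x)) := by
  refine ⟨B.isBoundedBilinearMap.contDiff.comp₂ hu.1 hw.1, fun n => ?_⟩
  choose M hM using hu.2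
  choose M' hM' using hw.2
  have hM0 : ∀ n, 0 ≤ M n := fun n => (norm_nonneg _).trans (hM n 0)
  refine ⟨‖B‖ * ∑ i ∈ Finset.range (n + 1), (n.choose i : ℝ) * M i * M' (n - i), fun x => ?_⟩
  refine (B.norm_iteratedFDeriv_le_of_bilinear hu.1 hw.1 x (by exact_mod_cast le_top)).trans ?_
  gcongr with i hi
  · exact mul_nonneg (by positivity) (hM0 i)
  · exact hM i x
  · exact hM' _ x

lemma iteratedFDeriv_succ_sub_norm (n : ℕ) (u : E3 → F) (x y : E3) :
    ‖iteratedFDeriv ℝ (n + 1) u x - iteratedFDeriv ℝ (n + 1) u y‖ =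
      ‖iteratedFDeriv ℝ n (fderiv ℝ u) x - iteratedFDeriv ℝ n (fderiv ℝ u) y‖ := by
  rw [iteratedFDeriv_succ_eq_comp_right, iteratedFDeriv_succ_eq_comp_right,
    Function.comp_apply, Function.comp_apply, ← dist_eq_norm, LinearIsometryEquiv.dist_map,
    dist_eq_norm]

lemma iteratedFDeriv_zero_sub_norm (u : E3 → F) (x y : E3) :
    ‖iteratedFDeriv ℝ 0 u x - iteratedFDeriv ℝ 0 u y‖ = ‖u x - u y‖ := by
  rw [iteratedFDeriv_zero_eq_comp, Function.comp_apply, Function.comp_apply, ← map_sub,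
    LinearIsometryEquiv.norm_map]

lemma semN_fderiv (n : ℕ) (u : E3 → F) : semN n (fderiv ℝ u) = semN (n + 1) u := by
  simp only [semN, norm_iteratedFDeriv_fderiv]

lemma semNA_fderiv (n : ℕ) (α : ℝ) (u : E3 → F) :
    semNA n α (fderiv ℝ u) = semNA (n + 1) α u := by
  simp only [semNA, semN_fderiv, hsemN, iteratedFDeriv_succ_sub_norm]

lemma semNA_zero_right (n : ℕ) (u : E3 → F) : semNA n 0 u = semN n u := by simp [semNA]

lemma sem1_eq (u : E3 → F) : sem1 u = semN 1 u := by
  simp only [sem1, semN]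
  congr 1; ext x
  rw [← norm_iteratedFDeriv_fderiv, norm_iteratedFDeriv_zero]

lemma semN_nonneg (n : ℕ) (u : E3 → F) : 0 ≤ semN n u :=
  Real.iSup_nonneg fun _ => norm_nonneg _

lemma semNA_nonneg (n : ℕ) (α : ℝ) (u : E3 → F) : 0 ≤ semNA n α u := by
  unfold semNA
  split_ifs
  · exact semN_nonneg n u
  · exact Real.iSup_nonneg fun _ => by positivity

lemma SmoothBounded.norm_iteratedFDeriv_le_semN {u : E3 → F} (hu : SmoothBounded u) (n : ℕ)
    (x : E3) : ‖iteratedFDeriv ℝ n u x‖ ≤ semN n u := by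
  obtain ⟨M, hM⟩ := hu.2 n
  exact le_ciSup (f := fun x => ‖iteratedFDeriv ℝ n u x‖)
    ⟨M, by rintro _ ⟨y, rfl⟩; exact hM y⟩ x

lemma SmoothBounded.norm_le {u : E3 → F} (hu : SmoothBounded u) (x : E3) :
    ‖u x‖ ≤ semN 0 u := by
  rw [← norm_iteratedFDeriv_zero (𝕜 := ℝ)]
  exact hu.norm_iteratedFDeriv_le_semN 0 x

lemma semN_le {n : ℕ} {u : E3 → F} {c : ℝ} (h : ∀ x, ‖iteratedFDeriv ℝ n u x‖ ≤ c) :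
    semN n u ≤ c := ciSup_le h

lemma semN_zero_le {u : E3 → F} {c : ℝ} (h : ∀ x, ‖u x‖ ≤ c) : semN 0 u ≤ c :=
  semN_le fun x => by rw [norm_iteratedFDeriv_zero]; exact h x

lemma hsemN_le {n : ℕ} {α : ℝ} {u : E3 → F} {c : ℝ} (hc : 0 ≤ c)
    (h : ∀ x y, ‖iteratedFDeriv ℝ n u x - iteratedFDeriv ℝ n u y‖ ≤ c * ‖x - y‖ ^ α) :
    hsemN n α u ≤ c := by
  refine Real.iSup_le (fun p => ?_) hc
  have : 0 < ‖p.1.1 - p.1.2‖ := norm_pos_iff.2 (sub_ne_zero.2 p.2)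
  rw [div_le_iff₀ (by positivity)]
  exact h _ _

lemma SmoothBounded.norm_sub_le {u : E3 → F} (hu : SmoothBounded u) (x y : E3) :
    ‖u x - u y‖ ≤ semN 1 u * ‖x - y‖ := by
  refine convex_univ.norm_image_sub_le_of_norm_fderiv_le (𝕜 := ℝ)
    (fun z _ => hu.differentiable z) (fun z _ => ?_) (mem_univ y) (mem_univ x)
  rw [← semN_fderiv]
  exact hu.fderiv.norm_le z

/-- Interpolation of the Hölder quotient between sup bounds, at scale `lam`. -/
lemma SmoothBounded.norm_sub_le_rpow {u : E3 → F} (hu : SmoothBounded u) {α lam : ℝ}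
    (hα : 0 < α) (hα1 : α < 1) (hl : 0 < lam) (x y : E3) :
    ‖u x - u y‖ ≤ (2 * lam ^ (-α) * semN 0 u + lam ^ (1 - α) * semN 1 u) * ‖x - y‖ ^ α := by
  have h0 := semN_nonneg 0 u
  have h1 := semN_nonneg 1 u
  rcases eq_or_ne x y with rfl | hxy
  · simp [hα.ne']
  have hd : 0 < ‖x - y‖ := norm_pos_iff.2 (sub_ne_zero.2 hxy)
  rcases le_total ‖x - y‖ lam with h | h
  · calc ‖u x - u y‖ ≤ semN 1 u * ‖x - y‖ := hu.norm_sub_le x y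
      _ = semN 1 u * (‖x - y‖ ^ (1 - α) * ‖x - y‖ ^ α) := by
          rw [← Real.rpow_add hd]; simp
      _ ≤ semN 1 u * (lam ^ (1 - α) * ‖x - y‖ ^ α) := by
          gcongr
      _ ≤ _ := by
          have : 0 ≤ 2 * lam ^ (-α) * semN 0 u * ‖x - y‖ ^ α := by positivity
          nlinarith
  · have h2 : 1 ≤ lam ^ (-α) * ‖x - y‖ ^ α := by
      rw [Real.rpow_neg hl.le, inv_mul_eq_div, one_le_div (by positivity)]
      exact Real.rpow_le_rpow hl.le h hα.le
    calc ‖u x - u y‖ ≤ semN 0 u + semN 0 u :=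
          (_root_.norm_sub_le _ _).trans (add_le_add (hu.norm_le x) (hu.norm_le y))
      _ = 2 * semN 0 u * 1 := by ring
      _ ≤ 2 * semN 0 u * (lam ^ (-α) * ‖x - y‖ ^ α) := by gcongr
      _ ≤ _ := by
          have : 0 ≤ lam ^ (1 - α) * semN 1 u * ‖x - y‖ ^ α := by positivity
          nlinarith

lemma SmoothBounded.norm_sub_le_hsemN {u : E3 → F} (hu : SmoothBounded u) {α : ℝ}
    (hα : 0 < α) (hα1 : α < 1) (x y : E3) :
    ‖u x - u y‖ ≤ semNA 0 α u * ‖x - y‖ ^ α := by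
  rcases eq_or_ne x y with rfl | hxy
  · simp [hα.ne']
  have hd : 0 < ‖x - y‖ := norm_pos_iff.2 (sub_ne_zero.2 hxy)
  rw [← div_le_iff₀ (by positivity), semNA, if_neg hα.ne', hsemN,
    ← iteratedFDeriv_zero_sub_norm]
  refine le_ciSup (f := fun p : { p : E3 × E3 // p.1 ≠ p.2 } =>
    ‖iteratedFDeriv ℝ 0 u p.1.1 - iteratedFDeriv ℝ 0 u p.1.2‖ / ‖p.1.1 - p.1.2‖ ^ α)
    ⟨2 * 1 ^ (-α) * semN 0 u + 1 ^ (1 - α) * semN 1 u, ?_⟩ ⟨(x, y), hxy⟩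
  rintro _ ⟨p, rfl⟩
  have : 0 < ‖p.1.1 - p.1.2‖ := norm_pos_iff.2 (sub_ne_zero.2 p.2)
  simp only [iteratedFDeriv_zero_sub_norm]
  rw [div_le_iff₀ (by positivity)]
  exact hu.norm_sub_le_rpow hα hα1 one_pos _ _

lemma hsemN_zero_le {α : ℝ} (hα : 0 < α) {u : E3 → F} {c : ℝ} (hc : 0 ≤ c)
    (h : ∀ x y, ‖u x - u y‖ ≤ c * ‖x - y‖ ^ α) : semNA 0 α u ≤ c := by
  rw [semNA, if_neg hα.ne']
  exact hsemN_le hc fun x y => by rw [iteratedFDeriv_zero_sub_norm]; exact h x y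

/-- The intermediate Hölder seminorm is controlled by two consecutive integer seminorms. -/
lemma SmoothBounded.semNA_le {u : E3 → F} (hu : SmoothBounded u) (n : ℕ) {α lam : ℝ}
    (hα : 0 < α) (hα1 : α < 1) (hl : 0 < lam) :
    semNA n α u ≤ 2 * lam ^ (-α) * semN n u + lam ^ (1 - α) * semN (n + 1) u := by
  induction n generalizing F with
  | zero =>
    have h0 := semN_nonneg 0 u
    have h1 := semN_nonneg 1 u
    exact hsemN_zero_le hα (by positivity) (hu.norm_sub_le_rpow hα hα1 hl)
  | succ n ih =>
    rw [← semNA_fderiv, ← semN_fderiv, ← semN_fderiv (n + 1)]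
    exact ih hu.fderiv

lemma SmoothBounded.semNA_add_le {u w : E3 → F} (hu : SmoothBounded u) (hw : SmoothBounded w)
    (n : ℕ) {α : ℝ} (hα : α ∈ Ico (0 : ℝ) 1) :
    semNA n α (fun x => u x + w x) ≤ semNA n α u + semNA n α w := by
  induction n generalizing F with
  | zero =>
    rcases hα.1.eq_or_lt with rfl | h0
    · simp only [semNA_zero_right]
      exact semN_zero_le fun x => (norm_add_le _ _).trans (add_le_add (hu.norm_le x) (hw.norm_le x))
    · refine hsemN_zero_le h0 (add_nonneg (semNA_nonneg _ _ _) (semNA_nonneg _ _ _)) fun x y => ?_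
      rw [add_sub_add_comm, add_mul]
      exact (norm_add_le _ _).trans (add_le_add (hu.norm_sub_le_hsemN h0 hα.2 x y)
        (hw.norm_sub_le_hsemN h0 hα.2 x y))
  | succ n ih =>
    have : _root_.fderiv ℝ (fun x => u x + w x)
        = fun x => _root_.fderiv ℝ u x + _root_.fderiv ℝ w x := by
      ext1 x
      exact fderiv_fun_add (hu.differentiable x) (hw.differentiable x)
    rw [← semNA_fderiv, ← semNA_fderiv, ← semNA_fderiv, this]
    exact ih hu.fderiv hw.fderiv

/-- Leibniz estimate for the Hölder seminorm of a bilinear expression. -/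
lemma semNA_bilin_le (n : ℕ) {α : ℝ} (hα : α ∈ Ico (0 : ℝ) 1) (B : F →L[ℝ] G →L[ℝ] H)
    {u : E3 → F} {w : E3 → G} (hu : SmoothBounded u) (hw : SmoothBounded w) {c : ℝ}
    (h : ∀ i j, i + j = n → semNA i α u * semN j w + semN i u * semNA j α w ≤ c) :
    semNA n α (fun x => B (u x) (w x)) ≤ 2 ^ n * ‖B‖ * c := by
  induction n generalizing F G H with
  | zero =>
    have h00 := h 0 0 rfl
    have b1 := semNA_nonneg 0 α u
    have b2 := semNA_nonneg 0 α w
    have b3 := semN_nonneg 0 u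
    have b4 := semN_nonneg 0 w
    have hc : 0 ≤ c := le_trans (by positivity) h00
    simp only [pow_zero, one_mul]
    rcases hα.1.eq_or_lt with rfl | h0
    · simp only [semNA_zero_right] at *
      refine semN_zero_le fun x => (B.le_opNorm₂ _ _).trans ?_
      rw [mul_assoc]
      gcongr
      have := mul_le_mul (hu.norm_le x) (hw.norm_le x) (norm_nonneg _) b3
      nlinarith [mul_nonneg b3 b4]
    · refine hsemN_zero_le h0 (by positivity) fun x y => ?_
      have e : B (u x) (w x) - B (u y) (w y) = B (u x - u y) (w x) + B (u y) (w x - w y) := by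
        simp
      have e1 := mul_le_mul (hu.norm_sub_le_hsemN h0 hα.2 x y) (hw.norm_le x) (norm_nonneg _)
        (by positivity)
      have e2 := mul_le_mul (hu.norm_le y) (hw.norm_sub_le_hsemN h0 hα.2 x y) (norm_nonneg _) b3
      calc _ ≤ ‖B‖ * ‖u x - u y‖ * ‖w x‖ + ‖B‖ * ‖u y‖ * ‖w x - w y‖ := by
            rw [e]
            exact (norm_add_le _ _).trans (add_le_add (B.le_opNorm₂ _ _) (B.le_opNorm₂ _ _))
        _ = ‖B‖ * (‖u x - u y‖ * ‖w x‖ + ‖u y‖ * ‖w x - w y‖) := by ring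
        _ ≤ ‖B‖ * ((semNA 0 α u * semN 0 w + semN 0 u * semNA 0 α w) * ‖x - y‖ ^ α) := by
            gcongr
            linarith
        _ ≤ ‖B‖ * (c * ‖x - y‖ ^ α) := by gcongr
        _ = _ := by ring
  | succ n ih =>
    have hd : fderiv ℝ (fun x => B (u x) (w x)) = fun x =>
        B.precompR E3 (u x) (fderiv ℝ w x) + B.precompL E3 (fderiv ℝ u x) (w x) := by
      ext1 x
      exact B.fderiv_of_bilinear (hu.differentiable x) (hw.differentiable x)
    have hc : 0 ≤ c := le_trans (add_nonneg (mul_nonneg (semNA_nonneg _ _ _) (semN_nonneg _ _))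
      (mul_nonneg (semN_nonneg _ _) (semNA_nonneg _ _ _))) (h (n + 1) 0 rfl)
    rw [← semNA_fderiv, hd]
    refine (SmoothBounded.semNA_add_le (.bilin _ hu hw.fderiv) (.bilin _ hu.fderiv hw) n
      hα).trans ?_
    have e1 := ih (B.precompR E3) hu hw.fderiv fun i j hij => by
      rw [semN_fderiv, semNA_fderiv]; exact h i (j + 1) (by omega)
    have e2 := ih (B.precompL E3) hu.fderiv hw fun i j hij => by
      rw [semN_fderiv, semNA_fderiv]; exact h (i + 1) j (by omega)
    calc _ ≤ _ := add_le_add e1 e2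
      _ ≤ 2 ^ n * ‖B‖ * c + 2 ^ n * ‖B‖ * c := by
          gcongr
          · exact B.norm_precompR_le E3
          · exact B.norm_precompL_le E3
      _ = _ := by ring

/-- Landau-type inequality: the first derivative is controlled by the function and the Hölder
quotient of the derivative, at scale `μ`. -/
lemma SmoothBounded.norm_fderiv_le {u : E3 → F} (hu : SmoothBounded u) {β c μ : ℝ} (hβ : 0 ≤ β)
    (hc : 0 ≤ c) (hμ : 0 < μ)
    (h : ∀ x y, ‖_root_.fderiv ℝ u x - _root_.fderiv ℝ u y‖ ≤ c * ‖x - y‖ ^ β) (x : E3) :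
    ‖_root_.fderiv ℝ u x‖ ≤ 2 / μ * semN 0 u + μ ^ β * c := by
  have h0 := semN_nonneg 0 u
  have key : ∀ k : E3, ‖k‖ = μ →
      ‖_root_.fderiv ℝ u x k‖ ≤ 2 * semN 0 u + c * μ ^ β * μ := by
    intro k hk
    have h1 : ‖u (x + k) - u x - _root_.fderiv ℝ u x (x + k - x)‖ ≤ c * μ ^ β * ‖x + k - x‖ := by
      refine (convex_closedBall x μ).norm_image_sub_le_of_norm_fderiv_le' (𝕜 := ℝ)
        (fun z _ => hu.differentiable z) (fun z hz => (h z x).trans ?_)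
        (Metric.mem_closedBall_self hμ.le) (by simp [hk])
      rw [mem_closedBall_iff_norm] at hz
      gcongr
    rw [add_sub_cancel_left, hk] at h1
    calc ‖_root_.fderiv ℝ u x k‖
        = ‖u (x + k) - u x - (u (x + k) - u x - _root_.fderiv ℝ u x k)‖ := by congr 1; abel
      _ ≤ ‖u (x + k) - u x‖ + c * μ ^ β * μ := (_root_.norm_sub_le _ _).trans (by gcongr)
      _ ≤ _ := by
          have := _root_.norm_sub_le (u (x + k)) (u x)
          linarith [hu.norm_le (x + k), hu.norm_le x]
  refine ContinuousLinearMap.opNorm_le_bound _ (by positivity) fun k => ?_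
  rcases eq_or_ne k 0 with rfl | hk
  · simp
  have hk' : 0 < ‖k‖ := norm_pos_iff.2 hk
  have := key ((μ / ‖k‖) • k) (by
    rw [norm_smul, Real.norm_of_nonneg (by positivity)]; field_simp)
  rw [map_smul, norm_smul, Real.norm_of_nonneg (by positivity)] at this
  calc _ = (μ / ‖k‖ * ‖_root_.fderiv ℝ u x k‖) * (‖k‖ / μ) := by field_simp
    _ ≤ (2 * semN 0 u + c * μ ^ β * μ) * (‖k‖ / μ) := by gcongr
    _ = _ := by field_simp

lemma SmoothBounded.semN_succ_le {u : E3 → F} (hu : SmoothBounded u) (n : ℕ) {μ : ℝ}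
    (hμ : 0 < μ) : semN (n + 1) u ≤ 2 / μ * semN n u + μ * semN (n + 2) u := by
  induction n generalizing F with
  | zero =>
    rw [← semN_fderiv]
    refine semN_zero_le fun x => ?_
    have := hu.norm_fderiv_le (β := 1) (c := semN 2 u) zero_le_one (semN_nonneg _ _) hμ
      (fun x y => by
        rw [Real.rpow_one, ← semN_fderiv]
        exact hu.fderiv.norm_sub_le x y) x
    rwa [Real.rpow_one] at this
  | succ n ih =>
    rw [← semN_fderiv n, ← semN_fderiv (n + 1), ← semN_fderiv (n + 2)]
    exact ih hu.fderiv

lemma SmoothBounded.semN_succ_le_semNA {u : E3 → F} (hu : SmoothBounded u) (n : ℕ) {μ α : ℝ}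
    (hα : 0 < α) (hα1 : α < 1) (hμ : 0 < μ) :
    semN (n + 1) u ≤ 2 / μ * semN n u + μ ^ α * semNA (n + 1) α u := by
  induction n generalizing F with
  | zero =>
    rw [← semN_fderiv]
    refine semN_zero_le fun x => ?_
    refine hu.norm_fderiv_le hα.le (semNA_nonneg _ _ _) hμ (fun x y => ?_) x
    rw [← semNA_fderiv]
    exact hu.fderiv.norm_sub_le_hsemN hα hα1 x y
  | succ n ih =>
    rw [← semN_fderiv n, ← semN_fderiv (n + 1), ← semNA_fderiv]
    exact ih hu.fderiv

variable (F) in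
lemma exists_semN_interpolation (m : ℕ) :
    ∃ C : ℝ, 1 ≤ C ∧ ∀ u : E3 → F, SmoothBounded u → ∀ lam : ℝ, 0 < lam → ∀ j ≤ m,
      lam ^ j * semN j u ≤ C * (semN 0 u + lam ^ m * semN m u) := by
  induction m with
  | zero =>
    refine ⟨1, le_rfl, fun u hu lam hl j hj => ?_⟩
    obtain rfl : j = 0 := by omega
    have := semN_nonneg 0 u
    simpa
  | succ m ih =>
    obtain ⟨C, hC, ih⟩ := ih
    refine ⟨8 * C * C, by nlinarith, fun u hu lam hl j hj => ?_⟩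
    have a0 := semN_nonneg 0 u
    have T0 : 0 ≤ lam ^ (m + 1) * semN (m + 1) u := mul_nonneg (by positivity) (semN_nonneg _ _)
    have hm : lam ^ m * semN m u ≤ semN 0 u + 8 * C * (lam ^ (m + 1) * semN (m + 1) u) := by
      rcases m with _ | k
      · simp only [pow_zero, one_mul]
        nlinarith
      have h1 := hu.semN_succ_le k (μ := 4 * C * lam) (by positivity)
      have h2 := ih u hu lam hl k (by omega)
      have h3 : lam ^ (k + 1) * semN (k + 1) u ≤ 1 / (2 * C) * (lam ^ k * semN k u)
          + 4 * C * (lam ^ (k + 2) * semN (k + 2) u) := by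
        calc _ ≤ lam ^ (k + 1) * (2 / (4 * C * lam) * semN k u
              + 4 * C * lam * semN (k + 2) u) := by gcongr
          _ = _ := by field_simp; ring
      have h4 : 1 / (2 * C) * (lam ^ k * semN k u) ≤
          1 / (2 * C) * (C * (semN 0 u + lam ^ (k + 1) * semN (k + 1) u)) := by gcongr
      have h5 : 1 / (2 * C) * (C * (semN 0 u + lam ^ (k + 1) * semN (k + 1) u)) =
          (semN 0 u + lam ^ (k + 1) * semN (k + 1) u) / 2 := by field_simp
      linarith
    rcases Nat.lt_succ_iff_lt_or_eq.1 (Nat.lt_succ_of_le hj) with hj | rfl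
    · have h1 := ih u hu lam hl j (by omega)
      have h2 : C * (semN 0 u + lam ^ m * semN m u) ≤
        C * (semN 0 u + (semN 0 u + 8 * C * (lam ^ (m + 1) * semN (m + 1) u))) := by gcongr
      nlinarith [mul_nonneg (sub_nonneg.2 hC) a0]
    · have : 1 ≤ 8 * C * C := by nlinarith
      nlinarith

variable (F) in
lemma exists_semNA_interpolation (m : ℕ) {α : ℝ} (hα : α ∈ Ico (0 : ℝ) 1) :
    ∃ C : ℝ, 1 ≤ C ∧ ∀ u : E3 → F, SmoothBounded u → ∀ lam : ℝ, 0 < lam → ∀ j ≤ m,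
      lam ^ j * semN j u ≤ C * (semN 0 u + lam ^ m * lam ^ α * semNA m α u) ∧
      lam ^ j * lam ^ α * semNA j α u ≤ C * (semN 0 u + lam ^ m * lam ^ α * semNA m α u) := by
  obtain ⟨C, hC, hP⟩ := exists_semN_interpolation F m
  rcases hα.1.eq_or_lt with rfl | h0
  · refine ⟨C, hC, fun u hu lam hl j hj => ?_⟩
    simp only [semNA_zero_right, Real.rpow_zero, mul_one, and_self]
    exact hP u hu lam hl j hj
  refine ⟨24 * C * C, by nlinarith, fun u hu lam hl j hj => ?_⟩
  have a0 := semN_nonneg 0 u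
  set T := lam ^ m * lam ^ α * semNA m α u with hT
  have T0 : 0 ≤ T := mul_nonneg (by positivity) (semNA_nonneg _ _ _)
  have hm : lam ^ m * semN m u ≤ semN 0 u + 8 * C * T := by
    rcases m with _ | k
    · simp only [pow_zero, one_mul]
      nlinarith
    have h1 := hu.semN_succ_le_semNA k (μ := 4 * C * lam) h0 hα.2 (by positivity)
    have h2 := hP u hu lam hl k (by omega)
    have h3 : lam ^ (k + 1) * semN (k + 1) u ≤ 1 / (2 * C) * (lam ^ k * semN k u)
        + (4 * C) ^ α * T := by
      calc _ ≤ lam ^ (k + 1) * (2 / (4 * C * lam) * semN k u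
            + (4 * C * lam) ^ α * semNA (k + 1) α u) := by gcongr
        _ = _ := by
            rw [Real.mul_rpow (by positivity) hl.le, hT]; field_simp; ring
    have h4 : 1 / (2 * C) * (lam ^ k * semN k u) ≤
        1 / (2 * C) * (C * (semN 0 u + lam ^ (k + 1) * semN (k + 1) u)) := by gcongr
    have h5 : 1 / (2 * C) * (C * (semN 0 u + lam ^ (k + 1) * semN (k + 1) u)) =
        (semN 0 u + lam ^ (k + 1) * semN (k + 1) u) / 2 := by field_simp
    have h6 : (4 * C) ^ α * T ≤ 4 * C * T := by
      gcongr
      exact Real.rpow_le_self_of_one_le (by linarith) hα.2.le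
    linarith
  have hint : ∀ i ≤ m, lam ^ i * semN i u ≤ 8 * C * C * (semN 0 u + T) := by
    intro i hi
    have h1 := hP u hu lam hl i hi
    have h2 : C * (semN 0 u + lam ^ m * semN m u) ≤
      C * (semN 0 u + (semN 0 u + 8 * C * T)) := by gcongr
    nlinarith [mul_nonneg (sub_nonneg.2 hC) a0]
  have hbig : 0 ≤ C * C * (semN 0 u + T) := by positivity
  refine ⟨(hint j hj).trans (by nlinarith), ?_⟩
  rcases hj.lt_or_eq with hj | rfl
  · have h1 := hint j hj.le
    have h2 := hint (j + 1) hj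
    have h3 := hu.semNA_le j h0 hα.2 hl
    calc _ ≤ lam ^ j * lam ^ α *
          (2 * lam ^ (-α) * semN j u + lam ^ (1 - α) * semN (j + 1) u) := by gcongr
      _ = 2 * (lam ^ j * semN j u) + lam ^ (j + 1) * semN (j + 1) u := by
          rw [Real.rpow_neg hl.le, Real.rpow_sub hl, Real.rpow_one]
          field_simp
          ring
      _ ≤ _ := by linarith
  · have : 1 ≤ 24 * C * C := by nlinarith
    nlinarith

variable (F G) in
/-- Interpolation estimate for products of intermediate seminorms. -/
lemma exists_mul_semNA_le (m : ℕ) {α : ℝ} (hα : α ∈ Ico (0 : ℝ) 1) :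
    ∃ C : ℝ, 1 ≤ C ∧ ∀ (u : E3 → F) (w : E3 → G), SmoothBounded u → SmoothBounded w →
      ∀ i j, i + j = m → semNA i α u * semN j w + semN i u * semNA j α w ≤
        C * (semN 0 u * semNA m α w + semNA m α u * semN 0 w) := by
  rcases Nat.eq_zero_or_pos m with rfl | hm
  · refine ⟨1, le_rfl, fun u w _ _ i j hij => ?_⟩
    obtain ⟨rfl, rfl⟩ : i = 0 ∧ j = 0 := by omega
    linarith
  obtain ⟨C, hC, hu'⟩ := exists_semNA_interpolation F m hα
  obtain ⟨C', hC', hw'⟩ := exists_semNA_interpolation G m hα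
  refine ⟨4 * C * C', by nlinarith, fun u w hu hw i j hij => ?_⟩
  have a0 := semN_nonneg 0 u
  have b0 := semN_nonneg 0 w
  have am := semNA_nonneg m α u
  have bm := semNA_nonneg m α w
  have key : ∀ ε : ℝ, 0 < ε → semNA i α u * semN j w + semN i u * semNA j α w ≤
      4 * C * C' * ((semN 0 u + ε) * semNA m α w + (semNA m α u + ε) * semN 0 w) := by
    intro ε hε
    set A := semN 0 u + ε
    set B := semNA m α u + ε
    have hA : 0 < A := by positivity
    have hB : 0 < B := by positivity
    have hM : 0 < (m : ℝ) + α := by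
      have : (0 : ℝ) < m := by exact_mod_cast hm
      linarith [hα.1]
    obtain ⟨lam, hl, hlam⟩ : ∃ lam : ℝ, 0 < lam ∧ lam ^ m * lam ^ α = A / B := by
      refine ⟨(A / B) ^ (1 / ((m : ℝ) + α)), by positivity, ?_⟩
      rw [← Real.rpow_natCast, ← Real.rpow_add (by positivity), ← Real.rpow_mul (by positivity),
        one_div_mul_cancel hM.ne', Real.rpow_one]
    obtain ⟨u1, u2⟩ := hu' u hu lam hl i (by omega)
    obtain ⟨w1, w2⟩ := hw' w hw lam hl j (by omega)
    rw [hlam] at u1 u2 w1 w2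
    have hU : C * (semN 0 u + A / B * semNA m α u) ≤ C * (2 * A) := by
      have : A / B * semNA m α u ≤ A / B * B := by
        gcongr
        simp only [B]; linarith
      rw [div_mul_cancel₀ _ hB.ne'] at this
      have : semN 0 u ≤ A := by simp only [A]; linarith
      gcongr
      linarith
    have p1 := mul_le_mul (u2.trans hU) w1
      (mul_nonneg (by positivity) (semN_nonneg _ _)) (by positivity)
    have p2 := mul_le_mul (u1.trans hU) w2
      (mul_nonneg (by positivity) (semNA_nonneg _ _ _)) (by positivity)
    have e : lam ^ i * lam ^ α * lam ^ j = A / B := by rw [← hlam, ← hij]; ring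
    have e1 : A / B * (semNA i α u * semN j w + semN i u * semNA j α w) ≤
        A / B * (4 * C * C' * (A * semNA m α w + B * semN 0 w)) := by
      calc _ = lam ^ i * lam ^ α * semNA i α u * (lam ^ j * semN j w) +
            lam ^ i * semN i u * (lam ^ j * lam ^ α * semNA j α w) := by rw [← e]; ring
        _ ≤ _ := add_le_add p1 p2
        _ = _ := by field_simp; ring
    exact le_of_mul_le_mul_left e1 (by positivity)
  refine le_of_forall_pos_le_add fun δ hδ => ?_
  have hQ : 0 < 4 * C * C' * (semNA m α w + semN 0 w + 1) := by positivity
  refine (key (δ / (4 * C * C' * (semNA m α w + semN 0 w + 1))) (by positivity)).trans ?_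
  set q := δ / (4 * C * C' * (semNA m α w + semN 0 w + 1)) with hq
  have hq0 : 0 < q := by positivity
  have : q * (4 * C * C' * (semNA m α w + semN 0 w + 1)) = δ := by
    rw [hq]; field_simp
  have : 0 ≤ q * (4 * C * C') := by positivity
  linarith

set_option maxSynthPendingDepth 3 in
lemma norm_neg_compL_le (X Y Z : Type*) [NormedAddCommGroup X] [NormedSpace ℝ X]
    [NormedAddCommGroup Y] [NormedSpace ℝ Y] [NormedAddCommGroup Z] [NormedSpace ℝ Z] :
    ‖-ContinuousLinearMap.compL ℝ X Y Z‖ ≤ 1 := by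
  rw [norm_neg]
  exact ContinuousLinearMap.norm_compL_le ℝ X Y Z

section Slices

variable {t₀ t : ℝ} {f : ℝ → E3 → F}

lemma uniqueDiffOn_slab (h : t₀ < t) : UniqueDiffOn ℝ (Icc t₀ t ×ˢ (univ : Set E3)) :=
  (uniqueDiffOn_Icc h).prod uniqueDiffOn_univ

lemma hasFDerivAt_slice
    (hf : ContDiffOn ℝ (⊤ : ℕ∞) (fun q : ℝ × E3 => f q.1 q.2) (Icc t₀ t ×ˢ univ))
    {s : ℝ} (hs : s ∈ Icc t₀ t) (x : E3) :
    HasFDerivAt (f s) ((fderivWithin ℝ (fun q : ℝ × E3 => f q.1 q.2) (Icc t₀ t ×ˢ univ)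
      (s, x)).comp (ContinuousLinearMap.inr ℝ ℝ E3)) x := by
  have h1 := ((hf.differentiableOn (by simp)) (s, x) ⟨hs, mem_univ _⟩).hasFDerivWithinAt
  exact (h1.comp x (hasFDerivAt_prodMk_right s x).hasFDerivWithinAt (s := univ)
    (fun y _ => ⟨hs, mem_univ _⟩)).hasFDerivAt Filter.univ_mem

lemma hasDerivWithinAt_slice
    (hf : ContDiffOn ℝ (⊤ : ℕ∞) (fun q : ℝ × E3 => f q.1 q.2) (Icc t₀ t ×ˢ univ))
    {s : ℝ} (hs : s ∈ Icc t₀ t) (x : E3) :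
    HasDerivWithinAt (fun τ => f τ x) (fderivWithin ℝ (fun q : ℝ × E3 => f q.1 q.2)
      (Icc t₀ t ×ˢ univ) (s, x) (1, 0)) (Icc t₀ t) s := by
  have h1 := ((hf.differentiableOn (by simp)) (s, x) ⟨hs, mem_univ _⟩).hasFDerivWithinAt
  have hmaps : MapsTo (fun τ => (τ, x)) (Icc t₀ t) (Icc t₀ t ×ˢ univ) :=
    fun τ hτ => ⟨hτ, mem_univ _⟩
  exact h1.comp_hasDerivWithinAt s
    ((hasDerivAt_id s).prodMk (hasDerivAt_const s x)).hasDerivWithinAt hmaps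

lemma contDiffOn_fderiv_slice (h : t₀ < t)
    (hf : ContDiffOn ℝ (⊤ : ℕ∞) (fun q : ℝ × E3 => f q.1 q.2) (Icc t₀ t ×ˢ univ)) :
    ContDiffOn ℝ (⊤ : ℕ∞) (fun q : ℝ × E3 => fderiv ℝ (f q.1) q.2) (Icc t₀ t ×ˢ univ) := by
  have h1 := hf.fderivWithin (m := (⊤ : ℕ∞)) (uniqueDiffOn_slab h) (by simp)
  refine (h1.clm_comp (contDiffOn_const (c := ContinuousLinearMap.inr ℝ ℝ E3))).congr ?_
  rintro ⟨s, x⟩ ⟨hs, -⟩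
  exact (hasFDerivAt_slice hf hs x).fderiv

/-- Time and space derivatives commute. -/
lemma hasDerivWithinAt_fderiv_slice (h : t₀ < t)
    (hf : ContDiffOn ℝ (⊤ : ℕ∞) (fun q : ℝ × E3 => f q.1 q.2) (Icc t₀ t ×ˢ univ))
    {q : ℝ → E3 → F} (hq : ∀ s ∈ Icc t₀ t, ∀ x,
      HasDerivWithinAt (fun τ => f τ x) (q s x) (Icc t₀ t) s) {s : ℝ} (hs : s ∈ Icc t₀ t)
    (x : E3) :
    HasDerivWithinAt (fun τ => fderiv ℝ (f τ) x) (fderiv ℝ (q s) x) (Icc t₀ t) s := by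
  have hU := uniqueDiffOn_slab h
  have h1 := hf.fderivWithin (m := (⊤ : ℕ∞)) hU (by simp)
  set P' := fderivWithin ℝ (fun q : ℝ × E3 => f q.1 q.2) (Icc t₀ t ×ˢ univ) with hP'
  have h1' : ContDiffOn ℝ (⊤ : ℕ∞) (fun q : ℝ × E3 => (fun s x => P' (s, x)) q.1 q.2)
    (Icc t₀ t ×ˢ univ) := h1
  have hsymm : IsSymmSndFDerivWithinAt ℝ (fun q : ℝ × E3 => f q.1 q.2)
      (Icc t₀ t ×ˢ univ) (s, x) := by
    refine (hf (s, x) ⟨hs, mem_univ _⟩).isSymmSndFDerivWithinAt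
      (by simpa using WithTop.coe_le_coe.2 (le_top : (2 : ℕ∞) ≤ ⊤)) hU ?_ ⟨hs, mem_univ _⟩
    rw [interior_prod_eq, closure_prod_eq, interior_Icc, closure_Ioo h.ne]
    simpa using hs
  have hqs : q s = fun y => P' (s, y) (1, 0) := by
    ext1 y
    exact (uniqueDiffOn_Icc h s hs).eq_deriv _ (hq s hs y) (hasDerivWithinAt_slice hf hs y)
  have hx := (hasFDerivAt_slice (f := fun s x => P' (s, x)) h1' hs x).clm_apply
    (hasFDerivAt_const ((1 : ℝ), (0 : E3)) x)
  have ht := (hasDerivWithinAt_slice (f := fun s x => P' (s, x)) h1' hs x).clm_comp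
    (hasDerivWithinAt_const s (Icc t₀ t) (ContinuousLinearMap.inr ℝ ℝ E3))
  rw [hqs, hx.fderiv]
  refine (ht.congr (fun τ hτ => (hasFDerivAt_slice hf hτ x).fderiv)
    (hasFDerivAt_slice hf hs x).fderiv).congr_deriv ?_
  ext1 w
  simpa using hsymm (1, 0) (0, w)

end Slices

/-- Data of a smooth bounded solution of the transport equation `∂ₛ f + v · ∇f = g` on the slab
`[t₀, t] × ℝ³`, with quantitative bounds on the velocity. -/
structure TransportSolution (t₀ t V L : ℝ) (v : ℝ → E3 → E3) (g f : ℝ → E3 → F) : Prop where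
  lt : t₀ < t
  mul_le : (t - t₀) * V ≤ 1
  v_smooth : ContDiffOn ℝ (⊤ : ℕ∞) (fun q : ℝ × E3 => v q.1 q.2) (Icc t₀ t ×ˢ univ)
  v_bdd : ∀ s ∈ Icc t₀ t, SmoothBounded (v s)
  v_sup : ∀ s ∈ Icc t₀ t, semN 0 (v s) ≤ L
  v_lip : ∀ s ∈ Icc t₀ t, semN 1 (v s) ≤ V
  g_smooth : ContDiffOn ℝ (⊤ : ℕ∞) (fun q : ℝ × E3 => g q.1 q.2) (Icc t₀ t ×ˢ univ)
  g_bdd : ∀ s ∈ Icc t₀ t, SmoothBounded (g s)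
  f_smooth : ContDiffOn ℝ (⊤ : ℕ∞) (fun q : ℝ × E3 => f q.1 q.2) (Icc t₀ t ×ˢ univ)
  f_bdd : ∀ s ∈ Icc t₀ t, SmoothBounded (f s)
  deriv : ∀ s ∈ Icc t₀ t, ∀ x : E3, HasDerivWithinAt (fun τ => f τ x)
    (g s x - fderiv ℝ (f s) x (v s x)) (Icc t₀ t) s

namespace TransportSolution

variable {t₀ t V L : ℝ} {v : ℝ → E3 → E3} {g f : ℝ → E3 → F}

lemma nonneg (S : TransportSolution t₀ t V L v g f) : 0 ≤ V :=
  (semN_nonneg _ _).trans (S.v_lip t (right_mem_Icc.2 S.lt.le))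

lemma restrict (S : TransportSolution t₀ t V L v g f) {s : ℝ} (hs : s ∈ Ioc t₀ t) :
    TransportSolution t₀ s V L v g f := by
  have hI : Icc t₀ s ⊆ Icc t₀ t := Icc_subset_Icc_right hs.2
  have hP : Icc t₀ s ×ˢ (univ : Set E3) ⊆ Icc t₀ t ×ˢ univ := prod_mono hI subset_rfl
  exact
  { lt := hs.1
    mul_le := (mul_le_mul_of_nonneg_right (by linarith [hs.2]) S.nonneg).trans S.mul_le
    v_smooth := S.v_smooth.mono hP
    v_bdd := fun τ hτ => S.v_bdd τ (hI hτ)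
    v_sup := fun τ hτ => S.v_sup τ (hI hτ)
    v_lip := fun τ hτ => S.v_lip τ (hI hτ)
    g_smooth := S.g_smooth.mono hP
    g_bdd := fun τ hτ => S.g_bdd τ (hI hτ)
    f_smooth := S.f_smooth.mono hP
    f_bdd := fun τ hτ => S.f_bdd τ (hI hτ)
    deriv := fun τ hτ x => (S.deriv τ (hI hτ) x).mono hI }

lemma lipschitzWith (S : TransportSolution t₀ t V L v g f) {s : ℝ} (hs : s ∈ Icc t₀ t) :
    LipschitzWith ⟨V, S.nonneg⟩ (v s) :=
  LipschitzWith.of_dist_le_mul fun x y => by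
    rw [dist_eq_norm, dist_eq_norm]
    exact ((S.v_bdd s hs).norm_sub_le x y).trans
      (mul_le_mul_of_nonneg_right (S.v_lip s hs) (norm_nonneg _))

/-- Characteristics through a given point at the final time. -/
lemma exists_characteristic (S : TransportSolution t₀ t V L v g f) (x : E3) :
    ∃ X : ℝ → E3, X t = x ∧ ∀ s ∈ Icc t₀ t, HasDerivWithinAt X (v s (X s)) (Icc t₀ t) s := by
  have ht := right_mem_Icc.2 S.lt.le
  have hL : 0 ≤ L := (semN_nonneg _ _).trans (S.v_sup t ht)
  have hT : 0 ≤ L * (t - t₀) := mul_nonneg hL (sub_nonneg.2 S.lt.le)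
  have hPL : IsPicardLindelof v (⟨t, ht⟩ : Icc t₀ t) x ⟨L * (t - t₀), hT⟩ 0 ⟨L, hL⟩
      ⟨V, S.nonneg⟩ :=
    { lipschitzOnWith := fun s hs => (S.lipschitzWith hs).lipschitzOnWith
      continuousOn := fun y _ s hs =>
        (hasDerivWithinAt_slice S.v_smooth hs y).continuousWithinAt
      norm_le := fun s hs y _ => ((S.v_bdd s hs).norm_le y).trans (S.v_sup s hs)
      mul_max_le := by simp [S.lt.le]; exact le_rfl }
  exact hPL.exists_eq_forall_mem_Icc_hasDerivWithinAt₀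

/-- Characteristics depend on the final point in a Lipschitz way. -/
lemma norm_characteristic_sub_le (S : TransportSolution t₀ t V L v g f) {X Y : ℝ → E3}
    (hX : ∀ s ∈ Icc t₀ t, HasDerivWithinAt X (v s (X s)) (Icc t₀ t) s)
    (hY : ∀ s ∈ Icc t₀ t, HasDerivWithinAt Y (v s (Y s)) (Icc t₀ t) s) {s : ℝ}
    (hs : s ∈ Icc t₀ t) : ‖X s - Y s‖ ≤ Real.exp 1 * ‖X t - Y t‖ := by
  have hmaps : MapsTo (fun τ => t - τ) (Icc 0 (t - t₀)) (Icc t₀ t) := fun τ hτ =>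
    ⟨by linarith [hτ.2], by linarith [hτ.1]⟩
  have hrev : ∀ {Z : ℝ → E3},
      (∀ s ∈ Icc t₀ t, HasDerivWithinAt Z (v s (Z s)) (Icc t₀ t) s) →
      ∀ τ ∈ Icc 0 (t - t₀), HasDerivWithinAt (fun τ => Z (t - τ))
        (-v (t - τ) (Z (t - τ))) (Icc 0 (t - t₀)) τ := by
    intro Z hZ τ hτ
    have h2 : HasDerivWithinAt (fun τ : ℝ => t - τ) (-1) (Icc 0 (t - t₀)) τ :=
      ((hasDerivAt_id τ).const_sub t).hasDerivWithinAt
    simpa [Function.comp_def] using (hZ (t - τ) (hmaps hτ)).scomp τ h2 hmaps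
  have hright : ∀ {Z : ℝ → E3},
      (∀ s ∈ Icc t₀ t, HasDerivWithinAt Z (v s (Z s)) (Icc t₀ t) s) →
      ∀ τ ∈ Ico 0 (t - t₀), HasDerivWithinAt (fun τ => Z (t - τ))
        (-v (t - τ) (Z (t - τ))) (Ici τ) τ := fun hZ τ hτ =>
    (hrev hZ τ (Ico_subset_Icc_self hτ)).mono_of_mem_nhdsWithin (Icc_mem_nhdsGE_of_mem hτ)
  have key := dist_le_of_trajectories_ODE_of_mem (v := fun τ z => -v (t - τ) z)
    (s := fun _ => univ) (K := ⟨V, S.nonneg⟩) (a := 0) (b := t - t₀) (δ := ‖X t - Y t‖)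
    (f := fun τ => X (t - τ)) (g := fun τ => Y (t - τ))
    (fun τ hτ => ((S.lipschitzWith (hmaps (Ico_subset_Icc_self hτ))).neg).lipschitzOnWith)
    (fun τ hτ => (hrev hX τ hτ).continuousWithinAt) (hright hX) (fun _ _ => mem_univ _)
    (fun τ hτ => (hrev hY τ hτ).continuousWithinAt) (hright hY) (fun _ _ => mem_univ _)
    (by simp [dist_eq_norm]) (t - s) ⟨by linarith [hs.2], by linarith [hs.1]⟩
  simp only [sub_sub_cancel, sub_zero, dist_eq_norm] at key
  change _ ≤ ‖X t - Y t‖ * Real.exp (V * (t - s)) at key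
  rw [mul_comm (Real.exp 1)]
  refine key.trans ?_
  gcongr
  nlinarith [mul_le_mul_of_nonneg_right (show t - s ≤ t - t₀ by linarith [hs.1]) S.nonneg,
    S.mul_le]

lemma hasDerivWithinAt_along (S : TransportSolution t₀ t V L v g f) {X : ℝ → E3}
    (hX : ∀ s ∈ Icc t₀ t, HasDerivWithinAt X (v s (X s)) (Icc t₀ t) s) {s : ℝ} (hs : s ∈ Icc t₀ t) :
    HasDerivWithinAt (fun τ => f τ (X τ)) (g s (X s)) (Icc t₀ t) s := by
  have h1 := ((S.f_smooth.differentiableOn (by simp)) (s, X s)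
    ⟨hs, mem_univ _⟩).hasFDerivWithinAt
  have hmaps : MapsTo (fun τ => (τ, X τ)) (Icc t₀ t) (Icc t₀ t ×ˢ univ) :=
    fun τ hτ => ⟨hτ, mem_univ _⟩
  have h2 := h1.comp_hasDerivWithinAt s ((hasDerivWithinAt_id s _).prodMk (hX s hs)) hmaps
  refine h2.congr_deriv ?_
  have e1 := (uniqueDiffOn_Icc S.lt s hs).eq_deriv _ (S.deriv s hs (X s))
    (hasDerivWithinAt_slice S.f_smooth hs (X s))
  rw [(hasFDerivAt_slice S.f_smooth hs (X s)).fderiv] at e1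
  have e2 : ((1 : ℝ), v s (X s)) = (1, 0) + (0, v s (X s)) := by simp
  rw [e2, map_add, ← e1]
  simp

lemma continuousOn_along (S : TransportSolution t₀ t V L v g f) {X : ℝ → E3}
    (hX : ∀ s ∈ Icc t₀ t, HasDerivWithinAt X (v s (X s)) (Icc t₀ t) s) :
    ContinuousOn (fun τ => g τ (X τ)) (Icc t₀ t) :=
  S.g_smooth.continuousOn.comp
    (continuousOn_id.prodMk (fun s hs => (hX s hs).continuousWithinAt))
    (fun _ hτ => ⟨hτ, mem_univ _⟩)

lemma integral_along [CompleteSpace F] (S : TransportSolution t₀ t V L v g f) {X : ℝ → E3}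
    (hX : ∀ s ∈ Icc t₀ t, HasDerivWithinAt X (v s (X s)) (Icc t₀ t) s) :
    f t (X t) = f t₀ (X t₀) + ∫ s in t₀..t, g s (X s) := by
  rw [intervalIntegral.integral_eq_sub_of_hasDeriv_right_of_le S.lt.le
    (fun s hs => (S.hasDerivWithinAt_along hX hs).continuousWithinAt)
    (fun s hs => (S.hasDerivWithinAt_along hX (Ioo_subset_Icc_self hs)).mono_of_mem_nhdsWithin
      (mem_nhdsWithin_of_mem_nhds (Icc_mem_nhds hs.1 hs.2)))
    (ContinuousOn.intervalIntegrable_of_Icc S.lt.le (S.continuousOn_along hX))]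
  abel

/-- Transport estimate without derivatives. -/
lemma semNA_zero_le [CompleteSpace F] (S : TransportSolution t₀ t V L v g f) {α : ℝ}
    (hα : α ∈ Ico (0 : ℝ) 1) {b : ℝ → ℝ} (hb : IntervalIntegrable b volume t₀ t)
    (hgb : ∀ s ∈ Icc t₀ t, semNA 0 α (g s) ≤ b s) :
    semNA 0 α (f t) ≤ Real.exp 1 * (semNA 0 α (f t₀) + ∫ s in t₀..t, b s) := by
  have ht₀ := left_mem_Icc.2 S.lt.le
  have ht := right_mem_Icc.2 S.lt.le
  have hb0 : 0 ≤ ∫ s in t₀..t, b s := intervalIntegral.integral_nonneg S.lt.le fun s hs =>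
    (semNA_nonneg _ _ _).trans (hgb s hs)
  have hf0 := semNA_nonneg 0 α (f t₀)
  have he : 1 ≤ Real.exp 1 := Real.one_le_exp zero_le_one
  rcases hα.1.eq_or_lt with rfl | h0
  · simp only [semNA_zero_right] at *
    refine semN_zero_le fun x => ?_
    obtain ⟨X, rfl, hX⟩ := S.exists_characteristic x
    rw [S.integral_along hX]
    have h1 : ‖∫ s in t₀..t, g s (X s)‖ ≤ ∫ s in t₀..t, b s :=
      intervalIntegral.norm_integral_le_of_norm_le S.lt.le (ae_of_all _ fun s hs =>
        ((S.g_bdd s (Ioc_subset_Icc_self hs)).norm_le _).trans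
          (hgb s (Ioc_subset_Icc_self hs))) hb
    have h2 := (S.f_bdd t₀ ht₀).norm_le (X t₀)
    have h3 := norm_add_le (f t₀ (X t₀)) (∫ s in t₀..t, g s (X s))
    nlinarith
  · refine hsemN_zero_le h0 (by positivity) fun x y => ?_
    obtain ⟨X, rfl, hX⟩ := S.exists_characteristic x
    obtain ⟨Y, rfl, hY⟩ := S.exists_characteristic y
    set d := Real.exp 1 * ‖X t - Y t‖ ^ α
    have hd : ∀ s ∈ Icc t₀ t, ‖X s - Y s‖ ^ α ≤ d := fun s hs => by
      calc _ ≤ (Real.exp 1 * ‖X t - Y t‖) ^ α := by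
            gcongr
            exact S.norm_characteristic_sub_le hX hY hs
        _ = Real.exp 1 ^ α * ‖X t - Y t‖ ^ α := Real.mul_rpow (by positivity) (by positivity)
        _ ≤ d := by
            simp only [d]
            gcongr
            exact Real.rpow_le_self_of_one_le he hα.2.le
    rw [S.integral_along hX, S.integral_along hY, add_sub_add_comm,
      ← intervalIntegral.integral_sub
        ((S.continuousOn_along hX).intervalIntegrable_of_Icc S.lt.le)
        ((S.continuousOn_along hY).intervalIntegrable_of_Icc S.lt.le)]
    have h1 : ‖∫ s in t₀..t, (g s (X s) - g s (Y s))‖ ≤ ∫ s in t₀..t, b s * d :=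
      intervalIntegral.norm_integral_le_of_norm_le S.lt.le (ae_of_all _ fun s hs => by
        have hs := Ioc_subset_Icc_self hs
        refine ((S.g_bdd s hs).norm_sub_le_hsemN h0 hα.2 _ _).trans ?_
        exact mul_le_mul (hgb s hs) (hd s hs) (by positivity)
          ((semNA_nonneg _ _ _).trans (hgb s hs))) (hb.mul_const d)
    rw [intervalIntegral.integral_mul_const] at h1
    have h2 : ‖f t₀ (X t₀) - f t₀ (Y t₀)‖ ≤ semNA 0 α (f t₀) * d :=
      ((S.f_bdd t₀ ht₀).norm_sub_le_hsemN h0 hα.2 _ _).trans (by gcongr; exact hd t₀ ht₀)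
    calc _ ≤ _ := norm_add_le _ _
      _ ≤ semNA 0 α (f t₀) * d + (∫ s in t₀..t, b s) * d := add_le_add h2 h1
      _ = _ := by simp only [d]; ring

/-- The gradient of a solution solves a transport equation. -/
lemma fderiv (S : TransportSolution t₀ t V L v g f) :
    TransportSolution t₀ t V L v (fun s x => fderiv ℝ (g s) x +
      (-ContinuousLinearMap.compL ℝ E3 E3 F) (fderiv ℝ (f s) x) (fderiv ℝ (v s) x))
      (fun s => fderiv ℝ (f s)) where
  lt := S.lt
  mul_le := S.mul_le
  v_smooth := S.v_smooth
  v_bdd := S.v_bdd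
  v_sup := S.v_sup
  v_lip := S.v_lip
  g_smooth := by
    have h1 := contDiffOn_fderiv_slice S.lt S.g_smooth
    have h2 := contDiffOn_fderiv_slice S.lt S.f_smooth
    have h3 := contDiffOn_fderiv_slice S.lt S.v_smooth
    refine (h1.add (h2.clm_comp h3).neg).congr fun q _ => ?_
    simp
  g_bdd := fun s hs => (S.g_bdd s hs).fderiv.add
    (.bilin _ (S.f_bdd s hs).fderiv (S.v_bdd s hs).fderiv)
  f_smooth := contDiffOn_fderiv_slice S.lt S.f_smooth
  f_bdd := fun s hs => (S.f_bdd s hs).fderiv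
  deriv := fun s hs x => by
    refine (hasDerivWithinAt_fderiv_slice S.lt S.f_smooth S.deriv hs x).congr_deriv ?_
    have hsymm : IsSymmSndFDerivAt ℝ (f s) x :=
      ((S.f_bdd s hs).1.contDiffAt).isSymmSndFDerivAt
        (by simpa using WithTop.coe_le_coe.2 (le_top : (2 : ℕ∞) ≤ ⊤))
    have h1 := ((S.f_bdd s hs).fderiv.differentiable x).hasFDerivAt.clm_apply
      ((S.v_bdd s hs).differentiable x).hasFDerivAt
    have h2 := ((S.g_bdd s hs).differentiable x).hasFDerivAt.fun_sub h1
    rw [h2.fderiv]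
    ext w
    simp [hsymm w (v s x)]
    abel

/-- Transport estimate for `N` derivatives, the commutators being controlled by `r`. -/
lemma semNA_le_integral [CompleteSpace F] {α : ℝ} (hα : α ∈ Ico (0 : ℝ) 1) (N : ℕ)
    (S : TransportSolution t₀ t V L v g f) {b r : ℝ → ℝ}
    (hb : IntervalIntegrable b volume t₀ t)
    (hr : ∀ s ∈ Icc t₀ t, ∀ i j, i + j + 1 = N →
      semNA (i + 1) α (f s) * semN (j + 1) (v s) + semN (i + 1) (f s) * semNA (j + 1) α (v s)
        ≤ r s)
    (hr0 : ∀ s ∈ Icc t₀ t, 0 ≤ r s)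
    (hgb : ∀ s ∈ Icc t₀ t, semNA N α (g s) + 2 ^ N * r s ≤ b s) :
    semNA N α (f t) ≤ Real.exp 1 * (semNA N α (f t₀) + ∫ s in t₀..t, b s) := by
  induction N generalizing F with
  | zero =>
    refine S.semNA_zero_le hα hb fun s hs => ?_
    linarith [hgb s hs, hr0 s hs]
  | succ N ih =>
    rw [← semNA_fderiv, ← semNA_fderiv]
    have key := ih S.fderiv
    refine key (fun s hs i j hij => ?_) fun s hs => ?_
    · rw [semN_fderiv, semNA_fderiv]
      exact hr s hs (i + 1) j (by omega)
    · have hf := (S.f_bdd s hs).fderiv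
      have hv := (S.v_bdd s hs).fderiv
      have h1 := (S.g_bdd s hs).fderiv.semNA_add_le
        (.bilin (-ContinuousLinearMap.compL ℝ E3 E3 F) hf hv) N hα
      have h2 := semNA_bilin_le N hα (-ContinuousLinearMap.compL ℝ E3 E3 F) hf hv (c := r s)
        (fun i j hij => by
          simp only [semN_fderiv, semNA_fderiv]
          exact hr s hs i j (by omega))
      have h3 := h2.trans (mul_le_mul_of_nonneg_right (mul_le_mul_of_nonneg_left
        (norm_neg_compL_le E3 E3 F) (by positivity)) (hr0 s hs))
      rw [semNA_fderiv] at h1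
      have h5 := hgb s hs
      rw [pow_succ] at h5
      linarith

end TransportSolution

section Time

variable {t₀ t : ℝ} {f : ℝ → E3 → F}

lemma smoothBounded_slice
    (hf : ContDiffOn ℝ (⊤ : ℕ∞) (fun q : ℝ × E3 => f q.1 q.2) (Icc t₀ t ×ˢ univ))
    (hM : ∀ n : ℕ, ∃ M : ℝ, ∀ s ∈ Icc t₀ t, ∀ x, ‖iteratedFDeriv ℝ n (f s) x‖ ≤ M)
    {s : ℝ} (hs : s ∈ Icc t₀ t) : SmoothBounded (f s) := by
  refine ⟨contDiffOn_univ.1 (hf.comp (contDiff_prodMk_right s).contDiffOn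
    fun x _ => ⟨hs, mem_univ _⟩), fun n => ?_⟩
  obtain ⟨M, hM⟩ := hM n
  exact ⟨M, hM s hs⟩

lemma exists_semNA_le {α : ℝ} (hα : α ∈ Ico (0 : ℝ) 1)
    (hf : ContDiffOn ℝ (⊤ : ℕ∞) (fun q : ℝ × E3 => f q.1 q.2) (Icc t₀ t ×ˢ univ))
    (hM : ∀ n : ℕ, ∃ M : ℝ, ∀ s ∈ Icc t₀ t, ∀ x, ‖iteratedFDeriv ℝ n (f s) x‖ ≤ M) (n : ℕ) :
    ∃ M : ℝ, ∀ s ∈ Icc t₀ t, semNA n α (f s) ≤ M := by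
  obtain ⟨M, hM0⟩ := hM n
  obtain ⟨M', hM1⟩ := hM (n + 1)
  rcases hα.1.eq_or_lt with rfl | h0
  · exact ⟨M, fun s hs => by rw [semNA_zero_right]; exact semN_le (hM0 s hs)⟩
  · refine ⟨2 * M + M', fun s hs => ?_⟩
    have h1 := (smoothBounded_slice hf hM hs).semNA_le n h0 hα.2 one_pos
    simp only [Real.one_rpow, mul_one, one_mul] at h1
    linarith [semN_le (hM0 s hs), semN_le (hM1 s hs)]

lemma intervalIntegrable_semNA {α : ℝ} (hα : α ∈ Ico (0 : ℝ) 1) (h : t₀ < t)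
    (hf : ContDiffOn ℝ (⊤ : ℕ∞) (fun q : ℝ × E3 => f q.1 q.2) (Icc t₀ t ×ˢ univ))
    (hM : ∀ n : ℕ, ∃ M : ℝ, ∀ s ∈ Icc t₀ t, ∀ x, ‖iteratedFDeriv ℝ n (f s) x‖ ≤ M) (n : ℕ) :
    IntervalIntegrable (fun s => semNA n α (f s)) volume t₀ t := by
  induction n generalizing F with
  | succ n ih =>
    refine (ih (contDiffOn_fderiv_slice h hf) fun k => ?_).congr fun s _ => semNA_fderiv n α (f s)
    obtain ⟨M, hM⟩ := hM (k + 1)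
    exact ⟨M, fun s hs x => by rw [norm_iteratedFDeriv_fderiv]; exact hM s hs x⟩
  | zero =>
    obtain ⟨C, hC⟩ := exists_semNA_le hα hf hM 0
    have hcont : ∀ x, Continuous fun s : Icc t₀ t => f s x := fun x =>
      continuousOn_iff_continuous_domRestrict.1
        fun s hs => (hasDerivWithinAt_slice hf hs x).continuousWithinAt
    have hmeas : Measurable fun s : Icc t₀ t => semNA 0 α (f s) := by
      rcases hα.1.eq_or_lt with rfl | h0
      · simp only [semNA_zero_right, semN, norm_iteratedFDeriv_zero]
        refine (lowerSemicontinuous_ciSup (fun s => ?_) fun x =>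
          (hcont x).norm.lowerSemicontinuous).measurable
        exact ⟨_, by rintro _ ⟨x, rfl⟩; exact (smoothBounded_slice hf hM s.2).norm_le x⟩
      · simp only [semNA, if_neg h0.ne', hsemN, iteratedFDeriv_zero_sub_norm]
        refine (lowerSemicontinuous_ciSup (fun s => ?_) fun (p : { p : E3 × E3 // p.1 ≠ p.2 }) =>
          (((hcont p.1.1).sub (hcont p.1.2)).norm.div_const _).lowerSemicontinuous).measurable
        refine ⟨semNA 0 α (f s), ?_⟩
        rintro _ ⟨p, rfl⟩
        have : 0 < ‖p.1.1 - p.1.2‖ := norm_pos_iff.2 (sub_ne_zero.2 p.2)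
        exact (div_le_iff₀ (by positivity)).2
          ((smoothBounded_slice hf hM s.2).norm_sub_le_hsemN h0 hα.2 _ _)
    rw [intervalIntegrable_iff_integrableOn_Icc_of_le h.le]
    refine ⟨(aemeasurable_restrict_of_measurable_subtype measurableSet_Icc
      hmeas).aestronglyMeasurable, .restrict_of_bounded (C := C) (by simp) ?_⟩
    filter_upwards [ae_restrict_mem measurableSet_Icc] with s hs
    rw [Real.norm_of_nonneg (semNA_nonneg _ _ _)]
    exact hC s hs

end Time

/-- Integral form of Grönwall's inequality, with non-sharp constants but for merely integrable
functions. -/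
lemma le_exp_of_le_integral {φ : ℝ → ℝ} {a b A K M : ℝ} (hab : a ≤ b)
    (hφ : IntervalIntegrable φ volume a b) (hφ0 : ∀ s ∈ Icc a b, 0 ≤ φ s)
    (hM : ∀ s ∈ Icc a b, φ s ≤ M) (hK : 0 ≤ K)
    (h : ∀ s ∈ Icc a b, φ s ≤ A + K * ∫ τ in a..s, φ τ) :
    φ b ≤ 2 * A * Real.exp (2 * K * (b - a)) := by
  have ha : a ∈ Icc a b := left_mem_Icc.2 hab
  have hb : b ∈ Icc a b := right_mem_Icc.2 hab
  have hA : 0 ≤ A := by simpa using (hφ0 a ha).trans (h a ha)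
  have : Nonempty (Icc a b) := ⟨⟨a, ha⟩⟩
  set e : ℝ → ℝ := fun s => Real.exp (2 * K * (s - a)) with he
  have he0 : ∀ s, 0 < e s := fun s => Real.exp_pos _
  have he1 : ∀ s ∈ Icc a b, 1 ≤ e s := fun s hs =>
    Real.one_le_exp (mul_nonneg (by positivity) (sub_nonneg.2 hs.1))
  have hec : Continuous e := by fun_prop
  set m : ℝ := ⨆ s : Icc a b, φ s / e s with hm
  have hle : ∀ s ∈ Icc a b, φ s ≤ m * e s := fun s hs => by
    rw [← div_le_iff₀ (he0 s)]
    refine le_ciSup (f := fun s : Icc a b => φ s / e s) ⟨M, ?_⟩ ⟨s, hs⟩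
    rintro _ ⟨τ, rfl⟩
    exact (div_le_self (hφ0 τ τ.2) (he1 τ τ.2)).trans (hM τ τ.2)
  have hm0 : 0 ≤ m := Real.iSup_nonneg fun s => div_nonneg (hφ0 s s.2) (he0 s).le
  have hint : ∀ s, ∫ τ in a..s, K * e τ = (e s - 1) / 2 := fun s => by
    have hd : ∀ τ ∈ uIcc a s, HasDerivAt (fun τ => e τ / 2) (K * e τ) τ := fun τ _ => by
      have := ((((hasDerivAt_id τ).sub_const a).const_mul (2 * K)).exp).div_const 2
      refine this.congr_deriv ?_
      simp only [he, id]
      ring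
    rw [intervalIntegral.integral_eq_sub_of_hasDerivAt hd
      ((continuous_const.mul hec).intervalIntegrable _ _)]
    simp [he]
    ring
  have hmA : m ≤ A + m / 2 := by
    refine ciSup_le fun ⟨s, hs⟩ => ?_
    rw [div_le_iff₀ (he0 s)]
    have hsub : uIcc a s ⊆ uIcc a b := by
      rw [uIcc_of_le hs.1, uIcc_of_le hab]
      exact Icc_subset_Icc_right hs.2
    have h1 : ∫ τ in a..s, φ τ ≤ ∫ τ in a..s, m * e τ :=
      intervalIntegral.integral_mono_on hs.1 (hφ.mono_set hsub)
        ((continuous_const.mul hec).intervalIntegrable _ _)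
        fun τ hτ => hle τ ⟨hτ.1, hτ.2.trans hs.2⟩
    have h2 := mul_le_mul_of_nonneg_left h1 hK
    have h3 : K * ∫ τ in a..s, m * e τ = m * ((e s - 1) / 2) := by
      rw [← hint, ← intervalIntegral.integral_const_mul, ← intervalIntegral.integral_const_mul]
      congr 1; ext τ; ring
    rw [h3] at h2
    nlinarith [h s hs, he1 s hs]
  calc φ b ≤ m * e b := hle b hb
    _ ≤ 2 * A * e b := mul_le_mul_of_nonneg_right (by linarith) (he0 b).le

/-- Cauchy's formula for repeated integration. -/
lemma integral_integral_eq_integral_sub_mul {φ : ℝ → ℝ} {a b : ℝ}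
    (hφ : IntervalIntegrable φ volume a b) :
    ∫ s in a..b, ∫ τ in a..s, φ τ = ∫ s in a..b, (b - s) * φ s := by
  have h1 := hφ.absolutelyContinuousOnInterval_intervalIntegral (c := a) (by simp)
  have h2 : AbsolutelyContinuousOnInterval (fun s : ℝ => s - b) a b :=
    ContDiffOn.absolutelyContinuousOnInterval (by fun_prop)
  have h3 := h1.integral_mul_deriv_eq_deriv_mul h2
  simp only [deriv_sub_const, deriv_id'', mul_one, sub_self, mul_zero,
    intervalIntegral.integral_same, zero_mul, zero_sub] at h3
  rw [h3, ← intervalIntegral.integral_neg]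
  refine intervalIntegral.integral_congr_ae ?_
  filter_upwards [hφ.ae_hasDerivAt_integral] with s hs hs'
  rw [(hs (uIoc_subset_uIcc hs') a (by simp)).deriv]
  ring

namespace TransportSolution

variable {t₀ t V L : ℝ} {v : ℝ → E3 → E3} {g f : ℝ → E3 → F}

/-- Transport estimate when the commutators are controlled by a given function `β` plus a multiple
of the seminorm to be estimated. -/
lemma semNA_le_exp_mul [CompleteSpace F] {α : ℝ} (hα : α ∈ Ico (0 : ℝ) 1) (N : ℕ)
    (S : TransportSolution t₀ t V L v g f) {β : ℝ → ℝ} {K M : ℝ} (hK : 0 ≤ K)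
    (hg : IntervalIntegrable (fun s => semNA N α (g s)) volume t₀ t)
    (hf : IntervalIntegrable (fun s => semNA N α (f s)) volume t₀ t)
    (hfM : ∀ s ∈ Icc t₀ t, semNA N α (f s) ≤ M)
    (hβ : IntervalIntegrable β volume t₀ t) (hβ0 : ∀ s ∈ Icc t₀ t, 0 ≤ β s)
    (hr : ∀ s ∈ Icc t₀ t, ∀ i j, i + j + 1 = N →
      semNA (i + 1) α (f s) * semN (j + 1) (v s) + semN (i + 1) (f s) * semNA (j + 1) α (v s)
        ≤ β s + K * V * semNA N α (f s)) :
    semNA N α (f t) ≤ 2 * Real.exp 1 * Real.exp (2 * Real.exp 1 * 2 ^ N * K) *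
      (semNA N α (f t₀) + ∫ s in t₀..t, (semNA N α (g s) + 2 ^ N * β s)) := by
  have hV := S.nonneg
  have hKV : 0 ≤ K * V := mul_nonneg hK hV
  have he := Real.exp_pos 1
  have hI : IntervalIntegrable (fun s => semNA N α (g s) + 2 ^ N * β s) volume t₀ t :=
    hg.add (hβ.const_mul _)
  have hI0 : ∀ s ∈ Icc t₀ t, 0 ≤ semNA N α (g s) + 2 ^ N * β s := fun s hs =>
    add_nonneg (semNA_nonneg _ _ _) (mul_nonneg (by positivity) (hβ0 s hs))
  set J := ∫ s in t₀..t, (semNA N α (g s) + 2 ^ N * β s) with hJ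
  have hJ0 : 0 ≤ J := intervalIntegral.integral_nonneg S.lt.le hI0
  have h0 := semNA_nonneg N α (f t₀)
  have key := le_exp_of_le_integral (A := Real.exp 1 * (semNA N α (f t₀) + J))
    (K := Real.exp 1 * 2 ^ N * (K * V)) S.lt.le hf (fun s _ => semNA_nonneg _ _ _) hfM
    (by positivity) fun s hs => ?_
  · refine key.trans ?_
    have h1 : 2 * (Real.exp 1 * 2 ^ N * (K * V)) * (t - t₀) ≤ 2 * Real.exp 1 * 2 ^ N * K := by
      have := mul_le_mul_of_nonneg_left S.mul_le
        (show 0 ≤ 2 * Real.exp 1 * 2 ^ N * K by positivity)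
      linarith
    have h2 := mul_le_mul_of_nonneg_left (Real.exp_le_exp.2 h1)
      (show 0 ≤ 2 * (Real.exp 1 * (semNA N α (f t₀) + J)) by positivity)
    linarith
  · rcases hs.1.eq_or_lt with rfl | hlt
    · have := Real.one_le_exp zero_le_one
      simp only [intervalIntegral.integral_same, mul_zero, add_zero]
      nlinarith
    have hsub : uIcc t₀ s ⊆ uIcc t₀ t := by
      rw [uIcc_of_le hs.1, uIcc_of_le S.lt.le]
      exact Icc_subset_Icc_right hs.2
    have hsub' : uIcc s t ⊆ uIcc t₀ t := by
      rw [uIcc_of_le hs.2, uIcc_of_le S.lt.le]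
      exact Icc_subset_Icc_left hs.1
    have hIs := hI.mono_set hsub
    have hfs := hf.mono_set hsub
    have hfK := hfs.const_mul (2 ^ N * (K * V))
    have h1 := (S.restrict ⟨hlt, hs.2⟩).semNA_le_integral hα N (hIs.add hfK)
      (r := fun τ => β τ + K * V * semNA N α (f τ))
      (fun τ hτ => hr τ ⟨hτ.1, hτ.2.trans hs.2⟩)
      (fun τ hτ => add_nonneg (hβ0 τ ⟨hτ.1, hτ.2.trans hs.2⟩)
        (mul_nonneg hKV (semNA_nonneg _ _ _)))
      (fun τ hτ => le_of_eq (by ring))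
    rw [intervalIntegral.integral_add hIs hfK, intervalIntegral.integral_const_mul] at h1
    have h2 : ∫ τ in t₀..s, (semNA N α (g τ) + 2 ^ N * β τ) ≤ J := by
      rw [hJ, ← intervalIntegral.integral_add_adjacent_intervals hIs
        (hI.mono_set hsub')]
      have := intervalIntegral.integral_nonneg (μ := volume) hs.2
        fun τ hτ => hI0 τ ⟨hs.1.trans hτ.1, hτ.2⟩
      linarith
    have h3 := mul_le_mul_of_nonneg_left h2 he.le
    linarith

/-- Propagation of the Lipschitz seminorm. -/
lemma semN_one_le [CompleteSpace F] (S : TransportSolution t₀ t V L v g f) {M : ℝ}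
    (hg : IntervalIntegrable (fun s => semN 1 (g s)) volume t₀ t)
    (hf : IntervalIntegrable (fun s => semN 1 (f s)) volume t₀ t)
    (hfM : ∀ s ∈ Icc t₀ t, semN 1 (f s) ≤ M) :
    semN 1 (f t) ≤ 2 * Real.exp 1 * Real.exp (8 * Real.exp 1) *
      (semN 1 (f t₀) + ∫ s in t₀..t, semN 1 (g s)) := by
  have key := S.semNA_le_exp_mul (α := 0) (by simp) 1 (β := fun _ => 0) (K := 2) (M := M)
    zero_le_two
  simp only [semNA_zero_right] at key
  have h1 := key hg hf hfM (by simp) (by simp) fun s hs i j hij => by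
    obtain ⟨rfl, rfl⟩ : i = 0 ∧ j = 0 := by omega
    have := mul_le_mul_of_nonneg_left (S.v_lip s hs) (semN_nonneg 1 (f s))
    simp only [zero_add]
    linarith
  convert h1 using 2
  · ring_nf
  · simp

lemma integral_semN_one_le [CompleteSpace F] (S : TransportSolution t₀ t V L v g f) {M : ℝ}
    (hg : IntervalIntegrable (fun s => semN 1 (g s)) volume t₀ t)
    (hf : IntervalIntegrable (fun s => semN 1 (f s)) volume t₀ t)
    (hfM : ∀ s ∈ Icc t₀ t, semN 1 (f s) ≤ M) :
    ∫ s in t₀..t, semN 1 (f s) ≤ 2 * Real.exp 1 * Real.exp (8 * Real.exp 1) *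
      ((t - t₀) * semN 1 (f t₀) + ∫ s in t₀..t, (t - s) * semN 1 (g s)) := by
  have hI : IntervalIntegrable (fun s => ∫ τ in t₀..s, semN 1 (g τ)) volume t₀ t :=
    (intervalIntegral.continuousOn_primitive_interval' hg left_mem_uIcc).intervalIntegrable
  have hc := (intervalIntegrable_const (μ := volume) (a := t₀) (b := t)
    (c := semN 1 (f t₀))).add hI
  rw [← integral_integral_eq_integral_sub_mul hg]
  refine (intervalIntegral.integral_mono_on S.lt.le hf
    (hc.const_mul (2 * Real.exp 1 * Real.exp (8 * Real.exp 1))) fun s hs => ?_).trans_eq ?_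
  · rcases hs.1.eq_or_lt with rfl | hlt
    · have h1 := Real.one_le_exp zero_le_one
      have h2 := Real.one_le_exp (show 0 ≤ 8 * Real.exp 1 by positivity)
      have h3 : 1 ≤ 2 * Real.exp 1 * Real.exp (8 * Real.exp 1) := by nlinarith
      simpa using le_mul_of_one_le_left (semN_nonneg 1 (f t₀)) h3
    · have hsub : uIcc t₀ s ⊆ uIcc t₀ t := by
        rw [uIcc_of_le hs.1, uIcc_of_le S.lt.le]
        exact Icc_subset_Icc_right hs.2
      exact (S.restrict ⟨hlt, hs.2⟩).semN_one_le (hg.mono_set hsub) (hf.mono_set hsub)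
        fun τ hτ => hfM τ ⟨hτ.1, hτ.2.trans hs.2⟩
  · rw [intervalIntegral.integral_const_mul, intervalIntegral.integral_add _ hI]
    · simp
    · simp

end TransportSolution

end Transport

/-- Transport estimate for higher Hölder seminorms `[·]_{N+α}`, `N ≥ 1`, `α ∈ [0,1)`,
under the assumption `|t − t₀| ‖v_{[t₀,t]}‖₁ ≤ 1`. -/
theorem stmt5 :
    ∀ N : ℕ, 1 ≤ N → ∀ α : ℝ, α ∈ Ico (0 : ℝ) 1 →
      ∃ C : ℝ, 0 < C ∧
        ∀ (t₀ t : ℝ) (v : ℝ → E3 → E3) (g f : ℝ → E3 → ℝ),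
          t₀ ≤ t →
          ContDiffOn ℝ (⊤ : ℕ∞) (fun q : ℝ × E3 => v q.1 q.2) (Icc t₀ t ×ˢ univ) →
          (∀ n : ℕ, ∃ M : ℝ, ∀ s ∈ Icc t₀ t, ∀ x, ‖iteratedFDeriv ℝ n (v s) x‖ ≤ M) →
          (t - t₀) * vnorm1 t₀ t v ≤ 1 →
          ContDiffOn ℝ (⊤ : ℕ∞) (fun q : ℝ × E3 => g q.1 q.2) (Icc t₀ t ×ˢ univ) →
          (∀ n : ℕ, ∃ M : ℝ, ∀ s ∈ Icc t₀ t, ∀ x, ‖iteratedFDeriv ℝ n (g s) x‖ ≤ M) →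
          ContDiffOn ℝ (⊤ : ℕ∞) (fun q : ℝ × E3 => f q.1 q.2) (Icc t₀ t ×ˢ univ) →
          (∀ n : ℕ, ∃ M : ℝ, ∀ s ∈ Icc t₀ t, ∀ x, ‖iteratedFDeriv ℝ n (f s) x‖ ≤ M) →
          (∀ s ∈ Icc t₀ t, ∀ x : E3,
            HasDerivWithinAt (fun τ => f τ x)
              (g s x - fderiv ℝ (f s) x (v s x)) (Icc t₀ t) s) →
          semNA N α (f t) ≤ C *
            (semNA N α (f t₀)
              + (t - t₀) * vsemNA t₀ t N α v * semN 1 (f t₀)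
              + ∫ s in t₀..t,
                  (semNA N α (g s) + (t - s) * vsemNA t₀ t N α v * semN 1 (g s))) := by
  intro N hN α hα
  obtain ⟨m, rfl⟩ : ∃ m, N = m + 1 := ⟨N - 1, by omega⟩
  obtain ⟨C, hC, hprod⟩ := exists_mul_semNA_le (E3 →L[ℝ] ℝ) (E3 →L[ℝ] E3) m hα
  set C₁ := 2 * Real.exp 1 * Real.exp (8 * Real.exp 1) with hC₁
  set C₂ := 2 * Real.exp 1 * Real.exp (2 * Real.exp 1 * 2 ^ (m + 1) * C) with hC₂
  have he := Real.one_le_exp zero_le_one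
  have hC₁1 : 1 ≤ C₁ := by
    have := Real.one_le_exp (show 0 ≤ 8 * Real.exp 1 by positivity)
    nlinarith
  have hC₂1 : 1 ≤ C₂ := by
    have := Real.one_le_exp (show 0 ≤ 2 * Real.exp 1 * 2 ^ (m + 1) * C by positivity)
    nlinarith
  set D := 2 ^ (m + 1) * C * C₁ with hD
  have hD1 : 1 ≤ D :=
    one_le_mul_of_one_le_of_one_le
      (one_le_mul_of_one_le_of_one_le (one_le_pow₀ one_le_two) hC) hC₁1
  have hCD : 1 ≤ C₂ * D := one_le_mul_of_one_le_of_one_le hC₂1 hD1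
  refine ⟨C₂ * D, by positivity, fun t₀ t v g f htt hvs hvM hvT hgs hgM hfs hfM hpde => ?_⟩
  rcases htt.eq_or_lt with rfl | hlt
  · simpa using le_mul_of_one_le_left (semNA_nonneg (m + 1) α (f t₀)) hCD
  have h01 : (0 : ℝ) ∈ Ico (0 : ℝ) 1 := by simp
  have hvn : ∀ s ∈ Icc t₀ t, semN 1 (v s) ≤ vnorm1 t₀ t v := fun s hs => by
    obtain ⟨M, hM⟩ := hvM 0
    obtain ⟨M', hM'⟩ := hvM 1
    rw [← sem1_eq]
    refine (le_max_right _ _).trans (le_ciSup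
      (f := fun s : Icc t₀ t => max (sup0 (v s.1)) (sem1 (v s.1))) ⟨max M M', ?_⟩ ⟨s, hs⟩)
    rintro _ ⟨τ, rfl⟩
    refine max_le_max (ciSup_le fun x => ?_) ?_
    · rw [← norm_iteratedFDeriv_zero (𝕜 := ℝ)]
      exact hM τ τ.2 x
    · rw [sem1_eq]
      exact semN_le (hM' τ τ.2)
  have hvN : ∀ s ∈ Icc t₀ t, semNA (m + 1) α (v s) ≤ vsemNA t₀ t (m + 1) α v := fun s hs => by
    obtain ⟨M, hM⟩ := exists_semNA_le hα hvs hvM (m + 1)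
    refine le_ciSup (f := fun s : Icc t₀ t => semNA (m + 1) α (v s.1)) ⟨M, ?_⟩ ⟨s, hs⟩
    rintro _ ⟨τ, rfl⟩
    exact hM τ τ.2
  set V := vnorm1 t₀ t v
  set W := vsemNA t₀ t (m + 1) α v
  have hW : 0 ≤ W := (semNA_nonneg _ _ _).trans (hvN t ⟨htt, le_rfl⟩)
  obtain ⟨L, hL⟩ := hvM 0
  have S : TransportSolution t₀ t V L v g f :=
    { lt := hlt
      mul_le := hvT
      v_smooth := hvs
      v_bdd := fun s => smoothBounded_slice hvs hvM
      v_sup := fun s hs => semN_le (hL s hs)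
      v_lip := hvn
      g_smooth := hgs
      g_bdd := fun s => smoothBounded_slice hgs hgM
      f_smooth := hfs
      f_bdd := fun s => smoothBounded_slice hfs hfM
      deriv := hpde }
  have hgN := intervalIntegrable_semNA hα hlt hgs hgM (m + 1)
  have hfN := intervalIntegrable_semNA hα hlt hfs hfM (m + 1)
  have hg1 := intervalIntegrable_semNA h01 hlt hgs hgM 1
  have hf1 := intervalIntegrable_semNA h01 hlt hfs hfM 1
  obtain ⟨M, hM⟩ := exists_semNA_le hα hfs hfM (m + 1)
  obtain ⟨M₁, hM₁⟩ := exists_semNA_le h01 hfs hfM 1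
  simp only [semNA_zero_right] at hg1 hf1 hM₁
  have h1 := S.integral_semN_one_le hg1 hf1 hM₁
  have hβ := hf1.const_mul (C * W)
  have h2 := S.semNA_le_exp_mul hα (m + 1) (β := fun s => C * W * semN 1 (f s)) (K := C)
    (by positivity) hgN hfN hM hβ
    (fun s _ => mul_nonneg (by positivity) (semN_nonneg _ _)) fun s hs i j hij => by
      have h3 := hprod _ _ (S.f_bdd s hs).fderiv (S.v_bdd s hs).fderiv i j (by omega)
      simp only [semN_fderiv, semNA_fderiv, zero_add] at h3
      refine h3.trans ?_
      have h4 := mul_le_mul_of_nonneg_left (hvN s hs) (semN_nonneg 1 (f s))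
      have h5 := mul_le_mul_of_nonneg_left (hvn s hs) (semNA_nonneg (m + 1) α (f s))
      have h6 := mul_le_mul_of_nonneg_left (add_le_add h4 h5) (show 0 ≤ C by positivity)
      linarith
  rw [intervalIntegral.integral_add hgN (hβ.const_mul _), intervalIntegral.integral_const_mul,
    intervalIntegral.integral_const_mul] at h2
  have hgt : IntervalIntegrable (fun s => (t - s) * semN 1 (g s)) volume t₀ t :=
    hg1.continuousOn_mul (by fun_prop)
  have hsplit : ∫ s in t₀..t, (semNA (m + 1) α (g s) + (t - s) * W * semN 1 (g s)) =
      (∫ s in t₀..t, semNA (m + 1) α (g s)) + W * ∫ s in t₀..t, (t - s) * semN 1 (g s) := by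
    rw [← intervalIntegral.integral_const_mul,
      ← intervalIntegral.integral_add hgN (hgt.const_mul _)]
    congr 1
    ext s
    ring
  rw [hsplit]
  have hG : 0 ≤ ∫ s in t₀..t, semNA (m + 1) α (g s) :=
    intervalIntegral.integral_nonneg htt fun s _ => semNA_nonneg _ _ _
  have h7 := mul_le_mul_of_nonneg_left h1 (show 0 ≤ 2 ^ (m + 1) * (C * W) by positivity)
  have h8 := le_mul_of_one_le_left (add_nonneg (semNA_nonneg (m + 1) α (f t₀)) hG) hD1
  refine h2.trans ?_
  rw [mul_assoc C₂]
  refine mul_le_mul_of_nonneg_left ?_ (by positivity)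
  rw [hD] at h8 ⊢
  linarith
end
end

section
/- For every integer N ≥ 2 there exists a constant C (depending only on N) with the following property. Let t₀ ≤ t, let v : [t₀,t] × ℝ³ → ℝ³ be smooth and bounded together with all its spatial derivatives, with |t − t₀| ‖v_{[t₀,t]}‖_1 ≤ 1. Let X(s,x) be the flow of v, i.e. ∂_s X(s,x) = v(s, X(s,x)) with X(t₀,x) = x, and let φ(t,·) := X(t,·)^{−1} be the spatial inverse of the time-t flow map. Then [φ(t,·)]_N ≤ C |t − t₀| [v_{[t₀,t]}]_N. -/
open Set

noncomputable section

/-- `[v_{[t₀,t]}]_N = sup_{s ∈ [t₀,t]} [v(s,·)]_N`. -/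
def vsemN (t₀ t : ℝ) (N : ℕ) (v : ℝ → E3 → E3) : ℝ :=
  ⨆ s : Icc t₀ t, semN N (v s.1)

section SmoothBounds

variable {E F : Type*} [NormedAddCommGroup E] [NormedSpace ℝ E]
  [NormedAddCommGroup F] [NormedSpace ℝ F]

/-- Landau's inequality at the length scale `h`. -/
theorem norm_fderiv_le_of_norm_le_of_lipschitz {g : E → F} (hg : Differentiable ℝ g) {b c h : ℝ}
    (hh : 0 < h) (hb : ∀ x, ‖g x‖ ≤ b)
    (hc : ∀ x y, ‖fderiv ℝ g y - fderiv ℝ g x‖ ≤ c * ‖y - x‖) (hc0 : 0 ≤ c) (x : E) :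
    ‖fderiv ℝ g x‖ ≤ 2 * b / h + h * c := by
  have hb0 : 0 ≤ b := (norm_nonneg _).trans (hb x)
  refine ContinuousLinearMap.opNorm_le_of_unit_norm (by positivity) fun e he => ?_
  have key : ‖g (x + h • e) - g x - fderiv ℝ g x ((x + h • e) - x)‖ ≤
      c * h * ‖(x + h • e) - x‖ := by
    refine Convex.norm_image_sub_le_of_norm_fderiv_le' (𝕜 := ℝ) (s := Metric.closedBall x h)
      (fun y _ => hg y) (fun y hy => ?_) (convex_closedBall x h)
      (Metric.mem_closedBall_self hh.le) ?_
    · refine (hc x y).trans ?_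
      gcongr
      simpa [dist_eq_norm] using hy
    · simp [Metric.mem_closedBall, dist_eq_norm, norm_smul, he, abs_of_pos hh]
  have hn : ‖h • e‖ = h := by simp [norm_smul, he, abs_of_pos hh]
  rw [add_sub_cancel_left, hn, map_smul] at key
  have h1 : ‖h • fderiv ℝ g x e‖ ≤ 2 * b + c * h * h := by
    have e1 : h • fderiv ℝ g x e =
        g (x + h • e) - g x - (g (x + h • e) - g x - h • fderiv ℝ g x e) := by abel
    rw [e1]
    calc _ ≤ ‖g (x + h • e)‖ + ‖g x‖ + c * h * h :=
          (norm_sub_le _ _).trans (add_le_add (norm_sub_le _ _) key)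
      _ ≤ _ := by linarith [hb x, hb (x + h • e)]
  rw [norm_smul, Real.norm_of_nonneg hh.le] at h1
  have e2 : 2 * b / h + h * c = (2 * b + c * h * h) / h := by field_simp
  rw [e2, le_div_iff₀ hh]
  linarith

theorem exists_le_eps_mul_add_of_landau (j : ℕ) :
    ∀ ε : ℝ, 0 < ε → ∃ C : ℝ, 0 ≤ C ∧ ∀ b : ℕ → ℝ, (∀ i, 0 ≤ b i) →
      (∀ i, ∀ h : ℝ, 0 < h → b (i + 1) ≤ 2 * b i / h + h * b (i + 2)) →
      b (j + 1) ≤ ε * b (j + 2) + C * b 0 := by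
  induction j with
  | zero =>
    intro ε hε
    refine ⟨2 / ε, by positivity, fun b _ hb => ?_⟩
    have := hb 0 ε hε
    have e : 2 * b 0 / ε = 2 / ε * b 0 := by ring
    simp only [zero_add] at *
    linarith
  | succ j ih =>
    intro ε hε
    obtain ⟨C, hC, H⟩ := ih (ε / 8) (by positivity)
    refine ⟨8 * C / ε, by positivity, fun b hb0 hb => ?_⟩
    have h1 := hb (j + 1) (ε / 2) (by positivity)
    have h2 := H b hb0 hb
    have e1 : 2 * b (j + 1) / (ε / 2) = 4 / ε * b (j + 1) := by field_simp; ring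
    have h3 : 4 / ε * b (j + 1) ≤ 4 / ε * (ε / 8 * b (j + 2) + C * b 0) := by gcongr
    have e2 : 4 / ε * (ε / 8 * b (j + 2) + C * b 0) = b (j + 2) / 2 + (8 * C / ε * b 0) / 2 := by
      field_simp; ring
    simp only [add_assoc, Nat.reduceAdd] at *
    linarith

theorem exists_bound_of_landau (m : ℕ) :
    ∃ K : ℝ, 0 ≤ K ∧ ∀ b : ℕ → ℝ, (∀ i, 0 ≤ b i) →
      (∀ i, ∀ h : ℝ, 0 < h → b (i + 1) ≤ 2 * b i / h + h * b (i + 2)) →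
      b 0 ≤ 1 → ∀ j ≤ m, b j ≤ K * (1 + b m) := by
  induction m with
  | zero =>
    refine ⟨1, zero_le_one, fun b _ _ _ j hj => ?_⟩
    obtain rfl : j = 0 := by omega
    linarith
  | succ m ih =>
    obtain ⟨K, hK, H⟩ := ih
    have hC : ∃ C : ℝ, 0 ≤ C ∧ ∀ b : ℕ → ℝ, (∀ i, 0 ≤ b i) →
        (∀ i, ∀ h : ℝ, 0 < h → b (i + 1) ≤ 2 * b i / h + h * b (i + 2)) →
        b m ≤ b (m + 1) + C * b 0 := by
      cases m with
      | zero => exact ⟨1, zero_le_one, fun b hb _ => by linarith [hb (0 + 1)]⟩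
      | succ m =>
        obtain ⟨C, hC, H'⟩ := exists_le_eps_mul_add_of_landau m 1 one_pos
        exact ⟨C, hC, fun b h1 h2 => by simpa using H' b h1 h2⟩
    obtain ⟨C, hC, H'⟩ := hC
    refine ⟨K * (1 + C) + 1, by positivity, fun b hb0 hb hb1 j hj => ?_⟩
    have hx := hb0 (m + 1)
    rcases Nat.lt_or_ge m j with h | h
    · obtain rfl : j = m + 1 := by omega
      nlinarith [mul_nonneg hK (add_nonneg zero_le_one hC)]
    · have h1 := H b hb0 hb hb1 j h
      have h2 := H' b hb0 hb
      have h3 : b m ≤ b (m + 1) + C := by nlinarith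
      have h4 : K * (1 + b m) ≤ K * (1 + (b (m + 1) + C)) := by gcongr
      nlinarith [mul_nonneg hK hC, mul_nonneg (mul_nonneg hK hC) hx]

/-- Interpolation: bounds on the first and on the `N`-th derivative of a map with bounded
derivatives bound all the derivatives in between, uniformly. -/
theorem exists_norm_iteratedFDeriv_le (N : ℕ) :
    ∃ K : ℝ, 0 ≤ K ∧ ∀ u : E → F, ContDiff ℝ (⊤ : ℕ∞) u →
      (∀ n : ℕ, ∃ M : ℝ, ∀ x, ‖iteratedFDeriv ℝ n u x‖ ≤ M) →
      (∀ x, ‖iteratedFDeriv ℝ 1 u x‖ ≤ 1) → (∀ x, ‖iteratedFDeriv ℝ (N + 1) u x‖ ≤ 1) →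
      ∀ j ≤ N, ∀ x, ‖iteratedFDeriv ℝ (j + 1) u x‖ ≤ K := by
  obtain ⟨K, hK, H⟩ := exists_bound_of_landau N
  refine ⟨K * 2, by positivity, fun u hu hbdd h1 hN j hj x => ?_⟩
  set b : ℕ → ℝ := fun i => ⨆ x, ‖iteratedFDeriv ℝ (i + 1) u x‖ with hb
  have hbx : ∀ i x, ‖iteratedFDeriv ℝ (i + 1) u x‖ ≤ b i := fun i x => by
    obtain ⟨M, hM⟩ := hbdd (i + 1)
    exact le_ciSup (f := fun x => ‖iteratedFDeriv ℝ (i + 1) u x‖)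
      ⟨M, by rintro _ ⟨y, rfl⟩; exact hM y⟩ x
  have hb0 : ∀ i, 0 ≤ b i := fun i => (norm_nonneg _).trans (hbx i x)
  have hdiff : ∀ i : ℕ, Differentiable ℝ (iteratedFDeriv ℝ i u) := fun i =>
    ContDiff.differentiable_iteratedFDeriv (by exact_mod_cast ENat.natCast_lt_top i) hu
  have hlan : ∀ i, ∀ h : ℝ, 0 < h → b (i + 1) ≤ 2 * b i / h + h * b (i + 2) := by
    intro i h hh
    refine ciSup_le fun y => ?_
    rw [← norm_fderiv_iteratedFDeriv]
    refine norm_fderiv_le_of_norm_le_of_lipschitz (hdiff (i + 1)) hh (hbx i) (fun y z => ?_)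
      (hb0 _) y
    rw [fderiv_iteratedFDeriv, Function.comp_apply, Function.comp_apply, ← dist_eq_norm,
      LinearIsometryEquiv.dist_map, dist_eq_norm]
    refine Convex.norm_image_sub_le_of_norm_fderiv_le (𝕜 := ℝ) (s := univ)
      (fun w _ => hdiff (i + 2) w) (fun w _ => ?_) convex_univ (mem_univ y) (mem_univ z)
    rw [norm_fderiv_iteratedFDeriv]
    exact hbx (i + 2) w
  have hbN : b N ≤ 1 := ciSup_le hN
  calc _ ≤ b j := hbx j x
    _ ≤ K * (1 + b N) := H b hb0 hlan (ciSup_le h1) j hj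
    _ ≤ K * 2 := by gcongr; linarith

/-- A bound on the `n`-th derivatives passes to pointwise limits, if the limit is smooth. -/
theorem norm_iteratedFDeriv_le_of_tendsto (n : ℕ) :
    ∀ (f : ℕ → E → F) (g : E → F) (M : ℝ),
      (∀ᶠ k in Filter.atTop, ContDiff ℝ (⊤ : ℕ∞) (f k)) →
      ContDiff ℝ (⊤ : ℕ∞) g →
      (∀ x, Filter.Tendsto (fun k => f k x) Filter.atTop (nhds (g x))) →
      (∀ᶠ k in Filter.atTop, ∀ x, ‖iteratedFDeriv ℝ n (f k) x‖ ≤ M) →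
      ∀ x, ‖iteratedFDeriv ℝ n g x‖ ≤ M := by
  induction n with
  | zero =>
    intro f g M _ _ hlim hM x
    rw [norm_iteratedFDeriv_zero]
    refine le_of_tendsto (hlim x).norm ?_
    filter_upwards [hM] with k hk
    simpa using hk x
  | succ n ih =>
    intro f g M hf hg hlim hM x
    have hM0 : 0 ≤ M := by
      obtain ⟨k, hk⟩ := hM.exists
      exact (norm_nonneg _).trans (hk x)
    have hshift : ∀ (p : E → F) (h : E), ContDiff ℝ (⊤ : ℕ∞) p →
        ContDiff ℝ (⊤ : ℕ∞) fun y => p (y + h) := fun p h hp =>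
      hp.comp (contDiff_id.add contDiff_const)
    have hD : ∀ (p : E → F) (h y : E), ContDiff ℝ (⊤ : ℕ∞) p →
        iteratedFDeriv ℝ n (fun y => p (y + h) - p y) y =
          iteratedFDeriv ℝ n p (y + h) - iteratedFDeriv ℝ n p y := by
      intro p h y hp
      rw [fun_iteratedFDeriv_sub ((hshift p h hp).of_le (by exact_mod_cast le_top))
        (hp.of_le (by exact_mod_cast le_top))]
      simp only [iteratedFDeriv_comp_add_right]
    have hlip : ∀ h y, ‖iteratedFDeriv ℝ n g (y + h) - iteratedFDeriv ℝ n g y‖ ≤ M * ‖h‖ := by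
      intro h y
      rw [← hD g h y hg]
      refine ih (fun k y => f k (y + h) - f k y) _ _ ?_ ((hshift g h hg).sub hg)
        (fun z => (hlim _).sub (hlim _)) ?_ y
      · filter_upwards [hf] with k hk using (hshift _ h hk).sub hk
      · filter_upwards [hf, hM] with k hk hk2
        intro z
        rw [hD (f k) h z hk]
        have := Convex.norm_image_sub_le_of_norm_fderiv_le (𝕜 := ℝ) (s := univ)
          (f := iteratedFDeriv ℝ n (f k)) (C := M) (x := z) (y := z + h)
          (fun w _ => ContDiff.differentiable_iteratedFDeriv
            (by exact_mod_cast ENat.natCast_lt_top n) hk w)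
          (fun w _ => by rw [norm_fderiv_iteratedFDeriv]; exact hk2 w) convex_univ
          (mem_univ _) (mem_univ _)
        simpa using this
    rw [← norm_fderiv_iteratedFDeriv]
    refine norm_fderiv_le_of_lipschitz ℝ (C := ⟨M, hM0⟩) (LipschitzWith.of_dist_le_mul ?_)
    intro y z
    rw [dist_eq_norm, dist_eq_norm]
    have := hlip (y - z) z
    rwa [add_sub_cancel] at this

theorem norm_iteratedFDeriv_smul_comp_smul_le {f : E → F} (hf : ContDiff ℝ (⊤ : ℕ∞) f)
    {c d M : ℝ} (hc : 0 ≤ c) (hd : 0 ≤ d) (n : ℕ)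
    (hM : ∀ x, ‖iteratedFDeriv ℝ n f x‖ ≤ M) (x : E) :
    ‖iteratedFDeriv ℝ n (fun y => c • f (d • y)) x‖ ≤ c * d ^ n * M := by
  have hfn : ContDiff ℝ n f := hf.of_le (by exact_mod_cast le_top)
  have hfd : ContDiff ℝ n (fun y => f (d • y)) := hfn.comp (contDiff_const_smul d)
  rw [iteratedFDeriv_const_smul_apply' hfd.contDiffAt, iteratedFDeriv_comp_const_smul d hfn,
    norm_smul, norm_smul, Real.norm_of_nonneg hc, norm_pow, Real.norm_of_nonneg hd, mul_assoc]
  gcongr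
  exact hM _

/-- The chain rule for the derivative of order `n + 1`, with the top order term of the inner map
isolated. -/
theorem norm_iteratedFDeriv_succ_comp_le {w Z : E → E} (hw : ContDiff ℝ (⊤ : ℕ∞) w)
    (hZ : ContDiff ℝ (⊤ : ℕ∞) Z) {n : ℕ} {κ D : ℝ} (hD : 1 ≤ D)
    (hκ : ∀ l ≤ n, ∀ x, ‖iteratedFDeriv ℝ (l + 1) w x‖ ≤ κ) (x : E)
    (hZD : ∀ l < n, ‖iteratedFDeriv ℝ (l + 1) Z x‖ ≤ D) :
    ‖iteratedFDeriv ℝ (n + 1) (fun y => w (Z y)) x‖ ≤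
      κ * ‖iteratedFDeriv ℝ (n + 1) Z x‖ + κ * (2 ^ n * n.factorial * D ^ (n + 1)) := by
  have hκ0 : 0 ≤ κ := (norm_nonneg _).trans (hκ 0 (Nat.zero_le _) x)
  have hD0 : 0 ≤ D := zero_le_one.trans hD
  have hw' : ContDiff ℝ (⊤ : ℕ∞) (fderiv ℝ w) := hw.fderiv_right (by simp)
  have hZ' : ContDiff ℝ (⊤ : ℕ∞) (fderiv ℝ Z) := hZ.fderiv_right (by simp)
  have hpow : ∀ {l : ℕ}, 1 ≤ l → D ≤ D ^ l := fun hl => le_self_pow₀ hD (by omega)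
  have hder : fderiv ℝ (fun y => w (Z y)) = fun y =>
      ContinuousLinearMap.compL ℝ E E E (fderiv ℝ w (Z y)) (fderiv ℝ Z y) := by
    funext y
    exact fderiv_comp y (hw.differentiable (by simp) _) (hZ.differentiable (by simp) _)
  rw [← norm_iteratedFDeriv_fderiv, hder]
  refine (ContinuousLinearMap.norm_iteratedFDeriv_le_of_bilinear_of_le_one
    (ContinuousLinearMap.compL ℝ E E E) (hw'.comp hZ) hZ' x (n := n)
    (by exact_mod_cast le_top) (ContinuousLinearMap.norm_compL_le ℝ E E E)).trans ?_
  rw [Finset.sum_range_succ']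
  have h0 : ((n.choose 0 : ℕ) : ℝ) * ‖iteratedFDeriv ℝ 0 (fderiv ℝ w ∘ Z) x‖ *
      ‖iteratedFDeriv ℝ (n - 0) (fderiv ℝ Z) x‖ ≤ κ * ‖iteratedFDeriv ℝ (n + 1) Z x‖ := by
    rw [Nat.choose_zero_right, Nat.cast_one, one_mul, Nat.sub_zero, norm_iteratedFDeriv_fderiv,
      norm_iteratedFDeriv_zero, Function.comp_apply]
    gcongr
    rw [← norm_iteratedFDeriv_one]
    exact hκ 0 (Nat.zero_le _) _
  have h1 : ∑ i ∈ Finset.range n, ((n.choose (i + 1) : ℕ) : ℝ) *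
      ‖iteratedFDeriv ℝ (i + 1) (fderiv ℝ w ∘ Z) x‖ *
      ‖iteratedFDeriv ℝ (n - (i + 1)) (fderiv ℝ Z) x‖ ≤
      ∑ i ∈ Finset.range n, ((n.choose (i + 1) : ℕ) : ℝ) *
        (κ * (n.factorial * D ^ (n + 1))) := by
    refine Finset.sum_le_sum fun i hi => ?_
    have hin : i + 1 ≤ n := Finset.mem_range.mp hi
    rw [mul_assoc]
    refine mul_le_mul_of_nonneg_left ?_ (Nat.cast_nonneg _)
    have ha : ‖iteratedFDeriv ℝ (i + 1) (fderiv ℝ w ∘ Z) x‖ ≤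
        (i + 1).factorial * κ * D ^ (i + 1) := by
      refine norm_iteratedFDeriv_comp_le hw' hZ (by exact_mod_cast le_top) x
        (fun l hl => ?_) (fun l hl hl' => ?_)
      · rw [norm_iteratedFDeriv_fderiv]
        exact hκ l (by omega) _
      · obtain ⟨m, rfl⟩ : ∃ m, l = m + 1 := ⟨l - 1, by omega⟩
        exact (hZD m (by omega)).trans (hpow hl)
    have hb : ‖iteratedFDeriv ℝ (n - (i + 1)) (fderiv ℝ Z) x‖ ≤ D ^ (n - i) := by
      rw [norm_iteratedFDeriv_fderiv]
      exact (hZD _ (by omega)).trans (hpow (by omega))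
    calc _ ≤ ((i + 1).factorial * κ * D ^ (i + 1)) * D ^ (n - i) := by gcongr
      _ = κ * ((i + 1).factorial * D ^ (n + 1)) := by
        have : D ^ (n + 1) = D ^ (i + 1) * D ^ (n - i) := by
          rw [← pow_add]; congr 1; omega
        rw [this]; ring
      _ ≤ _ := by
        have : ((i + 1).factorial : ℝ) ≤ n.factorial := by exact_mod_cast Nat.factorial_le hin
        gcongr
  have h2 : ∑ i ∈ Finset.range n, ((n.choose (i + 1) : ℕ) : ℝ) ≤ 2 ^ n := by
    have := Nat.sum_range_choose n
    rw [Finset.sum_range_succ'] at this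
    exact_mod_cast (Nat.le_add_right _ _).trans this.le
  rw [← Finset.sum_mul] at h1
  have h3 : (∑ i ∈ Finset.range n, ((n.choose (i + 1) : ℕ) : ℝ)) *
      (κ * (n.factorial * D ^ (n + 1))) ≤ 2 ^ n * (κ * (n.factorial * D ^ (n + 1))) := by
    gcongr
  have e : 2 ^ n * (κ * (n.factorial * D ^ (n + 1))) =
    κ * (2 ^ n * n.factorial * D ^ (n + 1)) := by ring
  linarith

end SmoothBounds

/-- Discrete Grönwall inequality. -/
theorem le_exp_mul_of_discrete_gronwall {a : ℕ → ℝ} {K P : ℝ} (hK : 0 ≤ K) (hP : 0 ≤ P)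
    (ha : 0 ≤ a 0) {k : ℕ} (hk : 0 < k)
    (h : ∀ i < k, a (i + 1) ≤ (1 + K / k) * a i + P / k) :
    ∀ i ≤ k, a i ≤ Real.exp K * (a 0 + P) := by
  have hk' : (0 : ℝ) < k := by exact_mod_cast hk
  have key : ∀ i ≤ k, a i ≤ Real.exp (K / k * i) * (a 0 + P / k * i) := by
    intro i
    induction i with
    | zero => simp
    | succ i ih =>
      intro hi
      have h1 := ih (by omega)
      have h2 := h i (by omega)
      have h3 : 1 + K / k ≤ Real.exp (K / k) := by linarith [Real.add_one_le_exp (K / k)]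
      have h4 : (1 : ℝ) ≤ Real.exp (K / k * (i + 1)) := Real.one_le_exp (by positivity)
      have h5 : 0 ≤ P / k := by positivity
      have h6 : (1 + K / k) * a i ≤
          Real.exp (K / k) * (Real.exp (K / k * i) * (a 0 + P / k * i)) := by
        calc _ ≤ (1 + K / k) * (Real.exp (K / k * i) * (a 0 + P / k * i)) := by gcongr
          _ ≤ _ := by gcongr
      have h7 : Real.exp (K / k) * Real.exp (K / k * i) = Real.exp (K / k * (i + 1)) := by
        rw [← Real.exp_add]; congr 1; ring
      rw [← mul_assoc, h7] at h6
      push_cast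
      nlinarith
  intro i hi
  have hik : (i : ℝ) ≤ k := by exact_mod_cast hi
  refine (key i hi).trans ?_
  have h1 : K / k * i ≤ K := by
    rw [div_mul_eq_mul_div, div_le_iff₀ hk']; gcongr
  have h2 : P / k * i ≤ P := by
    rw [div_mul_eq_mul_div, div_le_iff₀ hk']; gcongr
  gcongr

section EulerScheme

variable {E : Type*} [NormedAddCommGroup E] [NormedSpace ℝ E]

/-- The composition of the first `i` maps `id + w 0`, `id + w 1`, …. -/
def eulerMap (w : ℕ → E → E) : ℕ → E → E
  | 0 => id
  | i + 1 => fun y => eulerMap w i y + w i (eulerMap w i y)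

theorem contDiff_eulerMap {w : ℕ → E → E} {k : ℕ} (hw : ∀ i < k, ContDiff ℝ (⊤ : ℕ∞) (w i)) :
    ∀ i ≤ k, ContDiff ℝ (⊤ : ℕ∞) (eulerMap w i) := by
  intro i
  induction i with
  | zero => exact fun _ => contDiff_id
  | succ i ih =>
    intro hi
    exact (ih (by omega)).add ((hw i hi).comp (ih (by omega)))

theorem norm_iteratedFDeriv_succ_id_le (n : ℕ) (x : E) :
    ‖iteratedFDeriv ℝ (n + 1) (id : E → E) x‖ ≤ 1 := by
  have h : fderiv ℝ (id : E → E) = fun _ => ContinuousLinearMap.id ℝ E := funext fun _ => fderiv_id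
  rw [← norm_iteratedFDeriv_fderiv, h]
  cases n with
  | zero => rw [norm_iteratedFDeriv_zero]; exact ContinuousLinearMap.norm_id_le
  | succ n => rw [iteratedFDeriv_succ_const]; simp

/-- The derivatives of the composition of `k` maps that are `K / k`-close to the identity are
bounded uniformly in `k`. -/
theorem exists_norm_iteratedFDeriv_eulerMap_le {K : ℝ} (hK : 0 ≤ K) (N : ℕ) :
    ∃ D : ℝ, 1 ≤ D ∧ ∀ (k : ℕ) (w : ℕ → E → E), 0 < k →
      (∀ i < k, ContDiff ℝ (⊤ : ℕ∞) (w i)) →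
      (∀ i < k, ∀ l < N, ∀ x, ‖iteratedFDeriv ℝ (l + 1) (w i) x‖ ≤ K / k) →
      ∀ i ≤ k, ∀ l < N, ∀ x, ‖iteratedFDeriv ℝ (l + 1) (eulerMap w i) x‖ ≤ D := by
  induction N with
  | zero => exact ⟨1, le_rfl, fun _ _ _ _ _ _ _ l hl => absurd hl (Nat.not_lt_zero l)⟩
  | succ N ih =>
    obtain ⟨D, hD, H⟩ := ih
    have hD0 : 0 ≤ D := zero_le_one.trans hD
    set P : ℝ := K * (2 ^ N * N.factorial * D ^ (N + 1)) with hP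
    have hP0 : 0 ≤ P := by positivity
    refine ⟨max D (Real.exp K * (1 + P)), hD.trans (le_max_left _ _),
      fun k w hk hw hb i hi l hl x => ?_⟩
    have H' := H k w hk hw fun i hi l hl => hb i hi l (by omega)
    rcases Nat.lt_succ_iff_lt_or_eq.mp hl with hl | rfl
    · exact (H' i hi l hl x).trans (le_max_left _ _)
    · refine le_trans ?_ (le_max_right _ _)
      refine (le_exp_mul_of_discrete_gronwall
        (a := fun i => ‖iteratedFDeriv ℝ (l + 1) (eulerMap w i) x‖)
        hK hP0 (norm_nonneg _) hk (fun i hi => ?_) i hi).trans ?_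
      · have hZ := contDiff_eulerMap hw i hi.le
        have h1 := norm_iteratedFDeriv_succ_comp_le (hw i hi) hZ hD
          (fun m hm => hb i hi m (by omega)) x (fun m hm => H' i hi.le m hm x)
        have h2 : iteratedFDeriv ℝ (l + 1) (eulerMap w (i + 1)) x =
            iteratedFDeriv ℝ (l + 1) (eulerMap w i) x +
              iteratedFDeriv ℝ (l + 1) (fun y => w i (eulerMap w i y)) x :=
          iteratedFDeriv_add_apply (hZ.of_le (by exact_mod_cast le_top)).contDiffAt
            (((hw i hi).comp hZ).of_le (by exact_mod_cast le_top)).contDiffAt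
        have h3 : K / k * (2 ^ l * l.factorial * D ^ (l + 1)) = P / k := by rw [hP]; ring
        rw [h3] at h1
        simp only [h2]
        refine (norm_add_le _ _).trans ?_
        linarith
      · gcongr
        exact norm_iteratedFDeriv_succ_id_le l x

/-- The explicit Euler scheme, run backwards in time, converges along a trajectory. -/
theorem tendsto_eulerMap {t₀ t K : ℝ} (ht : t₀ ≤ t) (hK : 0 ≤ K) {v : ℝ → E → E} {γ : ℝ → E}
    (hγ : ∀ s ∈ Icc t₀ t, HasDerivWithinAt γ (v s (γ s)) (Icc t₀ t) s)
    (hcont : ContinuousOn (fun s => v s (γ s)) (Icc t₀ t))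
    (hlip : ∀ s ∈ Icc t₀ t, ∀ x y, (t - t₀) * ‖v s x - v s y‖ ≤ K * ‖x - y‖) :
    Filter.Tendsto (fun k : ℕ => eulerMap
      (fun i x => -((t - t₀) / k) • v (t - i * ((t - t₀) / k)) x) k (γ t))
      Filter.atTop (nhds (γ t₀)) := by
  have hτ : 0 ≤ t - t₀ := sub_nonneg.mpr ht
  rw [Metric.tendsto_atTop]
  intro ε hε
  set ω : ℝ := ε / (2 * (Real.exp K * (t - t₀ + 1))) with hω
  have hω0 : 0 < ω := by positivity
  obtain ⟨η, hη, hη'⟩ := Metric.uniformContinuousOn_iff.mp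
    (isCompact_Icc.uniformContinuousOn_of_continuous hcont) ω hω0
  obtain ⟨n, hn⟩ := exists_nat_gt ((t - t₀) / η)
  refine ⟨n + 1, fun k hk => ?_⟩
  have hk0 : 0 < k := by omega
  have hkR : (0 : ℝ) < k := by exact_mod_cast hk0
  set δ : ℝ := (t - t₀) / k with hδ
  have hδ0 : 0 ≤ δ := by positivity
  have hδk : k * δ = t - t₀ := by rw [hδ]; field_simp
  have hδη : δ < η := by
    have h1 : (n : ℝ) ≤ k := by exact_mod_cast (by omega : n ≤ k)
    have h2 := hn.trans_le h1
    rw [div_lt_iff₀ hη] at h2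
    rw [hδ, div_lt_iff₀ hkR]
    linarith
  have hmem : ∀ i ≤ k, t - i * δ ∈ Icc t₀ t := by
    intro i hi
    have h1 : (i : ℝ) * δ ≤ k * δ := by gcongr
    have h2 : 0 ≤ i * δ := by positivity
    constructor <;> linarith
  set w : ℕ → E → E := fun i x => -δ • v (t - i * δ) x with hw
  have hstep : ∀ i < k, ‖eulerMap w (i + 1) (γ t) - γ (t - (i + 1 : ℕ) * δ)‖ ≤
      (1 + K / k) * ‖eulerMap w i (γ t) - γ (t - i * δ)‖ + (t - t₀) * ω / k := by
    intro i hi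
    have hs := hmem i hi.le
    have hs' := hmem (i + 1) hi
    have hss : t - ((i + 1 : ℕ) : ℝ) * δ = t - i * δ - δ := by push_cast; ring
    rw [hss] at hs' ⊢
    set s := t - i * δ with hsdef
    set Z := eulerMap w i (γ t)
    have hsub : Icc (s - δ) s ⊆ Icc t₀ t := Icc_subset_Icc hs'.1 hs.2
    have hm : ‖(γ (s - δ) - (s - δ) • v s (γ s)) - (γ s - s • v s (γ s))‖ ≤
        ω * ‖(s - δ) - s‖ := by
      refine Convex.norm_image_sub_le_of_norm_hasDerivWithin_le (𝕜 := ℝ)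
        (f := fun r => γ r - r • v s (γ s)) (f' := fun r => v r (γ r) - v s (γ s))
        (s := Icc (s - δ) s) (fun r hr => ?_) (fun r hr => ?_) (convex_Icc _ _)
        (right_mem_Icc.mpr (by linarith)) (left_mem_Icc.mpr (by linarith))
      · have h1 := ((hγ r (hsub hr)).mono hsub).sub
          ((hasDerivWithinAt_id r (Icc (s - δ) s)).smul_const (v s (γ s)))
        rw [one_smul] at h1
        exact h1
      · have h1 := hη' r (hsub hr) s hs (by
          rw [Real.dist_eq, abs_lt]
          constructor <;> linarith [hr.1, hr.2])
        rw [dist_eq_norm] at h1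
        exact h1.le
    have e1 : ‖(s - δ) - s‖ = δ := by
      rw [sub_sub_cancel_left, norm_neg, Real.norm_of_nonneg hδ0]
    rw [e1] at hm
    have e2 : eulerMap w (i + 1) (γ t) - γ (s - δ) =
        (Z - γ s) - δ • (v s Z - v s (γ s)) -
          ((γ (s - δ) - (s - δ) • v s (γ s)) - (γ s - s • v s (γ s))) := by
      change Z + -δ • v s Z - γ (s - δ) = _
      module
    have h2 : ‖δ • (v s Z - v s (γ s))‖ ≤ K / k * ‖Z - γ s‖ := by
      rw [norm_smul, Real.norm_of_nonneg hδ0, hδ, div_mul_eq_mul_div, div_mul_eq_mul_div]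
      have := hlip s hs Z (γ s)
      gcongr
    rw [e2]
    have e3 : (t - t₀) * ω / k = ω * δ := by rw [hδ]; ring
    rw [e3]
    calc _ ≤ ‖Z - γ s‖ + ‖δ • (v s Z - v s (γ s))‖ + ω * δ :=
          (norm_sub_le _ _).trans (add_le_add (norm_sub_le _ _) hm)
      _ ≤ _ := by linarith
  have h0 : ‖eulerMap w 0 (γ t) - γ (t - (0 : ℕ) * δ)‖ = 0 := by simp [eulerMap]
  have hfin := le_exp_mul_of_discrete_gronwall
    (a := fun i => ‖eulerMap w i (γ t) - γ (t - i * δ)‖) hK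
    (mul_nonneg hτ hω0.le) (norm_nonneg _) hk0 hstep k le_rfl
  simp only [h0, hδk, sub_sub_cancel, zero_add] at hfin
  rw [dist_eq_norm]
  refine hfin.trans_lt ?_
  have hexp := Real.exp_pos K
  have e4 : Real.exp K * ((t - t₀ + 1) * ω) = ε / 2 := by rw [hω]; field_simp
  have h5 : Real.exp K * ((t - t₀) * ω) ≤ Real.exp K * ((t - t₀ + 1) * ω) := by
    gcongr
    linarith
  linarith

/-- If the derivatives of a vector field of orders `1, …, N` are at most `K / (t - t₀)`, then the
`N`-th derivative of the inverse of its time-`t` flow map is bounded. -/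
theorem exists_norm_iteratedFDeriv_inverse_flow_le {K : ℝ} (hK : 0 ≤ K) (N : ℕ) :
    ∃ D : ℝ, 1 ≤ D ∧ ∀ (t₀ t : ℝ) (v X : ℝ → E → E) (φ : E → E), t₀ ≤ t →
      (∀ s ∈ Icc t₀ t, ContDiff ℝ (⊤ : ℕ∞) (v s)) →
      ContinuousOn (fun q : ℝ × E => v q.1 q.2) (Icc t₀ t ×ˢ univ) →
      (∀ s ∈ Icc t₀ t, ∀ l ≤ N, ∀ x, (t - t₀) * ‖iteratedFDeriv ℝ (l + 1) (v s) x‖ ≤ K) →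
      (∀ x, X t₀ x = x) →
      (∀ x, ∀ s ∈ Icc t₀ t, HasDerivWithinAt (fun τ => X τ x) (v s (X s x)) (Icc t₀ t) s) →
      ContDiff ℝ (⊤ : ℕ∞) φ → Function.RightInverse φ (X t) →
      ∀ x, ‖iteratedFDeriv ℝ (N + 1) φ x‖ ≤ D := by
  obtain ⟨D, hD, H⟩ := exists_norm_iteratedFDeriv_eulerMap_le (E := E) hK (N + 1)
  refine ⟨D, hD, fun t₀ t v X φ ht hv hcont hb hX0 hX hφ hinv => ?_⟩
  have hτ : 0 ≤ t - t₀ := sub_nonneg.mpr ht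
  set w : ℕ → ℕ → E → E := fun k i x => -((t - t₀) / k) • v (t - i * ((t - t₀) / k)) x with hw
  have hmem : ∀ k i : ℕ, i < k → t - i * ((t - t₀) / k) ∈ Icc t₀ t := by
    intro k i hi
    have hk : (0 : ℝ) < k := by exact_mod_cast (Nat.zero_le i).trans_lt hi
    have h1 : (i : ℝ) * ((t - t₀) / k) ≤ k * ((t - t₀) / k) := by gcongr
    rw [mul_div_cancel₀ _ hk.ne'] at h1
    have h2 : 0 ≤ i * ((t - t₀) / k) := by positivity
    constructor <;> linarith
  have hws : ∀ k, ∀ i < k, ContDiff ℝ (⊤ : ℕ∞) (w k i) := fun k i hi =>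
    (hv _ (hmem k i hi)).const_smul _
  refine norm_iteratedFDeriv_le_of_tendsto (N + 1) (fun k => eulerMap (w k) k) φ D ?_ hφ ?_ ?_
  · exact Filter.Eventually.of_forall fun k => contDiff_eulerMap (hws k) k le_rfl
  · intro y
    have h1 : ContinuousOn (fun s => X s (φ y)) (Icc t₀ t) := fun s hs =>
      (hX (φ y) s hs).continuousWithinAt
    have h2 : ContinuousOn (fun s => v s (X s (φ y))) (Icc t₀ t) :=
      hcont.comp (continuousOn_id.prodMk h1) fun s hs => ⟨hs, mem_univ _⟩
    have h3 := tendsto_eulerMap ht hK (hX (φ y)) h2 (fun s hs a b => ?_)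
    · rw [hinv y, hX0] at h3
      exact h3
    · have := Convex.norm_image_sub_le_of_norm_fderiv_le (𝕜 := ℝ) (s := univ)
        (f := fun z => (t - t₀) • v s z) (C := K) (x := b) (y := a)
        (fun z _ => ((hv s hs).differentiable (by simp) z).const_smul _) (fun z _ => ?_)
        convex_univ (mem_univ _) (mem_univ _)
      · rwa [← smul_sub, norm_smul, Real.norm_of_nonneg hτ] at this
      · rw [fderiv_fun_const_smul ((hv s hs).differentiable (by simp) z), norm_smul,
          Real.norm_of_nonneg hτ, ← norm_iteratedFDeriv_one]
        exact hb s hs 0 (Nat.zero_le _) z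
  · filter_upwards [Filter.eventually_gt_atTop 0] with k hk
    refine H k (w k) hk (hws k) (fun i hi l hl x => ?_) k le_rfl N (Nat.lt_succ_self N)
    have hs := hmem k i hi
    have hkR : (0 : ℝ) < k := by exact_mod_cast hk
    rw [hw, iteratedFDeriv_const_smul_apply'
      ((hv _ hs).of_le (by exact_mod_cast le_top)).contDiffAt, norm_smul, norm_neg,
      Real.norm_of_nonneg (by positivity), div_mul_eq_mul_div]
    have := hb _ hs l (by omega) x
    gcongr

end EulerScheme

theorem norm_iteratedFDeriv_le_vsemN {t₀ t : ℝ} {v : ℝ → E3 → E3}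
    (hbdd : ∀ n : ℕ, ∃ M : ℝ, ∀ s ∈ Icc t₀ t, ∀ x, ‖iteratedFDeriv ℝ n (v s) x‖ ≤ M) (n : ℕ)
    {s : ℝ} (hs : s ∈ Icc t₀ t) (x : E3) :
    ‖iteratedFDeriv ℝ n (v s) x‖ ≤ vsemN t₀ t n v := by
  obtain ⟨M, hM⟩ := hbdd n
  have h1 : ‖iteratedFDeriv ℝ n (v s) x‖ ≤ semN n (v s) :=
    le_ciSup (f := fun x => ‖iteratedFDeriv ℝ n (v s) x‖)
      ⟨M, by rintro _ ⟨y, rfl⟩; exact hM s hs y⟩ x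
  exact h1.trans (le_ciSup (f := fun s : Icc t₀ t => semN n (v s.1))
    ⟨M, by rintro _ ⟨r, rfl⟩; exact ciSup_le fun y => hM r r.2 y⟩ ⟨s, hs⟩)

theorem norm_iteratedFDeriv_one_le_vnorm1 {t₀ t : ℝ} {v : ℝ → E3 → E3}
    (hbdd : ∀ n : ℕ, ∃ M : ℝ, ∀ s ∈ Icc t₀ t, ∀ x, ‖iteratedFDeriv ℝ n (v s) x‖ ≤ M)
    {s : ℝ} (hs : s ∈ Icc t₀ t) (x : E3) :
    ‖iteratedFDeriv ℝ 1 (v s) x‖ ≤ vnorm1 t₀ t v := by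
  obtain ⟨M₀, hM₀⟩ := hbdd 0
  obtain ⟨M₁, hM₁⟩ := hbdd 1
  simp only [norm_iteratedFDeriv_zero, norm_iteratedFDeriv_one] at hM₀ hM₁ ⊢
  have h1 : ‖fderiv ℝ (v s) x‖ ≤ sem1 (v s) :=
    le_ciSup (f := fun x => ‖fderiv ℝ (v s) x‖)
      ⟨M₁, by rintro _ ⟨y, rfl⟩; exact hM₁ s hs y⟩ x
  refine (h1.trans (le_max_right (sup0 (v s)) _)).trans
    (le_ciSup (f := fun s : Icc t₀ t => max (sup0 (v s.1)) (sem1 (v s.1)))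
      ⟨max M₀ M₁, ?_⟩ ⟨s, hs⟩)
  rintro _ ⟨r, rfl⟩
  exact max_le_max (ciSup_le fun y => hM₀ r r.2 y) (ciSup_le fun y => hM₁ r r.2 y)

/-- If `X` is the flow of `v` started at time `t₀`, with `|t − t₀| ‖v_{[t₀,t]}‖₁ ≤ 1`, and
`φ` is the spatial inverse of the time-`t` flow map, then for each `N ≥ 2`
`[φ(t,·)]_N ≤ C |t − t₀| [v_{[t₀,t]}]_N` for a constant `C` depending only on `N`. -/
theorem stmt7 :
    ∀ N : ℕ, 2 ≤ N →
      ∃ C : ℝ, 0 < C ∧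
        ∀ (t₀ t : ℝ) (v : ℝ → E3 → E3) (X : ℝ → E3 → E3) (φ : E3 → E3),
          t₀ ≤ t →
          ContDiffOn ℝ (⊤ : ℕ∞) (fun q : ℝ × E3 => v q.1 q.2) (Icc t₀ t ×ˢ univ) →
          (∀ n : ℕ, ∃ M : ℝ, ∀ s ∈ Icc t₀ t, ∀ x, ‖iteratedFDeriv ℝ n (v s) x‖ ≤ M) →
          (t - t₀) * vnorm1 t₀ t v ≤ 1 →
          (∀ x, X t₀ x = x) →
          (∀ x : E3, ∀ s ∈ Icc t₀ t,
            HasDerivWithinAt (fun τ => X τ x) (v s (X s x)) (Icc t₀ t) s) →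
          ContDiff ℝ (⊤ : ℕ∞) φ →
          Function.LeftInverse φ (X t) →
          Function.RightInverse φ (X t) →
          ∀ x : E3, ‖iteratedFDeriv ℝ N φ x‖ ≤ C * (t - t₀) * vsemN t₀ t N v := by
  intro N hN
  obtain ⟨n, rfl⟩ : ∃ n, N = n + 2 := ⟨N - 2, by omega⟩
  obtain ⟨K, hK, HK⟩ := exists_norm_iteratedFDeriv_le (E := E3) (F := E3) (n + 1)
  obtain ⟨D, hD, HD⟩ := exists_norm_iteratedFDeriv_inverse_flow_le (E := E3) hK (n + 1)
  have hD0 : 0 < D := zero_lt_one.trans_le hD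
  refine ⟨D, hD0, ?_⟩
  intro t₀ t v X φ ht hv hbdd hsmall hX0 hX hφ _ hinv x
  have hτ : 0 ≤ t - t₀ := sub_nonneg.mpr ht
  have hvs : ∀ s ∈ Icc t₀ t, ContDiff ℝ (⊤ : ℕ∞) (v s) := fun s hs =>
    hv.comp_contDiff (contDiff_const.prodMk contDiff_id) fun y => ⟨hs, mem_univ y⟩
  have h1 : ∀ s ∈ Icc t₀ t, ∀ y, (t - t₀) * ‖iteratedFDeriv ℝ 1 (v s) y‖ ≤ 1 := fun s hs y =>
    (mul_le_mul_of_nonneg_left (norm_iteratedFDeriv_one_le_vnorm1 hbdd hs y) hτ).trans hsmall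
  have h2 := fun s (hs : s ∈ Icc t₀ t) y =>
    mul_le_mul_of_nonneg_left (norm_iteratedFDeriv_le_vsemN hbdd (n + 2) hs y) hτ
  have hA : 0 ≤ (t - t₀) * vsemN t₀ t (n + 2) v :=
    (mul_nonneg hτ (norm_nonneg _)).trans (h2 t (right_mem_Icc.mpr ht) x)
  have main : ∀ B : ℝ, (t - t₀) * vsemN t₀ t (n + 2) v < B →
      ‖iteratedFDeriv ℝ (n + 2) φ x‖ ≤ D * B := by
    intro B hB
    have hB0 : 0 < B := hA.trans_lt hB
    obtain ⟨L, hL, hLB⟩ : ∃ L : ℝ, 0 < L ∧ L ^ (n + 1) = B :=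
      ⟨B ^ (((n + 1 : ℕ) : ℝ)⁻¹), Real.rpow_pos_of_pos hB0 _,
        Real.rpow_inv_natCast_pow hB0.le (Nat.succ_ne_zero n)⟩
    have hLi : 0 ≤ L⁻¹ := inv_nonneg.mpr hL.le
    have hscale : ∀ f : E3 → E3, ContDiff ℝ (⊤ : ℕ∞) f → ∀ c d : ℝ,
        ContDiff ℝ (⊤ : ℕ∞) fun y => c • f (d • y) := fun f hf c d =>
      (hf.comp (contDiff_const_smul d)).const_smul c
    have hu : ∀ s ∈ Icc t₀ t, ∀ j ≤ n + 1, ∀ y,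
        (t - t₀) * ‖iteratedFDeriv ℝ (j + 1) (fun y => L • v s (L⁻¹ • y)) y‖ ≤ K := by
      intro s hs j hj y
      have hu' := hscale _ (hvs s hs) L L⁻¹
      have hnorm : ∀ m z, ‖iteratedFDeriv ℝ m
          (fun y => (t - t₀) • ((fun y => L • v s (L⁻¹ • y)) y)) z‖ =
          (t - t₀) * ‖iteratedFDeriv ℝ m (fun y => L • v s (L⁻¹ • y)) z‖ := fun m z => by
        rw [iteratedFDeriv_const_smul_apply' (hu'.of_le (by exact_mod_cast le_top)).contDiffAt,
          norm_smul, Real.norm_of_nonneg hτ]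
      have hbound : ∀ (m : ℕ) (M : ℝ), (∀ z, (t - t₀) * ‖iteratedFDeriv ℝ m (v s) z‖ ≤ M) →
          ∀ z, (t - t₀) * ‖iteratedFDeriv ℝ m (fun y => L • v s (L⁻¹ • y)) z‖ ≤
            L * L⁻¹ ^ m * M := by
        intro m M hM z
        have h3 := norm_iteratedFDeriv_smul_comp_smul_le
          (f := fun y => (t - t₀) • v s y) ((hvs s hs).const_smul (t - t₀))
          hL.le hLi m (M := M) (fun z => by
            rw [iteratedFDeriv_const_smul_apply'
              ((hvs s hs).of_le (by exact_mod_cast le_top)).contDiffAt, norm_smul,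
              Real.norm_of_nonneg hτ]
            exact hM z) z
        rw [← hnorm]
        simpa only [smul_comm L (t - t₀)] using h3
      rw [← hnorm]
      refine HK _ (hu'.const_smul _) (fun m => ?_) (fun z => ?_) (fun z => ?_) j hj y
      · obtain ⟨M, hM⟩ := hbdd m
        refine ⟨L * L⁻¹ ^ m * ((t - t₀) * M), fun z => ?_⟩
        rw [hnorm]
        exact hbound m _ (fun z => mul_le_mul_of_nonneg_left (hM s hs z) hτ) z
      · rw [hnorm]
        refine (hbound 1 1 (h1 s hs) z).trans (le_of_eq ?_)
        field_simp
      · rw [hnorm]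
        refine (hbound (n + 2) B (fun z => (h2 s hs z).trans hB.le) z).trans (le_of_eq ?_)
        rw [← hLB, inv_pow]
        field_simp
        ring
    have hflow := HD t₀ t (fun s y => L • v s (L⁻¹ • y)) (fun s y => L • X s (L⁻¹ • y))
      (fun y => L • φ (L⁻¹ • y)) ht (fun s hs => hscale _ (hvs s hs) _ _) ?_ hu
      (fun y => by rw [hX0, smul_inv_smul₀ hL.ne']) (fun y s hs => ?_) (hscale _ hφ _ _)
      (fun y => by
        change L • X t (L⁻¹ • (L • φ (L⁻¹ • y))) = y
        rw [inv_smul_smul₀ hL.ne', hinv, smul_inv_smul₀ hL.ne'])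
    · have h3 := norm_iteratedFDeriv_smul_comp_smul_le (hscale _ hφ L L⁻¹) hLi hL.le (n + 2)
        hflow x
      simp only [inv_smul_smul₀ hL.ne'] at h3
      refine h3.trans (le_of_eq ?_)
      rw [← hLB]
      field_simp
      ring
    · refine (hv.continuousOn.comp (f := fun q : ℝ × E3 => (q.1, L⁻¹ • q.2)) ?_ ?_).const_smul L
      · fun_prop
      · exact fun q hq => ⟨hq.1, mem_univ _⟩
    · simp only [inv_smul_smul₀ hL.ne']
      exact (hX (L⁻¹ • y) s hs).const_smul L
  refine le_of_forall_pos_le_add fun ε hε => ?_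
  refine (main ((t - t₀) * vsemN t₀ t (n + 2) v + ε / D)
    (lt_add_of_pos_right _ (by positivity))).trans (le_of_eq ?_)
  field_simp
end
end

section
/- Let u : ℝ × ℝ³ → ℝ³ be smooth and bounded together with all its spatial derivatives, and for t ∈ ℝ let μ(t; ·, ·) denote the Lagrangian flow of u started at time t: ∂_r μ(t; r, x) = u(r, μ(t; r, x)) for r ∈ ℝ, with μ(t; t, x) = x. Let G : ℝ × ℝ³ → ℝ^m be smooth and bounded together with all its derivatives, let η ∈ C_c^∞(ℝ), and define the mollification along the Lagrangian flow R(t,x) := ∫_ℝ G(t+s, μ(t; t+s, x)) η(s) ds. Then R is smooth and its advective derivative satisfies, for all (t,x) ∈ ℝ × ℝ³, (∂_t + u·∇) R(t,x) = − ∫_ℝ G(t+s, μ(t; t+s, x)) η'(s) ds. -/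
open MeasureTheory

noncomputable section

open Set Topology
open scoped ContDiff

universe v

section Nemytskii
variable {X : Type*} [TopologicalSpace X] [CompactSpace X]
  {F G : Type v} [NormedAddCommGroup F] [NormedSpace ℝ F] [NormedAddCommGroup G] [NormedSpace ℝ G]

/-- Pointwise application of a continuous family of continuous linear maps, as a continuous
linear map in the family. -/
def pointwiseApplyL (X : Type*) [TopologicalSpace X] [CompactSpace X]
    (F G : Type v) [NormedAddCommGroup F] [NormedSpace ℝ F]
    [NormedAddCommGroup G] [NormedSpace ℝ G] :
    C(X, F →L[ℝ] G) →L[ℝ] C(X, F) →L[ℝ] C(X, G) :=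
  LinearMap.mkContinuous₂
    (LinearMap.mk₂ ℝ (fun (A : C(X, F →L[ℝ] G)) (h : C(X, F)) =>
        (⟨fun σ => A σ (h σ), by fun_prop⟩ : C(X, G)))
      (fun _ _ _ => by ext; simp) (fun _ _ _ => by ext; simp)
      (fun _ _ _ => by ext; simp) (fun _ _ _ => by ext; simp))
    1 (fun A h => by
      rw [one_mul, ContinuousMap.norm_le _ (by positivity)]
      exact fun σ => (A σ).le_of_opNorm_le_of_le (A.norm_coe_le_norm σ) (h.norm_coe_le_norm σ))

@[simp]
theorem pointwiseApplyL_apply (A : C(X, F →L[ℝ] G)) (h : C(X, F)) (σ : X) :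
    pointwiseApplyL X F G A h σ = A σ (h σ) := rfl

theorem hasFDerivAt_continuousMap_comp {f : C(F, G)} {f' : C(F, F →L[ℝ] G)}
    (hf : ∀ x, HasFDerivAt f (f' x) x) (α : C(X, F)) :
    HasFDerivAt (fun β : C(X, F) => f.comp β) (pointwiseApplyL X F G (f'.comp α)) α := by
  rw [hasFDerivAt_iff_isLittleO, Asymptotics.isLittleO_iff]
  intro ε hε
  have hcont : ContinuousAt (fun β : C(X, F) => f'.comp β) α :=
    (ContinuousMap.continuous_postcomp f').continuousAt
  have hball : ∀ᶠ β in 𝓝 α, f'.comp β ∈ Metric.ball (f'.comp α) ε :=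
    hcont.eventually_mem (Metric.ball_mem_nhds (f'.comp α) hε)
  obtain ⟨δ, hδ, H⟩ := Metric.eventually_nhds_iff.1 hball
  filter_upwards [Metric.ball_mem_nhds α hδ] with β hβ
  rw [ContinuousMap.norm_le _ (by positivity)]
  intro σ
  have key : ‖f (β σ) - f (α σ) - f' (α σ) (β σ - α σ)‖ ≤ ε * ‖β σ - α σ‖ := by
    refine (convex_segment (𝕜 := ℝ) (α σ) (β σ)).norm_image_sub_le_of_norm_hasFDerivWithin_le'
      (fun x _ => (hf x).hasFDerivWithinAt) (fun x hx => ?_)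
      (left_mem_segment ℝ _ _) (right_mem_segment ℝ _ _)
    rw [segment_eq_image'] at hx
    obtain ⟨θ, hθ, rfl⟩ := hx
    have hγ : α + θ • (β - α) ∈ Metric.ball α δ := by
      rw [mem_ball_iff_norm, add_sub_cancel_left, norm_smul, Real.norm_of_nonneg hθ.1]
      exact (mul_le_of_le_one_left (norm_nonneg _) hθ.2).trans_lt (mem_ball_iff_norm.1 hβ)
    have := (ContinuousMap.dist_apply_le_dist σ).trans (H hγ).le
    simpa [dist_eq_norm] using this
  refine le_trans ?_ (key.trans (mul_le_mul_of_nonneg_left ((β - α).norm_coe_le_norm σ) hε.le))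
  simp

theorem contDiff_nat_continuousMap_comp (n : ℕ) {F G : Type v} [NormedAddCommGroup F]
    [NormedSpace ℝ F] [NormedAddCommGroup G] [NormedSpace ℝ G] {f : C(F, G)}
    (hf : ContDiff ℝ ∞ f) : ContDiff ℝ n (fun β : C(X, F) => f.comp β) := by
  induction n generalizing G with
  | zero => exact contDiff_zero.2 (ContinuousMap.continuous_postcomp f)
  | succ n ih =>
    have h := contDiff_infty_iff_fderiv.1 hf
    push_cast
    rw [contDiff_succ_iff_hasFDerivAt]
    exact ⟨_, (pointwiseApplyL X F G).contDiff.comp (ih (f := ⟨_, h.2.continuous⟩) h.2),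
      hasFDerivAt_continuousMap_comp fun x => (h.1 x).hasFDerivAt⟩

/-- Composition with a smooth function is a smooth map between spaces of continuous functions. -/
theorem ContDiff.continuousMap_comp {f : C(F, G)} (hf : ContDiff ℝ ∞ f) :
    ContDiff ℝ ∞ (fun β : C(X, F) => f.comp β) :=
  contDiff_infty.2 fun n => contDiff_nat_continuousMap_comp n hf

end Nemytskii

section
variable {F : Type v} [NormedAddCommGroup F] [NormedSpace ℝ F]

/-- The Volterra operator `α ↦ ∫₀^σ α` on `C([0, 1], F)`. -/
def volterraL (F : Type v) [NormedAddCommGroup F] [NormedSpace ℝ F] :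
    C(unitInterval, F) →L[ℝ] C(unitInterval, F) :=
  LinearMap.mkContinuous
    { toFun := fun α => ⟨fun σ => ∫ τ in (0 : ℝ)..σ, IccExtend zero_le_one α τ, by
        have h : Continuous (IccExtend (zero_le_one' ℝ) α) := α.continuous.Icc_extend'
        exact (intervalIntegral.continuous_primitive (fun a b => h.intervalIntegrable a b) 0).comp
          continuous_subtype_val⟩
      map_add' := fun α β => by
        ext σ
        have h (γ : C(unitInterval, F)) : Continuous (IccExtend (zero_le_one' ℝ) γ) :=
          γ.continuous.Icc_extend'
        exact intervalIntegral.integral_add ((h α).intervalIntegrable _ _)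
          ((h β).intervalIntegrable _ _)
      map_smul' := fun c α => by
        ext σ
        exact intervalIntegral.integral_smul c _ }
    1 (fun α => by
      rw [one_mul, ContinuousMap.norm_le _ (norm_nonneg _)]
      intro σ
      refine (intervalIntegral.norm_integral_le_of_norm_le_const
        fun τ _ => α.norm_coe_le_norm (projIcc 0 1 zero_le_one τ)).trans ?_
      rw [sub_zero, abs_of_nonneg σ.2.1]
      exact mul_le_of_le_one_right (norm_nonneg _) σ.2.2)

theorem volterraL_apply (α : C(unitInterval, F)) (σ : unitInterval) :
    volterraL F α σ = ∫ τ in (0 : ℝ)..σ, IccExtend zero_le_one α τ := rfl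

/-- Solutions on `[0, 1]` of the autonomous equation of a `C¹` vector field are determined by
their initial value. -/
theorem eqOn_of_hasDerivWithinAt_of_contDiff {V : F → F} (hV : ContDiff ℝ 1 V) {s : ℝ} {α β : ℝ → F}
    (hα : ContinuousOn α (Icc 0 1)) (hβ : ContinuousOn β (Icc 0 1))
    (hα' : ∀ σ ∈ Ico (0 : ℝ) 1, HasDerivWithinAt α (s • V (α σ)) (Ici σ) σ)
    (hβ' : ∀ σ ∈ Ico (0 : ℝ) 1, HasDerivWithinAt β (s • V (β σ)) (Ici σ) σ)
    (h0 : α 0 = β 0) : EqOn α β (Icc 0 1) := by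
  have hc := (isCompact_Icc.image_of_continuousOn hα).union (isCompact_Icc.image_of_continuousOn hβ)
  obtain ⟨K, hK⟩ := LocallyLipschitzOn.exists_lipschitzOnWith_of_compact hc
    (ContDiff.locallyLipschitz (𝕂 := ℝ)
      (contDiff_const.smul hV : ContDiff ℝ 1 fun x => s • V x)).locallyLipschitzOn
  exact ODE_solution_unique_of_mem_Icc_right (v := fun _ x => s • V x) (fun _ _ => hK) hα hα'
    (fun σ hσ => Or.inl (mem_image_of_mem _ (Ico_subset_Icc_self hσ))) hβ hβ'
    (fun σ hσ => Or.inr (mem_image_of_mem _ (Ico_subset_Icc_self hσ))) h0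

/-- Group law of the flow of an autonomous `C¹` vector field. -/
theorem flow_add {V : F → F} (hV : ContDiff ℝ 1 V) {Φ : ℝ → F → F} (h0 : ∀ y, Φ 0 y = y)
    (hΦ : ∀ s y, HasDerivAt (fun r => Φ r y) (V (Φ s y)) s) (s h : ℝ) (y : F) :
    Φ (h + s) y = Φ s (Φ h y) := by
  have d1 (σ : ℝ) : HasDerivAt (fun σ => Φ (h + σ * s) y) (s • V (Φ (h + σ * s) y)) σ := by
    simpa [Function.comp_def] using (hΦ _ y).scomp σ (((hasDerivAt_id σ).mul_const s).const_add h)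
  have d2 (z : F) (σ : ℝ) : HasDerivAt (fun σ => Φ (σ * s) z) (s • V (Φ (σ * s) z)) σ := by
    simpa [Function.comp_def] using (hΦ _ z).scomp σ ((hasDerivAt_id σ).mul_const s)
  simpa using eqOn_of_hasDerivWithinAt_of_contDiff hV
    (fun σ _ => (d1 σ).continuousAt.continuousWithinAt)
    (fun σ _ => (d2 (Φ h y) σ).continuousAt.continuousWithinAt)
    (fun σ _ => (d1 σ).hasDerivWithinAt) (fun σ _ => (d2 _ σ).hasDerivWithinAt)
    (by simp [h0]) (right_mem_Icc.2 zero_le_one)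

/-- The flow of a smooth vector field is smooth near time `0`: by the implicit function theorem the
rescaled trajectory `σ ↦ Φ (s σ) y`, as an element of `C([0, 1], F)`, depends smoothly on
`(s, y)`. -/
theorem flow_contDiffAt_zero [CompleteSpace F] {V : F → F} (hV : ContDiff ℝ ∞ V) {Φ : ℝ → F → F}
    (h0 : ∀ y, Φ 0 y = y)
    (hΦ : ∀ s y, HasDerivAt (fun r => Φ r y) (V (Φ s y)) s) (y₀ : F) :
    ContDiffAt ℝ ∞ (fun q : ℝ × F => Φ q.1 q.2) (0, y₀) := by
  let V' : C(F, F) := ⟨V, hV.continuous⟩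
  let f : (ℝ × F) × C(unitInterval, F) → C(unitInterval, F) := fun p =>
    p.2 - ContinuousLinearMap.const ℝ unitInterval p.1.2 - p.1.1 • volterraL F (V'.comp p.2)
  have hf : ContDiff ℝ ∞ f := by
    have h1 : ContDiff ℝ ∞ fun p : (ℝ × F) × C(unitInterval, F) => V'.comp p.2 :=
      (ContDiff.continuousMap_comp hV).comp contDiff_snd
    have h2 := (volterraL F).contDiff (n := ∞) |>.comp h1
    exact (contDiff_snd.sub (by fun_prop)).sub ((contDiff_fst.comp contDiff_fst).smul h2)
  let u₀ : (ℝ × F) × C(unitInterval, F) := ((0, y₀), ContinuousMap.const unitInterval y₀)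
  have hfu : f u₀ = 0 := by ext; simp [f, u₀]
  have hinv : (fderiv ℝ f u₀ ∘L .inr ℝ (ℝ × F) C(unitInterval, F)).IsInvertible := by
    have h1 := ((hf.differentiable (by simp)) u₀).hasFDerivAt.comp u₀.2
      (hasFDerivAt_prodMk_right u₀.1 u₀.2)
    have h2 : HasFDerivAt (fun β : C(unitInterval, F) => f (u₀.1, β))
        (ContinuousLinearMap.id ℝ C(unitInterval, F)) u₀.2 := by
      have : (fun β : C(unitInterval, F) => f (u₀.1, β)) =
          fun β => β - ContinuousMap.const unitInterval y₀ := by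
        ext; simp [f, u₀]
      rw [this]
      exact (hasFDerivAt_id _).sub_const _
    have := h1.unique h2
    rw [this]
    exact ⟨ContinuousLinearEquiv.refl ℝ _, rfl⟩
  have cdf : ContDiffAt ℝ ∞ f u₀ := hf.contDiffAt
  have hψ := cdf.contDiffAt_implicitFunction (by simp) hinv
  have hev := cdf.eventually_apply_implicitFunction (by simp) hinv
  set ψ := cdf.implicitFunction (by simp) hinv
  have hψ1 : ContDiffAt ℝ ∞ (fun q => ψ q 1) (0, y₀) :=
    (ContinuousMap.evalCLM (M := F) ℝ (1 : unitInterval)).contDiff.contDiffAt.comp (0, y₀) hψ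
  refine hψ1.congr_of_eventuallyEq ?_
  filter_upwards [hev] with q hq
  rw [hfu] at hq
  have hψI (σ : unitInterval) : ψ q σ =
      q.2 + q.1 • ∫ τ in (0 : ℝ)..σ, V (IccExtend zero_le_one (ψ q) τ) := by
    have := DFunLike.congr_fun hq σ
    simp only [f, ContinuousMap.sub_apply, ContinuousMap.smul_apply, volterraL_apply] at this
    rw [sub_sub] at this
    exact sub_eq_zero.1 this
  have hc : Continuous (IccExtend (zero_le_one' ℝ) (ψ q)) := (ψ q).continuous.Icc_extend'
  let α : ℝ → F := fun σ => q.2 + q.1 • ∫ τ in (0 : ℝ)..σ, V (IccExtend zero_le_one (ψ q) τ)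
  have hα (σ : ℝ) : HasDerivAt α (q.1 • V (IccExtend zero_le_one (ψ q) σ)) σ :=
    (((hV.continuous.comp hc).integral_hasStrictDerivAt 0 σ).hasDerivAt.const_smul _).const_add _
  have hαψ (σ) (hσ : σ ∈ Icc (0 : ℝ) 1) : IccExtend zero_le_one (ψ q) σ = α σ := by
    rw [IccExtend_of_mem _ _ hσ, hψI]
  have d2 (σ : ℝ) : HasDerivAt (fun σ => Φ (σ * q.1) q.2) (q.1 • V (Φ (σ * q.1) q.2)) σ := by
    simpa [Function.comp_def] using (hΦ _ q.2).scomp σ ((hasDerivAt_id σ).mul_const q.1)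
  have := eqOn_of_hasDerivWithinAt_of_contDiff (hV.of_le (by simp))
    (fun σ _ => (d2 σ).continuousAt.continuousWithinAt)
    (fun σ _ => (hα σ).continuousAt.continuousWithinAt)
    (fun σ _ => (d2 σ).hasDerivWithinAt)
    (fun σ hσ => hαψ σ (Ico_subset_Icc_self hσ) ▸ (hα σ).hasDerivWithinAt)
    (by simp [h0, α]) (right_mem_Icc.2 zero_le_one)
  rw [hψI]
  simpa using this

/-- The flow of a smooth complete vector field is jointly smooth. -/
theorem flow_contDiff [CompleteSpace F] {V : F → F} (hV : ContDiff ℝ ∞ V) {Φ : ℝ → F → F}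
    (h0 : ∀ y, Φ 0 y = y)
    (hΦ : ∀ s y, HasDerivAt (fun r => Φ r y) (V (Φ s y)) s) :
    ContDiff ℝ ∞ (fun q : ℝ × F => Φ q.1 q.2) := by
  refine contDiff_infty.2 fun n => contDiff_iff_contDiffAt.2 ?_
  rintro ⟨s, y⟩
  let S : Set ℝ := {s | ContDiffAt ℝ n (fun q : ℝ × F => Φ q.1 q.2) (s, y)}
  have hΦc : Continuous fun r => Φ r y :=
    continuous_iff_continuousAt.2 fun r => (hΦ r y).continuousAt
  have h0' (z : F) : ContDiffAt ℝ n (fun q : ℝ × F => Φ q.1 q.2) (0, z) :=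
    (flow_contDiffAt_zero hV h0 hΦ z).of_le (by exact_mod_cast le_top)
  have hSo : IsOpen S := isOpen_iff_mem_nhds.2 fun s hs =>
    (Continuous.prodMk_left y).continuousAt.eventually (ContDiffAt.eventually hs (by simp))
  have hSc : IsClosed S := by
    refine isClosed_of_closure_subset fun s hs => ?_
    have hc : ContinuousAt (fun r => (s - r, Φ r y)) s := by fun_prop
    have hev := hc.eventually (by simpa using (h0' (Φ s y)).eventually (by simp))
    obtain ⟨r, hr, hrS⟩ := mem_closure_iff_nhds.1 hs _ hev
    have hcomp : (fun q : ℝ × F => Φ q.1 q.2) = fun q => Φ (q.1 - r) (Φ r q.2) := by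
      ext q
      rw [← flow_add (hV.of_le (by simp)) h0 hΦ, add_sub_cancel]
    have h1 : ContDiffAt ℝ n (fun q : ℝ × F => Φ r q.2) (s, y) :=
      ContDiffAt.comp (g := fun q : ℝ × F => Φ q.1 q.2) (f := fun q : ℝ × F => (r, q.2)) (s, y) hrS
        (by fun_prop)
    change ContDiffAt ℝ n _ _
    rw [hcomp]
    exact ContDiffAt.comp (g := fun q : ℝ × F => Φ q.1 q.2)
      (f := fun q : ℝ × F => (q.1 - r, Φ r q.2)) (s, y) hr
      ((by fun_prop : ContDiffAt ℝ n (fun q : ℝ × F => q.1 - r) (s, y)).prodMk h1)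
  have hS : S = univ := (show IsClopen S from ⟨hSc, hSo⟩).eq_univ ⟨0, h0' y⟩
  exact (hS ▸ mem_univ s : s ∈ S)
end

theorem contDiff_integral_of_compact_support {P E : Type*} [NormedAddCommGroup P] [NormedSpace ℝ P]
    [NormedAddCommGroup E] [NormedSpace ℝ E] {H : ℝ → P → E} {k : Set ℝ} (hk : IsCompact k)
    (hHk : ∀ s p, s ∉ k → H s p = 0) (hH : ContDiff ℝ ∞ fun q : ℝ × P => H q.1 q.2) :
    ContDiff ℝ ∞ fun p => ∫ s, H s p := by
  have hconv := contDiffOn_convolution_right_with_param_comp (𝕜 := ℝ) (n := ⊤) (μ := volume)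
    (ContinuousLinearMap.lsmul ℝ ℝ : ℝ →L[ℝ] E →L[ℝ] E) (s := univ) (v := fun _ : P => (0 : ℝ))
    contDiffOn_const (f := fun _ => (1 : ℝ)) (g := fun p s => H (-s) p) isOpen_univ hk.neg
    (fun p s _ hs => hHk _ _ (by simpa using hs)) (locallyIntegrable_const 1)
    (hH.comp (by fun_prop : ContDiff ℝ ∞ fun q : P × ℝ => (-q.2, q.1))).contDiffOn
  simpa [convolution_def, contDiffOn_univ] using hconv

/-- Averages of `g` against translates of a compactly supported `η` are differentiable in the
translation parameter, and the derivative falls on `η`. -/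
theorem hasDerivAt_integral_smul_comp_add {E : Type*} [NormedAddCommGroup E] [NormedSpace ℝ E]
    {η : ℝ → ℝ} (hη : ContDiff ℝ 1 η) (hηc : HasCompactSupport η) {g : ℝ → E}
    (hg : Continuous g) :
    HasDerivAt (fun τ => ∫ s, η s • g (τ + s)) (-∫ s, deriv η s • g s) 0 := by
  have hd := (hηc.comp_homeomorph (Homeomorph.neg ℝ)).hasDerivAt_convolution_right (μ := volume)
    (ContinuousLinearMap.lsmul ℝ ℝ : ℝ →L[ℝ] E →L[ℝ] E).flip hg.locallyIntegrable
    (hη.comp contDiff_neg) 0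
  have hneg : η ∘ Homeomorph.neg ℝ = fun x => η (-x) := rfl
  rw [hneg] at hd
  convert hd using 1
  · ext τ
    simp only [convolution_def, ContinuousLinearMap.flip_apply, ContinuousLinearMap.lsmul_apply]
    rw [← integral_add_left_eq_self (fun t => η (-(τ - t)) • g t) τ]
    simp
  · simp [convolution_def, deriv_comp_neg, integral_neg]

/-- Mollification along the Lagrangian flow: if `μ(t; ·, ·)` is the flow of `u` started at
time `t` and `R(t,x) := ∫ G(t+s, μ(t; t+s, x)) η(s) ds`, then `R` is smooth and
`(∂ₜ + u·∇) R(t,x) = −∫ G(t+s, μ(t; t+s, x)) η'(s) ds`. -/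
theorem stmt8 (m : ℕ)
    (u : ℝ → E3 → E3)
    (hu : ContDiff ℝ (⊤ : ℕ∞) (fun q : ℝ × E3 => u q.1 q.2))
    (hub : ∀ n : ℕ, ∃ M : ℝ, ∀ (s : ℝ) (x : E3), ‖iteratedFDeriv ℝ n (u s) x‖ ≤ M)
    (μ : ℝ → ℝ → E3 → E3)
    (hμ0 : ∀ (t : ℝ) (x : E3), μ t t x = x)
    (hμ : ∀ (t r : ℝ) (x : E3), HasDerivAt (fun ρ => μ t ρ x) (u r (μ t r x)) r)
    (G : ℝ → E3 → EuclideanSpace ℝ (Fin m))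
    (hG : ContDiff ℝ (⊤ : ℕ∞) (fun q : ℝ × E3 => G q.1 q.2))
    (hGb : ∀ n : ℕ, ∃ M : ℝ, ∀ q : ℝ × E3,
      ‖iteratedFDeriv ℝ n (fun q' : ℝ × E3 => G q'.1 q'.2) q‖ ≤ M)
    (η : ℝ → ℝ) (hη : ContDiff ℝ (⊤ : ℕ∞) η) (hηc : HasCompactSupport η)
    (R : ℝ → E3 → EuclideanSpace ℝ (Fin m))
    (hR : ∀ (t : ℝ) (x : E3), R t x = ∫ s, η s • G (t + s) (μ t (t + s) x)) :
    ContDiff ℝ (⊤ : ℕ∞) (fun q : ℝ × E3 => R q.1 q.2) ∧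
    ∀ (t : ℝ) (x : E3),
      deriv (fun τ => R τ x) t + fderiv ℝ (fun y => R t y) x (u t x)
        = -∫ s, deriv η s • G (t + s) (μ t (t + s) x) := by
  let V : ℝ × E3 → ℝ × E3 := fun q => (1, u q.1 q.2)
  let Φ : ℝ → ℝ × E3 → ℝ × E3 := fun s q => (q.1 + s, μ q.1 (q.1 + s) q.2)
  have hV : ContDiff ℝ ∞ V := contDiff_const.prodMk hu
  have hΦ0 (q : ℝ × E3) : Φ 0 q = q := by simp [Φ, hμ0]
  have hΦ (s : ℝ) (q : ℝ × E3) : HasDerivAt (fun r => Φ r q) (V (Φ s q)) s :=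
    ((hasDerivAt_id s).const_add q.1).prodMk ((hμ q.1 (q.1 + s) q.2).comp_const_add q.1 s)
  have hΦs := flow_contDiff hV hΦ0 hΦ
  have hRs : ContDiff ℝ ∞ fun q : ℝ × E3 => R q.1 q.2 := by
    simp only [hR]
    refine contDiff_integral_of_compact_support
      (H := fun s (q : ℝ × E3) => η s • G (q.1 + s) (μ q.1 (q.1 + s) q.2)) hηc
      (fun s q hs => by simp [image_eq_zero_of_notMem_tsupport hs]) ?_
    exact (hη.comp contDiff_fst).smul (hG.comp hΦs)
  refine ⟨hRs, fun t x => ?_⟩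
  have hD := (hRs.differentiable (by simp) (t, x)).hasFDerivAt
  have ht : HasDerivAt (fun τ => R τ x) _ t :=
    hD.comp_hasDerivAt (f := fun τ => (τ, x)) t ((hasDerivAt_id t).prodMk (hasDerivAt_const t x))
  have hx : HasFDerivAt (fun y => R t y) _ x := hD.comp x (hasFDerivAt_prodMk_right t x)
  have hflow := hΦ 0 (t, x)
  rw [hΦ0] at hflow
  have hD' := hD
  rw [← hΦ0 (t, x)] at hD'
  have h1 := hD'.comp_hasDerivAt 0 hflow
  have h2 := hasDerivAt_integral_smul_comp_add (hη.of_le (by simp)) hηc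
    (g := fun r => G (Φ r (t, x)).1 (Φ r (t, x)).2) (hG.continuous.comp (by fun_prop))
  have heq : (fun q : ℝ × E3 => R q.1 q.2) ∘ (fun r => Φ r (t, x)) =
      fun τ => ∫ s, η s • G (Φ (τ + s) (t, x)).1 (Φ (τ + s) (t, x)).2 := by
    ext1 τ
    simp only [Function.comp_apply, hR, flow_add (hV.of_le (by simp)) hΦ0 hΦ]
    rfl
  rw [heq] at h1
  rw [ht.deriv, hx.fderiv, ← h1.unique h2, hΦ0]
  simp [V, ← map_add]
end
end
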